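/- Let f be a real analytic function whose power series Σ_{i≥1} a_i x^i at 0 has radius of convergence greater than 1 and satisfies f(0) = 0. For n > 1 let p(n) denote the smallest prime divisor of n and P(n) the largest prime divisor of n. Define S_f(x) = Σ_{1 < n ≤ x} f(p(n)/P(n)). Then as x → ∞, S_f(x) = f(1)·x/log x + (2∫₀¹ f(t)/t dt + f(1))·x/(log x)^2 + (9∫₀¹∫₀^s f(t)/(s t) dt ds + 4∫₀¹ f(t)/t dt + 2f(1))·x/(log x)^3 + o(x/(log x)^3). -/

import Mathlib

namespace SmallLargePrime

section

open Complex MeasureTheory Filter Topology Set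

/-- The `n`-th term of the series representing `ζ(s) - 1 / (s - 1)`. -/
noncomputable def zetaTerm (n : ℕ) (s : ℂ) : ℂ :=
  ((n + 1 : ℝ) : ℂ) ^ (-s) - ∫ u in (n + 1 : ℝ)..(n + 2 : ℝ), (u : ℂ) ^ (-s)

lemma continuousOn_ofReal_cpow_neg {a b : ℝ} (ha : 0 < a) (s : ℂ) :
    ContinuousOn (fun u : ℝ => (u : ℂ) ^ (-s)) (Icc a b) := fun _ hu =>
  (continuousAt_ofReal_cpow_const _ _ (Or.inr (ha.trans_le hu.1).ne')).continuousWithinAt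

lemma differentiable_zetaTerm (n : ℕ) : Differentiable ℂ (zetaTerm n) := by
  intro s₀
  have hn : (0 : ℝ) < n + 1 := by positivity
  unfold zetaTerm
  refine DifferentiableAt.sub ?_ ?_
  · exact DifferentiableAt.const_cpow (by fun_prop) (Or.inl (by exact_mod_cast hn.ne'))
  have hle : (n + 1 : ℝ) ≤ n + 2 := by linarith
  have key := intervalIntegral.hasDerivAt_integral_of_dominated_loc_of_deriv_le
    (μ := volume) (a := (n + 1 : ℝ)) (b := (n + 2 : ℝ)) (𝕜 := ℂ)
    (F := fun s u => (u : ℂ) ^ (-s)) (F' := fun s u => -((u : ℂ) ^ (-s) * Complex.log u))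
    (x₀ := s₀) (s := Metric.ball s₀ 1)
    (bound := fun _ => (n + 2 : ℝ) ^ (‖s₀‖ + 1) * Real.log (n + 2))
    (Metric.ball_mem_nhds _ one_pos) ?_ ?_ ?_ ?_ ?_ ?_
  · exact key.2.differentiableAt
  · refine Eventually.of_forall fun s => ?_
    rw [uIoc_of_le hle]
    exact ((continuousOn_ofReal_cpow_neg hn s).mono Ioc_subset_Icc_self).aestronglyMeasurable
      measurableSet_Ioc
  · exact (continuousOn_ofReal_cpow_neg hn s₀).intervalIntegrable_of_Icc hle
  · rw [uIoc_of_le hle]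
    refine ContinuousOn.aestronglyMeasurable ?_ measurableSet_Ioc
    refine (((continuousOn_ofReal_cpow_neg hn s₀).mono Ioc_subset_Icc_self).mul ?_).neg
    intro u hu
    have : (0 : ℝ) < u := hn.trans hu.1
    refine ContinuousAt.continuousWithinAt ?_
    exact (continuousAt_clog (by simp [this])).comp Complex.continuous_ofReal.continuousAt
  · refine Eventually.of_forall fun u hu s hs => ?_
    rw [uIoc_of_le hle] at hu
    have hu0 : (0 : ℝ) < u := hn.trans hu.1
    have hu1 : (1 : ℝ) ≤ u := by
      have := hu.1; have : (0 : ℝ) ≤ n := n.cast_nonneg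
      linarith
    rw [norm_neg, norm_mul, norm_cpow_eq_rpow_re_of_pos hu0, ← Complex.ofReal_log hu0.le,
      Complex.norm_real, Real.norm_of_nonneg (Real.log_nonneg hu1)]
    have hs' : ‖s - s₀‖ < 1 := by simpa [dist_eq_norm] using hs
    have h1 : (-s).re ≤ ‖s₀‖ + 1 := by
      have := Complex.abs_re_le_norm s
      have h2 := norm_le_norm_add_norm_sub' s s₀
      rw [neg_re]
      linarith [neg_abs_le s.re]
    gcongr
    · exact Real.log_nonneg hu1
    · calc u ^ (-s).re ≤ u ^ (‖s₀‖ + 1) := Real.rpow_le_rpow_of_exponent_le hu1 h1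
        _ ≤ _ := Real.rpow_le_rpow hu0.le hu.2 (by positivity)
    · exact hu.2
  · simp
  · refine Eventually.of_forall fun u hu s hs => ?_
    rw [uIoc_of_le hle] at hu
    have hu0 : (0 : ℝ) < u := hn.trans hu.1
    have := (hasDerivAt_neg s).const_cpow (c := (u : ℂ)) (Or.inl (by exact_mod_cast hu0.ne'))
    simpa using! this

lemma norm_cpow_sub_cpow_le {m u : ℝ} (hm : 1 ≤ m) (hu : u ∈ Icc m (m + 1)) {s : ℂ} {θ : ℝ}
    (hs : 0 ≤ s.re) (hθ : θ ∈ Icc (0 : ℝ) 1) :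
    ‖(m : ℂ) ^ (-s) - (u : ℂ) ^ (-s)‖ ≤ 2 * ‖s‖ ^ θ * m ^ (-(s.re + θ)) := by
  have hm0 : 0 < m := by linarith
  have hanti : ∀ {c : ℝ}, 0 ≤ c → ∀ v ∈ Icc m (m + 1), v ^ (-c) ≤ m ^ (-c) := fun hc v hv =>
    Real.rpow_le_rpow_of_nonpos hm0 hv.1 (by linarith)
  have h1 : ‖(m : ℂ) ^ (-s) - (u : ℂ) ^ (-s)‖ ≤ 2 * m ^ (-s.re) := by
    refine (norm_sub_le _ _).trans ?_
    rw [norm_cpow_eq_rpow_re_of_pos hm0, norm_cpow_eq_rpow_re_of_pos (hm0.trans_le hu.1), neg_re]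
    linarith [hanti hs u hu]
  have h2 : ‖(m : ℂ) ^ (-s) - (u : ℂ) ^ (-s)‖ ≤ ‖s‖ * m ^ (-(s.re + 1)) := by
    rw [norm_sub_rev]
    have := (convex_Icc m (m + 1)).norm_image_sub_le_of_norm_hasDerivWithin_le
      (f := fun v : ℝ => (v : ℂ) ^ (-s)) (f' := fun v : ℝ => -s * (v : ℂ) ^ (-s - 1))
      (C := ‖s‖ * m ^ (-(s.re + 1))) (x := m) (y := u) ?_ ?_ (by simp) hu
    · refine this.trans ?_
      have : ‖u - m‖ ≤ 1 := by rw [Real.norm_eq_abs, abs_le]; constructor <;> linarith [hu.1, hu.2]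
      exact mul_le_of_le_one_right (by positivity) this
    · intro v hv
      have hv0 : 0 < v := hm0.trans_le hv.1
      rcases eq_or_ne s 0 with rfl | hs0
      · simpa using hasDerivWithinAt_const v _ (1 : ℂ)
      have := (hasDerivAt_ofReal_cpow_const' hv0.ne' (r := -s - 1)
        (by intro h; apply hs0; linear_combination -h))
      have h3 := this.const_mul (-s)
      have hs1 : -s ≠ 0 := neg_ne_zero.mpr hs0
      refine HasDerivAt.hasDerivWithinAt ?_
      convert! h3 using 1
      ext w
      simp [mul_div_cancel₀, hs0]
    · intro v hv
      have hv0 : 0 < v := hm0.trans_le hv.1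
      rw [norm_mul, norm_neg, norm_cpow_eq_rpow_re_of_pos hv0]
      have := hanti (c := s.re + 1) (by linarith) v hv
      have e : (-s - 1).re = -(s.re + 1) := by simp; ring
      rw [e]
      gcongr
  set a := ‖(m : ℂ) ^ (-s) - (u : ℂ) ^ (-s)‖
  have ha : 0 ≤ a := norm_nonneg _
  calc a = a ^ θ * a ^ (1 - θ) := by
        rw [← Real.rpow_add_of_nonneg ha hθ.1 (by linarith [hθ.2])]; simp
    _ ≤ (‖s‖ * m ^ (-(s.re + 1))) ^ θ * (2 * m ^ (-s.re)) ^ (1 - θ) := by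
        gcongr
        · exact hθ.1
        · linarith [hθ.2]
    _ = 2 ^ (1 - θ) * ‖s‖ ^ θ * m ^ (-(s.re + θ)) := by
        rw [Real.mul_rpow (norm_nonneg _) (by positivity),
          Real.mul_rpow (by norm_num) (by positivity),
          ← Real.rpow_mul hm0.le, ← Real.rpow_mul hm0.le]
        have : m ^ (-(s.re + θ)) = m ^ (-(s.re + 1) * θ) * m ^ (-s.re * (1 - θ)) := by
          rw [← Real.rpow_add hm0]; congr 1; ring
        rw [this]; ring
    _ ≤ _ := by
        gcongr
        calc (2 : ℝ) ^ (1 - θ) ≤ 2 ^ (1 : ℝ) :=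
              Real.rpow_le_rpow_of_exponent_le (by norm_num) (by linarith [hθ.1])
          _ = 2 := by simp

lemma norm_zetaTerm_le (n : ℕ) {s : ℂ} {θ : ℝ} (hs : 0 ≤ s.re) (hθ : θ ∈ Icc (0 : ℝ) 1) :
    ‖zetaTerm n s‖ ≤ 2 * ‖s‖ ^ θ * (n + 1 : ℝ) ^ (-(s.re + θ)) := by
  have hn : (0 : ℝ) < n + 1 := by positivity
  have hle : (n + 1 : ℝ) ≤ n + 2 := by linarith
  have : zetaTerm n s = ∫ u in (n + 1 : ℝ)..(n + 2 : ℝ),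
      (((n + 1 : ℝ) : ℂ) ^ (-s) - (u : ℂ) ^ (-s)) := by
    rw [intervalIntegral.integral_sub (by simp)
      ((continuousOn_ofReal_cpow_neg hn s).intervalIntegrable_of_Icc hle),
      intervalIntegral.integral_const, zetaTerm]
    congr 1
    norm_num
  rw [this]
  refine (intervalIntegral.norm_integral_le_of_norm_le_const
    (C := 2 * ‖s‖ ^ θ * (n + 1 : ℝ) ^ (-(s.re + θ))) fun u hu => ?_).trans ?_
  · rw [uIoc_of_le hle] at hu
    exact norm_cpow_sub_cpow_le (by linarith [(n.cast_nonneg : (0 : ℝ) ≤ n)])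
      ⟨hu.1.le, by linarith [hu.2]⟩ hs hθ
  · norm_num

lemma summable_nat_add_one_rpow_neg {a : ℝ} (ha : 1 < a) :
    Summable fun n : ℕ => (n + 1 : ℝ) ^ (-a) := by
  have := (summable_nat_add_iff 1).mpr (Real.summable_nat_rpow.mpr (show -a < -1 by linarith))
  simpa using this

/-- The function `ζ(s) - 1 / (s - 1)`, as a series converging for `Re s > 0`. -/
noncomputable def zetaReg (s : ℂ) : ℂ := ∑' n, zetaTerm n s

lemma norm_zetaTerm_le_of_re_ge (n : ℕ) {s : ℂ} {η : ℝ} (hη : 0 < η) (hη' : η ≤ 1 / 2)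
    (hs : 1 - η ≤ s.re) :
    ‖zetaTerm n s‖ ≤ 2 * ‖s‖ ^ (2 * η) * (n + 1 : ℝ) ^ (-(1 + η)) := by
  refine (norm_zetaTerm_le n (by linarith) (θ := 2 * η) ⟨by linarith, by linarith⟩).trans ?_
  exact mul_le_mul_of_nonneg_left (Real.rpow_le_rpow_of_exponent_le
    (by linarith [(n.cast_nonneg : (0 : ℝ) ≤ n)]) (by linarith)) (by positivity)

lemma exists_norm_zetaReg_le {η : ℝ} (hη : 0 < η) (hη' : η ≤ 1 / 2) :
    ∃ C, 0 < C ∧ ∀ s : ℂ, 1 - η ≤ s.re → ‖zetaReg s‖ ≤ C * ‖s‖ ^ (2 * η) := by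
  have hsum := summable_nat_add_one_rpow_neg (show 1 < 1 + η by linarith)
  refine ⟨2 * ∑' n : ℕ, (n + 1 : ℝ) ^ (-(1 + η)), ?_, fun s hs => ?_⟩
  · have := hsum.tsum_pos (fun n => by positivity) 0 (by positivity)
    positivity
  · have := tsum_of_norm_bounded (hsum.mul_left (2 * ‖s‖ ^ (2 * η))).hasSum
      fun n => norm_zetaTerm_le_of_re_ge n hη hη' hs
    rw [tsum_mul_left] at this
    unfold zetaReg
    linarith

lemma differentiableOn_zetaReg {η : ℝ} (hη : 0 < η) (hη' : η ≤ 1 / 2) :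
    DifferentiableOn ℂ zetaReg {s | 1 - η < s.re} := by
  intro s hs
  have hsum := summable_nat_add_one_rpow_neg (show 1 < 1 + η by linarith)
  have hopen : IsOpen ({s : ℂ | 1 - η < s.re} ∩ Metric.ball 0 (‖s‖ + 1)) :=
    (isOpen_lt continuous_const Complex.continuous_re).inter Metric.isOpen_ball
  have := differentiableOn_tsum_of_summable_norm (F := zetaTerm)
    (hsum.mul_left (2 * (‖s‖ + 1) ^ (2 * η)))
    (fun n => (differentiable_zetaTerm n).differentiableOn) hopen ?_
  · exact (this.differentiableAt (hopen.mem_nhds ⟨hs, by simp⟩)).differentiableWithinAt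
  · intro n w hw
    refine (norm_zetaTerm_le_of_re_ge n hη hη' hw.1.le).trans ?_
    have : ‖w‖ ≤ ‖s‖ + 1 := by simpa using (Metric.mem_ball.mp hw.2).le
    gcongr

lemma zetaReg_eq {s : ℂ} (hs : 1 < s.re) : zetaReg s = riemannZeta s - 1 / (s - 1) := by
  have hsum := summable_nat_add_one_rpow_neg (show (1 : ℝ) < 1 + 1 / 2 by norm_num)
  have h1 : Summable fun n => zetaTerm n s :=
    .of_norm_bounded (hsum.mul_left _) fun n =>
      norm_zetaTerm_le_of_re_ge n (η := 1 / 2) (by norm_num) le_rfl (by linarith)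
  have h2 : Summable fun n : ℕ => ((n + 1 : ℝ) : ℂ) ^ (-s) := by
    have := (summable_nat_add_iff 1).mpr (Complex.summable_one_div_nat_cpow.mpr hs)
    refine this.congr fun n => ?_
    rw [cpow_neg, one_div]; push_cast; rfl
  have h3 : ∑' n : ℕ, ((n + 1 : ℝ) : ℂ) ^ (-s) = riemannZeta s := by
    rw [zeta_eq_tsum_one_div_nat_add_one_cpow hs]
    refine tsum_congr fun n => ?_
    rw [cpow_neg, one_div]; push_cast; rfl
  have h4 : Summable fun n : ℕ => ∫ u in (n + 1 : ℝ)..(n + 2 : ℝ), (u : ℂ) ^ (-s) := by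
    refine (h2.sub h1).congr fun n => ?_
    simp [zetaTerm]
  have h5 : ∑' n : ℕ, ∫ u in (n + 1 : ℝ)..(n + 2 : ℝ), (u : ℂ) ^ (-s) = 1 / (s - 1) := by
    refine tendsto_nhds_unique h4.hasSum.tendsto_sum_nat ?_
    have hs1 : s ≠ 1 := by rintro rfl; simp at hs
    have e : ∀ N : ℕ, ∑ n ∈ Finset.range N, ∫ u in (n + 1 : ℝ)..(n + 2 : ℝ), (u : ℂ) ^ (-s)
        = (((N + 1 : ℝ) : ℂ) ^ (-s + 1) - 1) / (-s + 1) := by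
      intro N
      have := intervalIntegral.sum_integral_adjacent_intervals (μ := volume)
        (f := fun u : ℝ => (u : ℂ) ^ (-s)) (a := fun n : ℕ => (n + 1 : ℝ)) (n := N) ?_
      · have e2 : ∀ n : ℕ, (((n + 1 : ℕ) : ℝ) + 1) = n + 2 := fun n => by push_cast; ring
        simp only [e2] at this
        rw [this, integral_cpow]
        · simp
        · right
          refine ⟨fun h => hs1 (by linear_combination -h), ?_⟩
          rw [uIcc_of_le (by simp)]
          simp
      · intro n _
        exact (continuousOn_ofReal_cpow_neg (by positivity) s).intervalIntegrable_of_Icc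
          (by push_cast; linarith)
    simp_rw [e]
    have : Tendsto (fun N : ℕ => ((N + 1 : ℝ) : ℂ) ^ (-s + 1)) atTop (𝓝 0) := by
      rw [tendsto_zero_iff_norm_tendsto_zero]
      have e3 : ∀ N : ℕ, ‖((N + 1 : ℝ) : ℂ) ^ (-s + 1)‖ = (N + 1 : ℝ) ^ (-(s.re - 1)) := fun N => by
        rw [norm_cpow_eq_rpow_re_of_pos (by positivity)]; congr 1; simp; ring
      simp_rw [e3]
      exact (tendsto_rpow_neg_atTop (by linarith)).comp
        (tendsto_atTop_add_const_right _ _ tendsto_natCast_atTop_atTop)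
    have h6 := (this.sub_const 1).div_const (-s + 1)
    convert! h6 using 2
    rw [zero_sub, neg_div, ← div_neg, neg_add_rev, neg_neg, sub_eq_add_neg, add_comm]
  unfold zetaReg
  rw [← h3, ← h5, ← h2.tsum_sub h4]
  rfl

/-- The function `(s - 1) ζ(s)`. -/
noncomputable def zetaNum (s : ℂ) : ℂ := 1 + (s - 1) * zetaReg s

/-- The function `-ζ'(s) / ζ(s) - ζ(s)`, without its removable singularity at `s = 1`. -/
noncomputable def logDerivReg (s : ℂ) : ℂ := -(deriv zetaNum s / zetaNum s) - zetaReg s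

lemma isOpen_halfPlane (a : ℝ) : IsOpen {s : ℂ | a < s.re} :=
  isOpen_lt continuous_const Complex.continuous_re

lemma differentiableOn_zetaReg' : DifferentiableOn ℂ zetaReg {s | 139 / 140 < s.re} := by
  have := differentiableOn_zetaReg (η := 1 / 140) (by norm_num) (by norm_num)
  norm_num at this
  exact this

lemma differentiableOn_zetaNum : DifferentiableOn ℂ zetaNum {s | 139 / 140 < s.re} := by
  unfold zetaNum
  exact ((differentiableOn_id.sub_const _).mul differentiableOn_zetaReg').const_add _

lemma zetaNum_eq {s : ℂ} (hs : 1 < s.re) : zetaNum s = (s - 1) * riemannZeta s := by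
  have hs1 : s - 1 ≠ 0 := by
    intro h
    rw [sub_eq_zero.mp h] at hs
    simp at hs
  rw [zetaNum, zetaReg_eq hs]
  field_simp
  ring

lemma zetaNum_ne_zero {s : ℂ} (hs : 1 ≤ s.re) : zetaNum s ≠ 0 := by
  rcases eq_or_ne s 1 with rfl | hs1
  · simp [zetaNum]
  have key : zetaNum s = (s - 1) * riemannZeta s := by
    have h1 : Tendsto (fun ε : ℝ => s + ε) (𝓝[>] 0) (𝓝 s) := by
      have : Continuous fun ε : ℝ => s + ε := by fun_prop
      have := this.tendsto 0
      simp only [ofReal_zero, add_zero] at this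
      exact this.mono_left nhdsWithin_le_nhds
    have h2 : ContinuousAt zetaNum s :=
      (differentiableOn_zetaNum.differentiableAt ((isOpen_halfPlane _).mem_nhds
        (show 139 / 140 < s.re by linarith))).continuousAt
    have h3 : ContinuousAt (fun s => (s - 1) * riemannZeta s) s :=
      ContinuousAt.mul (by fun_prop) (differentiableAt_riemannZeta hs1).continuousAt
    refine tendsto_nhds_unique (h2.tendsto.comp h1) ((h3.tendsto.comp h1).congr' ?_)
    filter_upwards [self_mem_nhdsWithin] with ε hε
    have hε : 0 < ε := hε
    exact (zetaNum_eq (by simp; linarith)).symm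
  rw [key]
  exact mul_ne_zero (sub_ne_zero.mpr hs1) (riemannZeta_ne_zero_of_one_le_re hs)

lemma zetaNum_bounds : ∃ C, 1 ≤ C ∧ ∀ T : ℝ, 1 ≤ T → ∀ s : ℂ,
    279 / 280 ≤ s.re → s.re ≤ 3 → |s.im| ≤ 2 * T →
    ‖zetaReg s‖ ≤ C * T ^ (1 / 70 : ℝ) ∧ ‖zetaNum s‖ ≤ C * (T * T ^ (1 / 70 : ℝ)) ∧
      ‖deriv zetaNum s‖ ≤ C * (T * T ^ (1 / 70 : ℝ)) := by
  obtain ⟨C, hC, h⟩ := exists_norm_zetaReg_le (η := 1 / 140) (by norm_num) (by norm_num)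
  have h1 : ∀ T : ℝ, 1 ≤ T → ∀ s : ℂ, 139 / 140 ≤ s.re → s.re ≤ 4 → |s.im| ≤ 3 * T →
      ‖zetaReg s‖ ≤ 7 * C * T ^ (1 / 70 : ℝ) ∧
      ‖zetaNum s‖ ≤ (1 + 56 * C) * (T * T ^ (1 / 70 : ℝ)) := by
    intro T hT s hs1 hs2 hs3
    have hn : ‖s‖ ≤ 7 * T := by
      have := Complex.norm_le_abs_re_add_abs_im s
      rw [abs_of_nonneg (by linarith)] at this
      linarith
    have hq : 1 ≤ T ^ (1 / 70 : ℝ) := Real.one_le_rpow hT (by norm_num)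
    have hZ : ‖zetaReg s‖ ≤ 7 * C * T ^ (1 / 70 : ℝ) := by
      refine (h s (by linarith)).trans ?_
      have : ‖s‖ ^ (2 * (1 / 140) : ℝ) ≤ 7 * T ^ (1 / 70 : ℝ) := by
        calc ‖s‖ ^ (2 * (1 / 140) : ℝ) ≤ (7 * T) ^ (2 * (1 / 140) : ℝ) := by gcongr
          _ = 7 ^ (1 / 70 : ℝ) * T ^ (1 / 70 : ℝ) := by
            rw [Real.mul_rpow (by norm_num) (by linarith)]; norm_num
          _ ≤ 7 ^ (1 : ℝ) * T ^ (1 / 70 : ℝ) := by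
            gcongr
            · norm_num
            · norm_num
          _ = _ := by norm_num
      nlinarith
    refine ⟨hZ, ?_⟩
    have hm : ‖s - 1‖ ≤ 8 * T := by
      refine (norm_sub_le _ _).trans ?_
      simp; linarith
    calc ‖zetaNum s‖ ≤ 1 + ‖s - 1‖ * ‖zetaReg s‖ := by
          refine (norm_add_le _ _).trans ?_
          simp
      _ ≤ 1 + 8 * T * (7 * C * T ^ (1 / 70 : ℝ)) := by gcongr
      _ ≤ _ := by nlinarith
  refine ⟨300 * (1 + 56 * C), by linarith, fun T hT s hs1 hs2 hs3 => ?_⟩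
  have hq : 1 ≤ T ^ (1 / 70 : ℝ) := Real.one_le_rpow hT (by norm_num)
  have h2 := h1 T hT s (by linarith) (by linarith) (by linarith)
  have hTq : 0 ≤ T * T ^ (1 / 70 : ℝ) := by positivity
  refine ⟨h2.1.trans (by nlinarith), h2.2.trans (by nlinarith), ?_⟩
  have mem : ∀ z ∈ Metric.closedBall s (1 / 300), 139 / 140 ≤ z.re ∧ z.re ≤ 4 ∧ |z.im| ≤ 3 * T := by
    intro z hz
    have hz : ‖z - s‖ ≤ 1 / 300 := by simpa [dist_eq_norm] using hz
    have h3 := (Complex.abs_re_le_norm (z - s)).trans hz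
    have h4 := (Complex.abs_im_le_norm (z - s)).trans hz
    simp only [sub_re, sub_im, abs_le] at h3 h4
    have h5 := abs_le.mp hs3
    exact ⟨by linarith, by linarith, abs_le.mpr ⟨by linarith, by linarith⟩⟩
  have h3 := Complex.norm_deriv_le_of_forall_mem_sphere_norm_le (c := s) (R := 1 / 300)
    (C := (1 + 56 * C) * (T * T ^ (1 / 70 : ℝ))) (f := zetaNum) (by norm_num) ?_ ?_
  · exact h3.trans (by linarith)
  · refine DifferentiableOn.diffContOnCl_ball (U := {s | 139 / 140 < s.re})
      differentiableOn_zetaNum fun z hz => ?_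
    have hz : ‖z - s‖ ≤ 1 / 300 := by simpa [dist_eq_norm] using hz
    have h3 := (Complex.abs_re_le_norm (z - s)).trans hz
    simp only [sub_re, abs_le] at h3
    show 139 / 140 < z.re
    linarith
  · intro z hz
    have := mem z (Metric.sphere_subset_closedBall hz)
    exact (h1 T hT z this.1 this.2.1 this.2.2).2

lemma one_le_zeta_product {σ : ℝ} (hσ : 1 < σ) (t : ℝ) :
    1 ≤ ‖riemannZeta σ‖ ^ 3 * ‖riemannZeta (σ + t * I)‖ ^ 4 * ‖riemannZeta (σ + 2 * t * I)‖ := by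
  have h := DirichletCharacter.norm_LFunction_product_ge_one (N := 1) 1 (x := σ - 1)
    (by linarith) t
  rw [DirichletCharacter.LFunctionTrivChar, DirichletCharacter.LFunction_modOne_eq,
    DirichletCharacter.LFunction_modOne_eq] at h
  simp only [norm_mul, norm_pow] at h
  have e1 : (1 : ℂ) + ((σ - 1 : ℝ) : ℂ) = σ := by push_cast; ring
  have e2 : (2 * I * t : ℂ) = 2 * t * I := by ring
  rw [e1, mul_comm I, e2] at h
  exact h

lemma exists_le_norm_zetaNum : ∃ C, 1 ≤ C ∧ ∀ T : ℝ, 1 ≤ T → ∀ σ ∈ Ioc (1 : ℝ) 2, ∀ t : ℝ,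
    |t| = T → (σ - 1) ^ 3 * T ^ 4 ≤ C * T ^ (1 / 70 : ℝ) * ‖zetaNum (σ + t * I)‖ ^ 4 := by
  obtain ⟨C, hC, h⟩ := zetaNum_bounds
  refine ⟨C ^ 3 * (C + 1), one_le_mul_of_one_le_of_one_le (one_le_pow₀ hC) (by linarith),
    fun T hT σ hσ t ht => ?_⟩
  have hσ1 : 0 < σ - 1 := by linarith [hσ.1]
  have hq : 1 ≤ T ^ (1 / 70 : ℝ) := Real.one_le_rpow hT (by norm_num)
  have h341 := one_le_zeta_product hσ.1 t
  have hA : (σ - 1) * ‖riemannZeta σ‖ ≤ C := by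
    have := (h 1 le_rfl σ (by simp; linarith) (by simp; linarith [hσ.2]) (by simp)).2.1
    rw [zetaNum_eq (by simpa using hσ.1), norm_mul] at this
    simp only [Real.one_rpow, mul_one] at this
    have e : ‖(σ : ℂ) - 1‖ = σ - 1 := by
      rw [← ofReal_one, ← ofReal_sub, norm_real, Real.norm_of_nonneg hσ1.le]
    rwa [e] at this
  have hB : T * ‖riemannZeta (σ + t * I)‖ ≤ ‖zetaNum (σ + t * I)‖ := by
    rw [zetaNum_eq (by simpa using hσ.1), norm_mul]
    gcongr
    have := Complex.abs_im_le_norm ((σ + t * I : ℂ) - 1)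
    simpa [ht] using this
  have hD : ‖riemannZeta (σ + 2 * t * I)‖ ≤ (C + 1) * T ^ (1 / 70 : ℝ) := by
    have h1 := (h T hT (σ + 2 * t * I) (by simp; linarith) (by simp; linarith [hσ.2])
      (by simp [ht])).1
    rw [zetaReg_eq (by simpa using hσ.1)] at h1
    have h2 : ‖1 / ((σ + 2 * t * I : ℂ) - 1)‖ ≤ 1 := by
      rw [norm_div, norm_one]
      apply div_le_one_of_le₀ _ (norm_nonneg _)
      have := Complex.abs_im_le_norm ((σ + 2 * t * I : ℂ) - 1)
      simp [ht] at this
      linarith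
    have h3 := norm_le_norm_add_norm_sub' (riemannZeta (σ + 2 * t * I))
      (1 / ((σ + 2 * t * I : ℂ) - 1))
    linarith
  set a := ‖riemannZeta σ‖
  set b := ‖riemannZeta (σ + t * I)‖
  set d := ‖riemannZeta (σ + 2 * t * I)‖
  calc (σ - 1) ^ 3 * T ^ 4 ≤ (σ - 1) ^ 3 * T ^ 4 * (a ^ 3 * b ^ 4 * d) :=
        le_mul_of_one_le_right (by positivity) h341
    _ = ((σ - 1) * a) ^ 3 * d * (T * b) ^ 4 := by ring
    _ ≤ C ^ 3 * ((C + 1) * T ^ (1 / 70 : ℝ)) * ‖zetaNum (σ + t * I)‖ ^ 4 := by gcongr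
    _ = _ := by ring

/-- A quantitative non-vanishing of `ζ` near the line `Re s = 1`. -/
lemma exists_le_norm_zetaNum' : ∃ c, 0 < c ∧ c ≤ 1 / 300 ∧ ∀ T : ℝ, 1 ≤ T →
    ∀ s₀ : ℂ, 1 ≤ s₀.re → s₀.re ≤ 2 → |s₀.im| = T →
    ∀ s, ‖s - s₀‖ ≤ c / (T ^ (1 / 70 : ℝ)) ^ 5 →
    c * T / (T ^ (1 / 70 : ℝ)) ^ 4 ≤ ‖zetaNum s‖ := by
  obtain ⟨C, hC, h⟩ := zetaNum_bounds
  obtain ⟨D, hD, hlow⟩ := exists_le_norm_zetaNum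
  obtain ⟨c, hc0, hc1, hc2⟩ : ∃ c : ℝ, 0 < c ∧ c ≤ 1 / 300 ∧ D * (3 * C) ^ 4 * c ≤ 1 := by
    refine ⟨min (1 / 300) (1 / (D * (3 * C) ^ 4)), by positivity, min_le_left _ _, ?_⟩
    calc D * (3 * C) ^ 4 * min (1 / 300) (1 / (D * (3 * C) ^ 4))
        ≤ D * (3 * C) ^ 4 * (1 / (D * (3 * C) ^ 4)) := by gcongr; exact min_le_right _ _
      _ = 1 := by field_simp
  refine ⟨c, hc0, hc1, fun T hT s₀ h1 h2 h3 s hs => ?_⟩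
  have hq : 1 ≤ T ^ (1 / 70 : ℝ) := Real.one_le_rpow hT (by norm_num)
  set q := T ^ (1 / 70 : ℝ)
  set δ := c / q ^ 5 with hδ
  have hδ0 : 0 < δ := by positivity
  have hδ1 : δ ≤ 1 / 300 := by
    rw [hδ]
    exact (div_le_self hc0.le (one_le_pow₀ hq)).trans hc1
  have main : ∀ σ : ℝ, 1 + δ ≤ σ → σ ≤ 2 → ∀ t : ℝ, |t| = T →
      3 * C * δ * (T * q) ≤ ‖zetaNum (σ + t * I)‖ := by
    intro σ hσ hσ2 t ht
    have h4 := hlow T hT σ ⟨by linarith, hσ2⟩ t ht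
    have h5 : δ ^ 3 * T ^ 4 ≤ D * q * ‖zetaNum (σ + t * I)‖ ^ 4 := by
      refine le_trans ?_ h4
      gcongr
      linarith
    have h6 : D * q * (3 * C * δ * (T * q)) ^ 4 ≤ D * q * ‖zetaNum (σ + t * I)‖ ^ 4 := by
      refine le_trans ?_ h5
      have : δ * q ^ 5 = c := by rw [hδ]; field_simp
      calc D * q * (3 * C * δ * (T * q)) ^ 4 = D * (3 * C) ^ 4 * (δ * q ^ 5) * (δ ^ 3 * T ^ 4) := by
            ring
        _ = D * (3 * C) ^ 4 * c * (δ ^ 3 * T ^ 4) := by rw [this]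
        _ ≤ 1 * (δ ^ 3 * T ^ 4) := by gcongr
        _ = _ := one_mul _
    exact le_of_pow_le_pow_left₀ (by norm_num) (norm_nonneg _)
      (le_of_mul_le_mul_left h6 (by positivity))
  set w : ℂ := ((max s₀.re (1 + δ) : ℝ) : ℂ) + s₀.im * I with hw
  have hwre : w.re = max s₀.re (1 + δ) := by simp [hw]
  have hwim : w.im = s₀.im := by simp [hw]
  have hwlow : 3 * C * δ * (T * q) ≤ ‖zetaNum w‖ :=
    main _ (le_max_right _ _) (max_le h2 (by linarith)) _ h3
  have hws : ‖w - s₀‖ ≤ δ := by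
    have : w - s₀ = ((max s₀.re (1 + δ) - s₀.re : ℝ) : ℂ) := by
      apply Complex.ext <;> simp [hwre, hwim]
    rw [this, norm_real, Real.norm_eq_abs, abs_of_nonneg (by linarith [le_max_left s₀.re (1 + δ)])]
    linarith [max_le (show s₀.re ≤ s₀.re + δ by linarith) (show 1 + δ ≤ s₀.re + δ by linarith)]
  have mem : ∀ z ∈ Metric.closedBall s₀ δ, 279 / 280 ≤ z.re ∧ z.re ≤ 3 ∧ |z.im| ≤ 2 * T := by
    intro z hz
    have hz : ‖z - s₀‖ ≤ δ := by simpa [dist_eq_norm] using hz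
    have h4 := (Complex.abs_re_le_norm (z - s₀)).trans hz
    have h5 := (Complex.abs_im_le_norm (z - s₀)).trans hz
    simp only [sub_re, sub_im, abs_le] at h4 h5
    have h6 := abs_le.mp h3.le
    exact ⟨by linarith, by linarith, abs_le.mpr ⟨by linarith, by linarith⟩⟩
  have hsub := (convex_closedBall s₀ δ).norm_image_sub_le_of_norm_deriv_le
    (f := zetaNum) (C := C * (T * q)) (x := s) (y := w) (fun z hz => ?_) (fun z hz => ?_)
    (by simpa [dist_eq_norm] using hs) (by simpa [dist_eq_norm] using hws)
  · have h7 : ‖w - s‖ ≤ 2 * δ := by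
      have := norm_sub_le_norm_sub_add_norm_sub w s₀ s
      rw [norm_sub_rev s₀ s] at this
      linarith
    have h8 : C * (T * q) * ‖w - s‖ ≤ 2 * C * δ * (T * q) := by
      calc _ ≤ C * (T * q) * (2 * δ) := by gcongr
        _ = _ := by ring
    have h9 := norm_le_norm_add_norm_sub' (zetaNum w) (zetaNum s)
    have h10 : c * T / q ^ 4 = δ * (T * q) := by rw [hδ]; field_simp
    have h11 : δ * (T * q) ≤ C * (δ * (T * q)) := le_mul_of_one_le_left (by positivity) hC
    rw [h10]
    linarith
  · exact differentiableOn_zetaNum.differentiableAt ((isOpen_halfPlane _).mem_nhds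
      (show 139 / 140 < z.re by linarith [(mem z hz).1]))
  · exact (h T hT z (mem z hz).1 (mem z hz).2.1 (mem z hz).2.2).2.2

lemma isOpen_zetaNum_ne_zero : IsOpen ({s : ℂ | 139 / 140 < s.re} ∩ {s | zetaNum s ≠ 0}) :=
  differentiableOn_zetaNum.continuousOn.isOpen_inter_preimage (isOpen_halfPlane _)
    isOpen_compl_singleton

lemma differentiableOn_logDerivReg :
    DifferentiableOn ℂ logDerivReg ({s : ℂ | 139 / 140 < s.re} ∩ {s | zetaNum s ≠ 0}) := by
  unfold logDerivReg
  have h1 := differentiableOn_zetaNum.mono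
    (inter_subset_left (s := {s : ℂ | 139 / 140 < s.re}) (t := {s | zetaNum s ≠ 0}))
  have h2 := differentiableOn_zetaReg'.mono
    (inter_subset_left (s := {s : ℂ | 139 / 140 < s.re}) (t := {s | zetaNum s ≠ 0}))
  exact ((h1.deriv isOpen_zetaNum_ne_zero).div h1 fun s hs => hs.2).neg.sub h2

lemma norm_iteratedDeriv_logDerivReg_le_of_one_le_im (k : ℕ) : ∃ C, ∀ s : ℂ, 1 ≤ s.re →
    s.re ≤ 2 → 1 ≤ |s.im| →
    ‖iteratedDeriv k logDerivReg s‖ ≤ C * (|s.im| ^ (1 / 70 : ℝ)) ^ (5 * (k + 1)) := by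
  obtain ⟨C, hC, h⟩ := zetaNum_bounds
  obtain ⟨c, hc0, hc1, hlow⟩ := exists_le_norm_zetaNum'
  refine ⟨k.factorial * (C / c + C) / c ^ k, fun s hs1 hs2 hs3 => ?_⟩
  obtain ⟨T, hT⟩ : ∃ T, T = |s.im| := ⟨_, rfl⟩
  have hT1 : 1 ≤ T := hT ▸ hs3
  rw [← hT]
  have hq : 1 ≤ T ^ (1 / 70 : ℝ) := Real.one_le_rpow hT1 (by norm_num)
  have hlow' := hlow T hT1 s hs1 hs2 hT.symm
  have h' := h T hT1
  set q := T ^ (1 / 70 : ℝ)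
  set δ := c / q ^ 5 with hδ
  have hδ0 : 0 < δ := by positivity
  have hδ1 : δ ≤ 1 / 300 := by
    rw [hδ]
    exact (div_le_self hc0.le (one_le_pow₀ hq)).trans hc1
  have mem : ∀ z ∈ Metric.closedBall s δ, 279 / 280 ≤ z.re ∧ z.re ≤ 3 ∧ |z.im| ≤ 2 * T := by
    intro z hz
    have hz : ‖z - s‖ ≤ δ := by simpa [dist_eq_norm] using hz
    have h4 := (Complex.abs_re_le_norm (z - s)).trans hz
    have h5 := (Complex.abs_im_le_norm (z - s)).trans hz
    simp only [sub_re, sub_im, abs_le] at h4 h5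
    have h6 := abs_le.mp hT.ge
    exact ⟨by linarith, by linarith, abs_le.mpr ⟨by linarith, by linarith⟩⟩
  have mem' : ∀ z ∈ Metric.closedBall s δ, c * T / q ^ 4 ≤ ‖zetaNum z‖ := fun z hz =>
    hlow' z (by simpa [dist_eq_norm] using hz)
  have hpos : 0 < c * T / q ^ 4 := by positivity
  have key := Complex.norm_iteratedDeriv_le_of_forall_mem_sphere_norm_le (c := s) (R := δ)
    (C := (C / c + C) * q ^ 5) (f := logDerivReg) k hδ0 ?_ ?_
  · refine key.trans (le_of_eq ?_)
    rw [hδ, div_pow]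
    field_simp
    ring
  · refine differentiableOn_logDerivReg.diffContOnCl_ball fun z hz => ⟨?_, ?_⟩
    · show 139 / 140 < z.re
      linarith [(mem z hz).1]
    · exact norm_pos_iff.mp (hpos.trans_le (mem' z hz))
  · intro z hz
    have hz := Metric.sphere_subset_closedBall hz
    obtain ⟨m1, m2, m3⟩ := mem z hz
    obtain ⟨b1, -, b3⟩ := h' z m1 m2 m3
    have b4 : ‖deriv zetaNum z / zetaNum z‖ ≤ C / c * q ^ 5 := by
      rw [norm_div]
      calc ‖deriv zetaNum z‖ / ‖zetaNum z‖ ≤ C * (T * q) / (c * T / q ^ 4) := by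
            gcongr
            exact mem' z hz
        _ = _ := by field_simp
    have b5 : C * q ≤ C * q ^ 5 := by
      gcongr
      exact le_self_pow₀ hq (by norm_num)
    calc ‖logDerivReg z‖ ≤ ‖deriv zetaNum z / zetaNum z‖ + ‖zetaReg z‖ := by
          refine (norm_sub_le _ _).trans ?_
          rw [norm_neg]
      _ ≤ _ := by linarith

lemma exists_norm_iteratedDeriv_logDerivReg_le : ∃ C, 0 < C ∧ ∀ s : ℂ, 1 ≤ s.re →
    s.re ≤ 2 → ‖iteratedDeriv 6 logDerivReg s‖ ≤ C * (1 + |s.im|) ^ (1 / 2 : ℝ) := by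
  obtain ⟨C, hC⟩ := norm_iteratedDeriv_logDerivReg_le_of_one_le_im 6
  have hcont : ContinuousOn (iteratedDeriv 6 logDerivReg) (Icc 1 2 ×ℂ Icc (-1) 1) := by
    have h1 := (differentiableOn_logDerivReg.analyticOnNhd isOpen_zetaNum_ne_zero).iterated_deriv 6
    rw [← iteratedDeriv_eq_iterate] at h1
    refine h1.continuousOn.mono fun s hs => ⟨?_, zetaNum_ne_zero hs.1.1⟩
    have := hs.1.1
    show 139 / 140 < s.re
    linarith
  obtain ⟨D, hD⟩ := (isCompact_Icc.reProdIm isCompact_Icc).exists_bound_of_continuousOn hcont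
  refine ⟨max (max C D) 1, by positivity, fun s h1 h2 => ?_⟩
  have h1' : 1 ≤ (1 + |s.im|) ^ (1 / 2 : ℝ) :=
    Real.one_le_rpow (by linarith [abs_nonneg s.im]) (by norm_num)
  rcases le_total 1 |s.im| with h | h
  · refine (hC s h1 h2 h).trans ?_
    have : (|s.im| ^ (1 / 70 : ℝ)) ^ (5 * (6 + 1)) ≤ (1 + |s.im|) ^ (1 / 2 : ℝ) := by
      rw [← Real.rpow_natCast, ← Real.rpow_mul (abs_nonneg _)]
      norm_num
      gcongr
      linarith
    gcongr
    exact (le_max_left _ _).trans (le_max_left _ _)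
  · have := hD s ⟨⟨h1, h2⟩, abs_le.mp h⟩
    calc _ ≤ D := this
      _ ≤ max (max C D) 1 := (le_max_right _ _).trans (le_max_left _ _)
      _ ≤ _ := le_mul_of_one_le_right (by positivity) h1'

/-- The coefficient `(Λ(n) - 1) (log n)⁶`. -/
noncomputable def logCoeff (n : ℕ) : ℝ := (ArithmeticFunction.vonMangoldt n - 1) * Real.log n ^ 6

lemma logDerivReg_eq {s : ℂ} (hs : 1 < s.re) :
    logDerivReg s = LSeries (fun n => ((ArithmeticFunction.vonMangoldt n - 1 : ℝ) : ℂ)) s := by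
  have hs1 : s ≠ 1 := by rintro rfl; simp at hs
  have h1 : (fun n : ℕ => ((ArithmeticFunction.vonMangoldt n - 1 : ℝ) : ℂ))
      = (fun n : ℕ => (ArithmeticFunction.vonMangoldt n : ℂ)) - 1 := by
    ext n; simp
  rw [h1, LSeries_sub (ArithmeticFunction.LSeriesSummable_vonMangoldt hs)
    (LSeriesSummable_one_iff.mpr hs), LSeries_one_eq_riemannZeta hs,
    ArithmeticFunction.LSeries_vonMangoldt_eq_deriv_riemannZeta_div hs]
  have h2 : zetaNum =ᶠ[𝓝 s] fun s => (s - 1) * riemannZeta s := by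
    filter_upwards [(isOpen_halfPlane 1).mem_nhds hs] with z hz using zetaNum_eq hz
  have h3 : deriv zetaNum s = riemannZeta s + (s - 1) * deriv riemannZeta s := by
    rw [h2.deriv_eq, deriv_fun_mul (by fun_prop) (differentiableAt_riemannZeta hs1)]
    simp
  rw [logDerivReg, h3, zetaNum_eq hs, zetaReg_eq hs]
  have h4 := riemannZeta_ne_zero_of_one_le_re hs.le
  have h5 := sub_ne_zero.mpr hs1
  field_simp
  ring

lemma iterate_logMul (f : ℕ → ℂ) (k : ℕ) (n : ℕ) :
    LSeries.logMul^[k] f n = Complex.log n ^ k * f n := by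
  induction k with
  | zero => simp
  | succ k ih => rw [Function.iterate_succ_apply', LSeries.logMul, ih, pow_succ]; ring

lemma abscissa_le : LSeries.abscissaOfAbsConv
    (fun n => ((ArithmeticFunction.vonMangoldt n - 1 : ℝ) : ℂ)) ≤ 1 := by
  refine LSeries.abscissaOfAbsConv_le_of_forall_lt_LSeriesSummable fun y hy => ?_
  have h1 : (fun n : ℕ => ((ArithmeticFunction.vonMangoldt n - 1 : ℝ) : ℂ))
      = (fun n : ℕ => (ArithmeticFunction.vonMangoldt n : ℂ)) - 1 := by
    ext n; simp
  have hy : 1 < (y : ℂ).re := by simpa using hy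
  rw [h1]
  exact (ArithmeticFunction.LSeriesSummable_vonMangoldt hy).sub (LSeriesSummable_one_iff.mpr hy)

lemma logMul_eq_logCoeff : LSeries.logMul^[6]
    (fun n => ((ArithmeticFunction.vonMangoldt n - 1 : ℝ) : ℂ)) = fun n => (logCoeff n : ℂ) := by
  ext n
  rw [iterate_logMul, logCoeff, ← Complex.natCast_log]
  push_cast
  ring

lemma iteratedDeriv_logDerivReg {s : ℂ} (hs : 1 < s.re) :
    iteratedDeriv 6 logDerivReg s = LSeries (fun n => (logCoeff n : ℂ)) s := by
  have h1 : logDerivReg =ᶠ[𝓝 s]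
      LSeries (fun n => ((ArithmeticFunction.vonMangoldt n - 1 : ℝ) : ℂ)) := by
    filter_upwards [(isOpen_halfPlane 1).mem_nhds hs] with z hz using logDerivReg_eq hz
  rw [h1.iteratedDeriv_eq, LSeries_iteratedDeriv 6
    (abscissa_le.trans_lt (by exact_mod_cast hs)), logMul_eq_logCoeff]
  norm_num

lemma LSeriesSummable_logCoeff {s : ℂ} (hs : 1 < s.re) :
    LSeriesSummable (fun n => (logCoeff n : ℂ)) s := by
  refine LSeriesSummable_of_abscissaOfAbsConv_lt_re (lt_of_le_of_lt ?_
    (show (1 : EReal) < s.re by exact_mod_cast hs))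
  rw [← logMul_eq_logCoeff, LSeries.absicssaOfAbsConv_logPowMul]
  exact abscissa_le

/-- The function `u ↦ max (1 - u) 0`, in the form whose Mellin transform is in Mathlib. -/
noncomputable def hatFn (u : ℝ) : ℂ :=
  (Ioc (0 : ℝ) 1).indicator (fun _ => (1 : ℂ)) u -
    (Ioc (0 : ℝ) 1).indicator (fun t => (t : ℂ) ^ (1 : ℂ)) u

lemma hatFn_eq {u : ℝ} (hu : 0 < u) : hatFn u = ((max (1 - u) 0 : ℝ) : ℂ) := by
  unfold hatFn
  rcases le_or_gt u 1 with h | h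
  · have : u ∈ Ioc (0 : ℝ) 1 := ⟨hu, h⟩
    rw [indicator_of_mem this, indicator_of_mem this, max_eq_left (by linarith)]
    simp
  · have : u ∉ Ioc (0 : ℝ) 1 := fun h' => by linarith [h'.2]
    rw [indicator_of_notMem this, indicator_of_notMem this, max_eq_right (by linarith)]
    simp

lemma hasMellin_hatFn {s : ℂ} (hs : 0 < s.re) : HasMellin hatFn s (1 / (s * (s + 1))) := by
  have h1 := hasMellin_one_Ioc hs
  have h2 := hasMellin_cpow_Ioc 1 (s := s) (by simp; linarith)
  have h3 := hasMellin_sub h1.1 h2.1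
  rw [h1.2, h2.2] at h3
  have hs0 : s ≠ 0 := by rintro rfl; simp at hs
  have hs1 : s + 1 ≠ 0 := by
    intro h
    have := congrArg re h
    simp at this
    linarith
  convert! h3 using 1
  field_simp
  ring

lemma norm_one_div_mul_le {σ : ℝ} (hσ : 1 ≤ σ) (t : ℝ) :
    ‖1 / ((σ + t * I : ℂ) * ((σ + t * I) + 1))‖ ≤ (1 + t ^ 2) ^ (-1 : ℝ) := by
  have h1 : ∀ a : ℝ, 1 ≤ a → Real.sqrt (1 + t ^ 2) ≤ ‖(a + t * I : ℂ)‖ := fun a ha => by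
    rw [Complex.norm_add_mul_I]
    apply Real.sqrt_le_sqrt
    nlinarith
  have h2 : (σ + t * I : ℂ) + 1 = ((σ + 1 : ℝ) : ℂ) + t * I := by push_cast; ring
  have hpos : 0 < 1 + t ^ 2 := by positivity
  rw [h2, norm_div, norm_one, norm_mul, Real.rpow_neg_one, one_div]
  apply inv_anti₀ hpos
  calc 1 + t ^ 2 = Real.sqrt (1 + t ^ 2) * Real.sqrt (1 + t ^ 2) :=
        (Real.mul_self_sqrt hpos.le).symm
    _ ≤ _ := mul_le_mul (h1 σ hσ) (h1 (σ + 1) (by linarith)) (Real.sqrt_nonneg _) (norm_nonneg _)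

lemma one_div_mul_continuous {σ : ℝ} (hσ : 1 ≤ σ) :
    Continuous fun t : ℝ => 1 / ((σ + t * I : ℂ) * ((σ + t * I) + 1)) := by
  refine Continuous.div (by fun_prop) (by fun_prop) fun t => mul_ne_zero ?_ ?_
  · intro h
    have := congrArg re h
    simp at this
    linarith
  · intro h
    have := congrArg re h
    simp at this
    linarith

lemma integrable_one_add_sq_rpow {a : ℝ} (ha : 1 / 2 < a) :
    Integrable fun t : ℝ => (1 + t ^ 2) ^ (-a) := by
  have := integrable_rpow_neg_one_add_norm_sq (E := ℝ) (μ := volume) (r := 2 * a)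
    (by simp; linarith)
  simpa [neg_div] using this

lemma verticalIntegrable_hatFn {σ : ℝ} (hσ : 1 ≤ σ) : VerticalIntegrable (mellin hatFn) σ := by
  have e : (fun y : ℝ => mellin hatFn (σ + y * I))
      = fun t : ℝ => 1 / ((σ + t * I : ℂ) * ((σ + t * I) + 1)) := by
    ext t
    exact (hasMellin_hatFn (by simp; linarith)).2
  rw [VerticalIntegrable, e]
  exact (integrable_one_add_sq_rpow (a := 1) (by norm_num)).mono'
    (one_div_mul_continuous hσ).aestronglyMeasurable (ae_of_all _ (norm_one_div_mul_le hσ))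

lemma hatFn_inversion {σ : ℝ} (hσ : 1 ≤ σ) {u : ℝ} (hu : 0 < u) :
    (1 / (2 * Real.pi)) • ∫ t : ℝ, (u : ℂ) ^ (-(σ + t * I : ℂ)) *
      (1 / ((σ + t * I : ℂ) * ((σ + t * I) + 1))) = ((max (1 - u) 0 : ℝ) : ℂ) := by
  have hcont : ContinuousAt hatFn u := by
    have h1 : hatFn =ᶠ[𝓝 u] fun u => ((max (1 - u) 0 : ℝ) : ℂ) := by
      filter_upwards [lt_mem_nhds hu] with v hv using hatFn_eq hv
    rw [continuousAt_congr h1]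
    fun_prop
  have := mellinInv_mellin_eq σ hatFn hu (hasMellin_hatFn (by simp; linarith)).1
    (verticalIntegrable_hatFn hσ) hcont
  rw [hatFn_eq hu, mellinInv] at this
  rw [← this]
  congr 1
  refine integral_congr_ae (ae_of_all _ fun t => ?_)
  simp only [smul_eq_mul]
  rw [(hasMellin_hatFn (s := σ + t * I) (by simp; linarith)).2]

lemma exists_sum_logCoeff_smooth_le : ∃ C, 0 < C ∧ ∀ x : ℝ, 3 ≤ x →
    |∑ n ∈ Finset.Icc 1 ⌊x⌋₊, logCoeff n * (1 - n / x)| ≤ C * x := by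
  obtain ⟨C, hC, hF⟩ := exists_norm_iteratedDeriv_logDerivReg_le
  have hint : Integrable fun t : ℝ => (1 + t ^ 2) ^ (-(3 / 4) : ℝ) :=
    integrable_one_add_sq_rpow (by norm_num)
  set J := ∫ t : ℝ, (1 + t ^ 2) ^ (-(3 / 4) : ℝ) with hJ
  have hJ0 : 0 ≤ J := integral_nonneg fun t => by positivity
  refine ⟨2 * C * 3 * J + 1, by positivity, fun x hx => ?_⟩
  have hx0 : 0 < x := by linarith
  have hlog : 1 ≤ Real.log x := by
    rw [Real.le_log_iff_exp_le hx0]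
    linarith [Real.exp_one_lt_three]
  set σ : ℝ := 1 + 1 / Real.log x with hσdef
  have hσ1 : 1 < σ := by
    have : 0 < 1 / Real.log x := by positivity
    linarith
  have hσ2 : σ ≤ 2 := by
    have : 1 / Real.log x ≤ 1 := by rw [div_le_one (by linarith)]; exact hlog
    linarith
  have hxσ : x ^ σ ≤ 3 * x := by
    rw [hσdef, Real.rpow_add hx0, Real.rpow_one, mul_comm]
    gcongr
    rw [Real.rpow_def_of_pos hx0, mul_one_div_cancel (by linarith)]
    exact Real.exp_one_lt_three.le
  set w : ℝ → ℂ := fun t => 1 / ((σ + t * I : ℂ) * ((σ + t * I) + 1)) with hw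
  have hwcont : Continuous w := one_div_mul_continuous hσ1.le
  have hwint : Integrable w := (integrable_one_add_sq_rpow (a := 1) (by norm_num)).mono'
    hwcont.aestronglyMeasurable (ae_of_all _ (norm_one_div_mul_le hσ1.le))
  set a : ℕ → ℂ := fun n => (logCoeff n : ℂ) with ha
  have ha0 : a 0 = 0 := by simp [ha, logCoeff]
  set G : ℕ → ℝ → ℂ := fun n t =>
    LSeries.term a (σ + t * I) n * (x : ℂ) ^ (σ + t * I : ℂ) * w t with hG
  have hterm : ∀ n (t : ℝ), ‖LSeries.term a (σ + t * I) n‖ = ‖LSeries.term a σ n‖ := fun n t => by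
    rw [LSeries.norm_term_eq, LSeries.norm_term_eq]
    simp
  have hxs : ∀ t : ℝ, ‖(x : ℂ) ^ (σ + t * I : ℂ)‖ = x ^ σ := fun t => by
    rw [norm_cpow_eq_rpow_re_of_pos hx0]; simp
  have hGnorm : ∀ n t, ‖G n t‖ = ‖LSeries.term a σ n‖ * x ^ σ * ‖w t‖ := fun n t => by
    simp only [hG, norm_mul, hterm, hxs]
  have htermcont : ∀ n, Continuous fun t : ℝ => LSeries.term a (σ + t * I) n := fun n => by
    rcases eq_or_ne n 0 with rfl | hn
    · simpa using continuous_const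
    · simp only [LSeries.term_of_ne_zero hn]
      refine Continuous.div (by fun_prop) ?_ fun t => ?_
      · exact Continuous.const_cpow (by fun_prop) (Or.inl (by exact_mod_cast hn))
      · simp [hn, cpow_eq_zero_iff]
  have hxcont : Continuous fun t : ℝ => (x : ℂ) ^ (σ + t * I : ℂ) :=
    Continuous.const_cpow (by fun_prop) (Or.inl (by exact_mod_cast hx0.ne'))
  have hGint : ∀ n, Integrable (G n) := fun n => by
    refine (hwint.norm.const_mul (‖LSeries.term a σ n‖ * x ^ σ)).mono'
      (((htermcont n).mul hxcont).mul hwcont).aestronglyMeasurable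
      (ae_of_all _ fun t => (hGnorm n t).le)
  have hsum : Summable fun n => ‖LSeries.term a σ n‖ :=
    (LSeriesSummable_logCoeff (s := σ) (by simpa using hσ1)).norm
  have hGsum : Summable fun n => ∫ t, ‖G n t‖ := by
    simp_rw [hGnorm, integral_const_mul]
    simp_rw [mul_assoc]
    exact hsum.mul_right _
  have hmain := hasSum_integral_of_summable_integral_norm hGint hGsum
  have hG2 : ∀ t, ∑' n, G n t = iteratedDeriv 6 logDerivReg (σ + t * I) *
      (x : ℂ) ^ (σ + t * I : ℂ) * w t := fun t => by
    simp only [hG]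
    rw [tsum_mul_right, tsum_mul_right, iteratedDeriv_logDerivReg (by simpa using hσ1)]
    rfl
  have hG3 : ∀ n,
      (∫ t, G n t) = (2 * Real.pi : ℝ) * (a n * ((max (1 - n / x) 0 : ℝ) : ℂ)) := fun n => by
    rcases eq_or_ne n 0 with rfl | hn
    · simp [hG, ha0]
    have hn0 : (0 : ℝ) < n := by positivity
    have hinv := hatFn_inversion hσ1.le (div_pos hn0 hx0)
    change (1 / (2 * Real.pi)) • (∫ t : ℝ, ((n / x : ℝ) : ℂ) ^ (-(σ + t * I : ℂ)) * w t) = _ at hinv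
    rw [← hinv, real_smul]
    have e : ∀ t, G n t = a n * (((n / x : ℝ) : ℂ) ^ (-(σ + t * I : ℂ)) * w t) := fun t => by
      simp only [hG, LSeries.term_of_ne_zero hn]
      rw [div_eq_mul_inv (n : ℝ), ofReal_mul, mul_cpow_ofReal_nonneg hn0.le (by positivity),
        ofReal_inv, inv_cpow _ _ (by rw [arg_ofReal_of_nonneg hx0.le]; exact Real.pi_pos.ne),
        cpow_neg _ (σ + t * I : ℂ), cpow_neg _ (σ + t * I : ℂ), inv_inv]
      push_cast
      ring
    simp_rw [e, integral_const_mul]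
    have : ((2 * Real.pi : ℝ) : ℂ) ≠ 0 := by exact_mod_cast Real.two_pi_pos.ne'
    rw [one_div, ofReal_inv]
    generalize (∫ t : ℝ, ((n / x : ℝ) : ℂ) ^ (-(σ + t * I : ℂ)) * w t) = K
    field_simp
  have hbound : ‖∫ t, ∑' n, G n t‖ ≤ 2 * C * (3 * x) * J := by
    rw [hJ, ← integral_const_mul]
    refine norm_integral_le_of_norm_le (hint.const_mul _) (ae_of_all _ fun t => ?_)
    rw [hG2, norm_mul, norm_mul, hxs]
    have h1 := hF (σ + t * I) (by simpa using hσ1.le) (by simpa using hσ2)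
    have h2 := norm_one_div_mul_le hσ1.le t
    have him : (σ + t * I : ℂ).im = t := by simp
    rw [him] at h1
    have hp : 0 < 1 + t ^ 2 := by positivity
    have h3 : (1 + |t|) ^ (1 / 2 : ℝ) ≤ 2 * (1 + t ^ 2) ^ (1 / 4 : ℝ) := by
      have h4 : 1 + |t| ≤ 2 * (1 + t ^ 2) ^ (1 / 2 : ℝ) := by
        rw [← Real.sqrt_eq_rpow]
        have h5 : 1 ≤ Real.sqrt (1 + t ^ 2) := Real.one_le_sqrt.mpr (by nlinarith [sq_nonneg t])
        have h6 : |t| ≤ Real.sqrt (1 + t ^ 2) := Real.abs_le_sqrt (by linarith)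
        linarith
      calc (1 + |t|) ^ (1 / 2 : ℝ) ≤ (2 * (1 + t ^ 2) ^ (1 / 2 : ℝ)) ^ (1 / 2 : ℝ) := by gcongr
        _ = 2 ^ (1 / 2 : ℝ) * (1 + t ^ 2) ^ (1 / 4 : ℝ) := by
          rw [Real.mul_rpow (by norm_num) (by positivity), ← Real.rpow_mul hp.le]; norm_num
        _ ≤ 2 ^ (1 : ℝ) * (1 + t ^ 2) ^ (1 / 4 : ℝ) := by
          gcongr
          · norm_num
          · norm_num
        _ = _ := by norm_num
    calc _ ≤ (C * (2 * (1 + t ^ 2) ^ (1 / 4 : ℝ))) * (3 * x) * (1 + t ^ 2) ^ (-1 : ℝ) := by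
          gcongr
          exact h1.trans (by gcongr)
      _ = 2 * C * (3 * x) * ((1 + t ^ 2) ^ (1 / 4 : ℝ) * (1 + t ^ 2) ^ (-1 : ℝ)) := by ring
      _ = _ := by rw [← Real.rpow_add hp]; norm_num
  have hfin : ∑' n, ∫ t, G n t
      = (2 * Real.pi : ℝ) * ((∑ n ∈ Finset.Icc 1 ⌊x⌋₊, logCoeff n * (1 - n / x) : ℝ) : ℂ) := by
    rw [tsum_eq_sum (s := Finset.Icc 1 ⌊x⌋₊)]
    · push_cast
      rw [Finset.mul_sum]
      refine Finset.sum_congr rfl fun n hn => ?_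
      rw [hG3]
      have : (n : ℝ) ≤ x := (Nat.le_floor_iff hx0.le).mp (Finset.mem_Icc.mp hn).2
      rw [max_eq_left (by rw [sub_nonneg, div_le_one hx0]; exact this)]
      simp only [ha]
      push_cast
      ring
    · intro n hn
      rw [hG3]
      rcases eq_or_ne n 0 with rfl | hn0
      · simp [ha0]
      have : x < n := by
        by_contra! h
        exact hn (Finset.mem_Icc.mpr ⟨by omega, Nat.le_floor h⟩)
      rw [max_eq_right (by rw [sub_nonpos, le_div_iff₀ hx0]; linarith)]
      simp
  rw [← hmain.tsum_eq, hfin, norm_mul, norm_real, norm_real, Real.norm_eq_abs, Real.norm_eq_abs,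
    abs_of_pos Real.two_pi_pos] at hbound
  have hpi : 1 ≤ 2 * Real.pi := by linarith [Real.pi_gt_three]
  have h9 := le_mul_of_one_le_left
    (abs_nonneg (∑ n ∈ Finset.Icc 1 ⌊x⌋₊, logCoeff n * (1 - n / x))) hpi
  nlinarith

end

section

open MeasureTheory Filter Topology Set

lemma neg_log_pow_le_logCoeff {n : ℕ} : -Real.log n ^ 6 ≤ logCoeff n := by
  have h1 : 0 ≤ ArithmeticFunction.vonMangoldt n := ArithmeticFunction.vonMangoldt_nonneg
  have h2 : 0 ≤ Real.log n ^ 6 := by positivity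
  unfold logCoeff
  nlinarith

lemma sum_Icc_sub_sum_Icc {M : Type*} [AddCommGroup M] {y x : ℝ} (h : y ≤ x) (f : ℕ → M) :
    ∑ n ∈ Finset.Icc 1 ⌊x⌋₊, f n - ∑ n ∈ Finset.Icc 1 ⌊y⌋₊, f n =
      ∑ n ∈ Finset.Ioc ⌊y⌋₊ ⌊x⌋₊, f n := by
  have e : ∀ m : ℕ, Finset.Icc 1 m = Finset.Ioc 0 m := fun m => rfl
  rw [e, e, ← Finset.sum_Ioc_consecutive f (Nat.zero_le _) (Nat.floor_mono h)]
  abel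

lemma card_Ioc_floor_le {y x : ℝ} (hy : 0 ≤ y) (h : y ≤ x) :
    ((Finset.Ioc ⌊y⌋₊ ⌊x⌋₊).card : ℝ) ≤ x - y + 1 := by
  rw [Nat.card_Ioc, Nat.cast_sub (Nat.floor_mono h)]
  linarith [Nat.floor_le (hy.trans h), Nat.lt_floor_add_one y]

/-- A short-interval averaging bound for sums of coefficients bounded below. -/
lemma sum_mul_short_ge {y x B : ℝ} (hy : 0 ≤ y) (h : y ≤ x) {w : ℕ → ℝ} {c : ℕ → ℝ} (hB : 0 ≤ B)
    (hc : ∀ n ∈ Finset.Ioc ⌊y⌋₊ ⌊x⌋₊, -B ≤ c n)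
    (hw : ∀ n ∈ Finset.Ioc ⌊y⌋₊ ⌊x⌋₊, 0 ≤ w n ∧ w n ≤ x - y) :
    -((x - y) * (x - y + 1) * B) ≤ ∑ n ∈ Finset.Ioc ⌊y⌋₊ ⌊x⌋₊, c n * w n := by
  have h1 : ∑ n ∈ Finset.Ioc ⌊y⌋₊ ⌊x⌋₊, -((x - y) * B) ≤ ∑ n ∈ Finset.Ioc ⌊y⌋₊ ⌊x⌋₊, c n * w n := by
    refine Finset.sum_le_sum fun n hn => ?_
    have := hc n hn
    have h2 := hw n hn
    nlinarith
  rw [Finset.sum_const, nsmul_eq_mul] at h1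
  have h3 := card_Ioc_floor_le hy h
  have h4 : 0 ≤ (x - y) * B := mul_nonneg (by linarith) hB
  nlinarith

lemma exists_sum_logCoeff_le : ∃ C, 0 < C ∧ ∀ x : ℝ, 8 ≤ x →
    |∑ n ∈ Finset.Icc 1 ⌊x⌋₊, logCoeff n| ≤ C * (x * Real.log x ^ 3) := by
  obtain ⟨C, hC, hV⟩ := exists_sum_logCoeff_smooth_le
  set S : ℝ → ℝ := fun x => ∑ n ∈ Finset.Icc 1 ⌊x⌋₊, logCoeff n with hS
  set V : ℝ → ℝ := fun x => ∑ n ∈ Finset.Icc 1 ⌊x⌋₊, logCoeff n * (x - n) with hVdef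
  have hV' : ∀ x, 3 ≤ x → |V x| ≤ C * x ^ 2 := fun x hx => by
    have hx0 : 0 < x := by linarith
    have : V x = x * ∑ n ∈ Finset.Icc 1 ⌊x⌋₊, logCoeff n * (1 - n / x) := by
      rw [Finset.mul_sum]
      refine Finset.sum_congr rfl fun n _ => ?_
      field_simp
    rw [this, abs_mul, abs_of_pos hx0]
    nlinarith [hV x hx]
  refine ⟨5 * C + 7 * 64, by positivity, fun x hx => ?_⟩
  have hx0 : 0 < x := by linarith
  have hlog2 : Real.log 2 < Real.log x := Real.log_lt_log (by norm_num) (by linarith)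
  have hlog : 2 ≤ Real.log x := by
    have h8 : Real.log 8 ≤ Real.log x := Real.log_le_log (by norm_num) hx
    have : Real.log 8 = 3 * Real.log 2 := by
      rw [show (8 : ℝ) = 2 ^ (3 : ℕ) by norm_num, Real.log_pow]; norm_num
    linarith [Real.log_two_gt_d9]
  set L := Real.log x with hL
  have hL3 : 8 ≤ L ^ 3 := by
    calc (8 : ℝ) = 2 ^ 3 := by norm_num
      _ ≤ L ^ 3 := by gcongr
  have hLx : L ^ 3 ≤ 6 * x := by
    have := Real.pow_div_factorial_le_exp L (by linarith) 3
    rw [hL, Real.exp_log hx0] at this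
    norm_num [Nat.factorial] at this
    linarith
  set h := x / L ^ 3 with hh
  have hh0 : 0 < h := by positivity
  have hh8 : h ≤ x / 8 := by rw [hh]; gcongr
  have hh1 : h + 1 ≤ 7 * h := by
    have : 1 ≤ 6 * h := by
      rw [hh, ← mul_div_assoc, le_div_iff₀ (by positivity)]; linarith
    linarith
  have hhL : h * L ^ 3 = x := by rw [hh]; field_simp
  have hB : ∀ n : ℕ, (n : ℝ) ≤ 2 * x → -(2 * L) ^ 6 ≤ logCoeff n := fun n hn => by
    refine le_trans ?_ neg_log_pow_le_logCoeff
    rcases Nat.eq_zero_or_pos n with rfl | hn0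
    · simp; positivity
    have h1 : Real.log n ≤ 2 * L := by
      calc Real.log n ≤ Real.log (2 * x) := Real.log_le_log (by exact_mod_cast hn0) hn
        _ = Real.log 2 + L := Real.log_mul (by norm_num) hx0.ne'
        _ ≤ _ := by linarith
    have h2 : 0 ≤ Real.log n := Real.log_natCast_nonneg n
    gcongr
  have hfin : h * (h + 1) * (2 * L) ^ 6 ≤ h * (7 * 64 * (x * L ^ 3)) := by
    calc h * (h + 1) * (2 * L) ^ 6 ≤ h * (7 * h) * (2 * L) ^ 6 := by gcongr
      _ = h * (7 * 64 * ((h * L ^ 3) * L ^ 3)) := by ring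
      _ = _ := by rw [hhL]
  have hsq : x ^ 2 = h * (x * L ^ 3) := by
    calc x ^ 2 = x * (h * L ^ 3) := by rw [hhL]; ring
      _ = _ := by ring
  change |S x| ≤ _
  rw [abs_le]
  constructor
  · have e : h * S x = V x - V (x - h) +
        ∑ n ∈ Finset.Ioc ⌊x - h⌋₊ ⌊x⌋₊, logCoeff n * (n - (x - h)) := by
      have h1 : V x = h * S x + ∑ n ∈ Finset.Icc 1 ⌊x⌋₊, logCoeff n * (x - h - n) := by
        simp only [hVdef, hS, Finset.mul_sum, ← Finset.sum_add_distrib]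
        exact Finset.sum_congr rfl fun n _ => by ring
      have h2 := sum_Icc_sub_sum_Icc (show x - h ≤ x by linarith) fun n => logCoeff n * (x - h - n)
      have h3 : ∑ n ∈ Finset.Ioc ⌊x - h⌋₊ ⌊x⌋₊, logCoeff n * (n - (x - h))
          = -∑ n ∈ Finset.Ioc ⌊x - h⌋₊ ⌊x⌋₊, logCoeff n * (x - h - n) := by
        rw [← Finset.sum_neg_distrib]
        exact Finset.sum_congr rfl fun n _ => by ring
      rw [h3, ← h2, h1]
      simp only [hVdef]
      ring
    have h4 := sum_mul_short_ge (y := x - h) (x := x) (B := (2 * L) ^ 6) (c := logCoeff)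
      (w := fun n => n - (x - h)) (by linarith) (by linarith) (by positivity)
      (fun n hn => hB n ?_) (fun n hn => ?_)
    · have h5 := abs_le.mp (hV' x (by linarith))
      have h6 := abs_le.mp (hV' (x - h) (by linarith))
      have h7 : C * (x - h) ^ 2 ≤ C * x ^ 2 := by gcongr <;> linarith
      have h8 : C * x ^ 2 = h * (C * (x * L ^ 3)) := by rw [hsq]; ring
      have h10 : 0 ≤ C * x ^ 2 := by positivity
      have h9 : x - (x - h) = h := by ring
      rw [h9] at h4
      refine le_of_mul_le_mul_left ?_ hh0
      linarith
    · have := (Nat.le_floor_iff hx0.le).mp (Finset.mem_Ioc.mp hn).2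
      linarith
    · have h1 := (Nat.le_floor_iff hx0.le).mp (Finset.mem_Ioc.mp hn).2
      have h2 := Nat.lt_of_floor_lt (Finset.mem_Ioc.mp hn).1
      constructor <;> linarith
  · have e : h * S x = V (x + h) - V x -
        ∑ n ∈ Finset.Ioc ⌊x⌋₊ ⌊x + h⌋₊, logCoeff n * (x + h - n) := by
      have h1 : V x = ∑ n ∈ Finset.Icc 1 ⌊x⌋₊, logCoeff n * (x + h - n) - h * S x := by
        simp only [hVdef, hS, Finset.mul_sum, ← Finset.sum_sub_distrib]
        exact Finset.sum_congr rfl fun n _ => by ring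
      have h2 := sum_Icc_sub_sum_Icc (show x ≤ x + h by linarith) fun n => logCoeff n * (x + h - n)
      rw [← h2, h1]
      simp only [hVdef]
      ring
    have h4 := sum_mul_short_ge (y := x) (x := x + h) (B := (2 * L) ^ 6) (c := logCoeff)
      (w := fun n => x + h - n) (by linarith) (by linarith) (by positivity)
      (fun n hn => hB n ?_) (fun n hn => ?_)
    · have h5 := abs_le.mp (hV' x (by linarith))
      have h6 := abs_le.mp (hV' (x + h) (by linarith))
      have h7 : C * (x + h) ^ 2 ≤ C * (4 * x ^ 2) := by
        have : (x + h) ^ 2 ≤ (2 * x) ^ 2 := by gcongr; linarith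
        gcongr
        linarith
      have h8 : C * x ^ 2 = h * (C * (x * L ^ 3)) := by rw [hsq]; ring
      have h9 : x + h - x = h := by ring
      rw [h9] at h4
      refine le_of_mul_le_mul_left ?_ hh0
      linarith
    · have := (Nat.le_floor_iff (by linarith)).mp (Finset.mem_Ioc.mp hn).2
      linarith
    · have h1 := (Nat.le_floor_iff (by linarith)).mp (Finset.mem_Ioc.mp hn).2
      have h2 := Nat.lt_of_floor_lt (Finset.mem_Ioc.mp hn).1
      constructor <;> linarith

lemma abs_sum_mul_le {c : ℕ → ℝ} {f : ℝ → ℝ} {a b D : ℝ} (ha : 0 ≤ a) (hab : a ≤ b)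
    (hf : ∀ t ∈ Icc a b, DifferentiableAt ℝ f t) (hf' : IntegrableOn (deriv f) (Icc a b))
    (hD : ∀ t ∈ Ioc a b, |deriv f t * ∑ k ∈ Finset.Icc 0 ⌊t⌋₊, c k| ≤ D) :
    |∑ k ∈ Finset.Ioc ⌊a⌋₊ ⌊b⌋₊, f k * c k| ≤ |f b * ∑ k ∈ Finset.Icc 0 ⌊b⌋₊, c k| +
      |f a * ∑ k ∈ Finset.Icc 0 ⌊a⌋₊, c k| + D * (b - a) := by
  rw [sum_mul_eq_sub_sub_integral_mul c ha hab hf hf']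
  refine (abs_sub _ _).trans (add_le_add (abs_sub _ _) ?_)
  have := norm_setIntegral_le_of_norm_le_const (μ := volume) (s := Ioc a b) (C := D)
    (f := fun t => deriv f t * ∑ k ∈ Finset.Icc 0 ⌊t⌋₊, c k) (by simp) hD
  simpa [hab, Measure.real] using this

lemma log_pow_three_le {x : ℝ} (hx : 1 ≤ x) : Real.log x ^ 3 ≤ 6 * x := by
  have := Real.pow_div_factorial_le_exp (Real.log x) (Real.log_nonneg hx) 3
  rw [Real.exp_log (by linarith)] at this
  norm_num [Nat.factorial] at this
  linarith

lemma exists_psi_sub_le : ∃ C, 0 < C ∧ ∀ x : ℝ, 64 ≤ x →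
    |Chebyshev.psi x - x| ≤ C * (x / Real.log x ^ 3) := by
  obtain ⟨C, hC, hS⟩ := exists_sum_logCoeff_le
  refine ⟨C + 8 * C + 768 * C + 9 * 48, by positivity, fun x hx => ?_⟩
  have hx0 : 0 < x := by linarith
  have hlog : 2 ≤ Real.log x := by
    have h8 : Real.log 8 ≤ Real.log x := Real.log_le_log (by norm_num) (by linarith)
    have : Real.log 8 = 3 * Real.log 2 := by
      rw [show (8 : ℝ) = 2 ^ (3 : ℕ) by norm_num, Real.log_pow]; norm_num
    linarith [Real.log_two_gt_d9]
  set y := √x with hy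
  have hyy : y * y = x := Real.mul_self_sqrt hx0.le
  have hy8 : 8 ≤ y := Real.le_sqrt_of_sq_le (by norm_num; linarith)
  have hyx : y ≤ x := by nlinarith
  have hlogy : Real.log y = Real.log x / 2 := by rw [hy, Real.log_sqrt hx0.le]
  set L := Real.log x with hL
  have hyL : y * L ^ 3 ≤ 48 * x := by
    have := log_pow_three_le (show 1 ≤ y by linarith)
    rw [hlogy] at this
    nlinarith
  have hyL' : y ≤ 48 * (x / L ^ 3) := by
    rw [← mul_div_assoc, le_div_iff₀ (by positivity)]; exact hyL
  have hS' : ∀ t, 8 ≤ t → |∑ n ∈ Finset.Icc 0 ⌊t⌋₊, logCoeff n| ≤ C * (t * Real.log t ^ 3) := by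
    intro t ht
    have : ∑ n ∈ Finset.Icc 0 ⌊t⌋₊, logCoeff n = ∑ n ∈ Finset.Icc 1 ⌊t⌋₊, logCoeff n := by
      rw [← Finset.add_sum_Ioc_eq_sum_Icc (Nat.zero_le _)]
      simp [logCoeff, ← Finset.Icc_succ_left_eq_Ioc]
    rw [this]
    exact hS t ht
  have hderiv : ∀ t, 1 < t → HasDerivAt (fun u => (Real.log u ^ 6)⁻¹)
      (-(6 / (t * Real.log t ^ 7))) t := fun t ht => by
    have hl : 0 < Real.log t := Real.log_pos ht
    have := ((Real.hasDerivAt_log (by linarith : t ≠ 0)).fun_pow 6).fun_inv (by positivity)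
    convert! this using 1
    field_simp
    norm_num
  have habel := abs_sum_mul_le (c := logCoeff) (f := fun u => (Real.log u ^ 6)⁻¹)
    (a := y) (b := x) (D := 768 * C / L ^ 4) (by linarith) hyx
    (fun t ht => (hderiv t (by linarith [ht.1])).differentiableAt) ?_ ?_
  · have e : ∑ k ∈ Finset.Ioc ⌊y⌋₊ ⌊x⌋₊, (Real.log k ^ 6)⁻¹ * logCoeff k
        = (Chebyshev.psi x - ⌊x⌋₊) - (Chebyshev.psi y - ⌊y⌋₊) := by
      have h1 : ∀ t, Chebyshev.psi t - ⌊t⌋₊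
          = ∑ n ∈ Finset.Icc 1 ⌊t⌋₊, (ArithmeticFunction.vonMangoldt n - 1) := fun t => by
        rw [Finset.sum_sub_distrib, Chebyshev.psi]
        simp [← Finset.Icc_succ_left_eq_Ioc]
      rw [h1, h1, sum_Icc_sub_sum_Icc hyx]
      refine Finset.sum_congr rfl fun n hn => ?_
      have h2 := Nat.lt_of_floor_lt (Finset.mem_Ioc.mp hn).1
      have h3 : 0 < Real.log n := Real.log_pos (by linarith)
      rw [logCoeff]
      field_simp
    rw [e] at habel
    have b1 : |(L ^ 6)⁻¹ * ∑ k ∈ Finset.Icc 0 ⌊x⌋₊, logCoeff k| ≤ C * (x / L ^ 3) := by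
      rw [abs_mul, abs_of_pos (by positivity)]
      calc _ ≤ (L ^ 6)⁻¹ * (C * (x * L ^ 3)) := by gcongr; exact hS' x (by linarith)
        _ = _ := by field_simp
    have b2 : |(Real.log y ^ 6)⁻¹ * ∑ k ∈ Finset.Icc 0 ⌊y⌋₊, logCoeff k| ≤ 8 * C * (x / L ^ 3) := by
      rw [abs_mul, abs_of_pos (by rw [hlogy]; positivity)]
      calc _ ≤ (Real.log y ^ 6)⁻¹ * (C * (y * Real.log y ^ 3)) := by
            gcongr
            exact hS' y hy8
        _ = 8 * C * (y / L ^ 3) := by rw [hlogy]; field_simp; norm_num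
        _ ≤ _ := by gcongr
    have b3 : 768 * C / L ^ 4 * (x - y) ≤ 768 * C * (x / L ^ 3) := by
      calc 768 * C / L ^ 4 * (x - y) ≤ 768 * C / L ^ 3 * x := by
            gcongr
            · linarith
            · norm_num
            · linarith
        _ = _ := by ring
    have b4 : |Chebyshev.psi y| ≤ 6 * y := by
      rw [abs_of_nonneg (Chebyshev.psi_nonneg y)]
      refine (Chebyshev.psi_le_const_mul_self (by linarith)).trans ?_
      gcongr
      have : Real.log 4 = 2 * Real.log 2 := by
        rw [show (4 : ℝ) = 2 ^ (2 : ℕ) by norm_num, Real.log_pow]; norm_num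
      linarith [Real.log_two_lt_d9]
    have b5 := Nat.floor_le hx0.le
    have b6 := Nat.lt_floor_add_one x
    have b7 := Nat.floor_le (show 0 ≤ y by linarith)
    have b8 := Nat.lt_floor_add_one y
    have b9 := abs_le.mp habel
    have b10 := abs_le.mp b4
    rw [abs_le]
    constructor <;> linarith [b9.1, b9.2]
  · refine ContinuousOn.integrableOn_Icc ?_
    have : ContinuousOn (fun t => -(6 / (t * Real.log t ^ 7))) (Icc y x) := by
      refine (ContinuousOn.div continuousOn_const ?_ ?_).neg
      · exact continuousOn_id.mul ((Real.continuousOn_log.mono fun t ht => by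
          have := ht.1
          simp; linarith).pow 7)
      · intro t ht
        have h1 : 0 < Real.log t := Real.log_pos (by linarith [ht.1])
        have h2 : 0 < t := by linarith [ht.1]
        positivity
    exact this.congr fun t ht => (hderiv t (by linarith [ht.1])).deriv
  · intro t ht
    have ht0 : 0 < t := by linarith [ht.1]
    have h1 : L / 2 ≤ Real.log t := hlogy ▸ Real.log_le_log (by linarith) ht.1.le
    have h2 : Real.log t ≤ L := Real.log_le_log ht0 ht.2
    have h3 : 0 < Real.log t := by linarith
    rw [(hderiv t (by linarith [ht.1])).deriv, abs_mul, abs_neg, abs_of_pos (by positivity)]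
    calc _ ≤ 6 / (t * Real.log t ^ 7) * (C * (t * Real.log t ^ 3)) := by
          gcongr; exact hS' t (by linarith [ht.1])
      _ = 6 * C / Real.log t ^ 4 := by field_simp
      _ ≤ 6 * C / (L / 2) ^ 4 := by gcongr
      _ ≤ 768 * C / L ^ 4 := by
        rw [div_pow, div_div_eq_mul_div]
        exact (div_le_div_iff_of_pos_right (by positivity)).mpr (by linarith)

/-- The prime number theorem with error term `O(x / (log x)³)`. -/
theorem exists_theta_sub_le : ∃ C, 0 < C ∧ ∀ x : ℝ, 1 ≤ x →
    |Chebyshev.theta x - x| ≤ C * (x / (1 + Real.log x) ^ 3) := by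
  obtain ⟨C, hC, hψ⟩ := exists_psi_sub_le
  obtain ⟨D, hD⟩ := Chebyshev.psi_sub_theta_le_mul_sqrt
  set L₀ := Real.log 64
  have hL₀ : 0 < L₀ := Real.log_pos (by norm_num)
  refine ⟨8 * (C + 48 * |D|) + 3 * (1 + L₀) ^ 3, by positivity, fun x hx => ?_⟩
  have hx0 : 0 < x := by linarith
  have hlog := Real.log_nonneg hx
  rcases le_total 64 x with h | h
  · have hlog1 : 1 ≤ Real.log x := by
      rw [Real.le_log_iff_exp_le hx0]
      linarith [Real.exp_one_lt_three]
    have h1 := hψ x h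
    have h2 := hD x
    have h3 := Chebyshev.theta_le_psi x
    have h4 : √x ≤ 48 * (x / Real.log x ^ 3) := by
      rw [← mul_div_assoc, le_div_iff₀ (by positivity)]
      have := log_pow_three_le (Real.one_le_sqrt.mpr hx)
      rw [Real.log_sqrt hx0.le] at this
      nlinarith [Real.mul_self_sqrt hx0.le, Real.sqrt_nonneg x]
    have h5 : |Chebyshev.theta x - x| ≤ (C + 48 * |D|) * (x / Real.log x ^ 3) := by
      have h6 : D * √x ≤ |D| * (48 * (x / Real.log x ^ 3)) :=
        mul_le_mul (le_abs_self D) h4 (Real.sqrt_nonneg x) (abs_nonneg D)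
      have h7 : 0 ≤ |D| * (48 * (x / Real.log x ^ 3)) := by positivity
      have h8 := abs_le.mp h1
      rw [abs_le]
      constructor <;> linarith
    have h6 : x / Real.log x ^ 3 ≤ 8 * (x / (1 + Real.log x) ^ 3) := by
      rw [div_le_iff₀ (by positivity), mul_assoc, div_mul_eq_mul_div, ← mul_div_assoc,
        le_div_iff₀ (by positivity)]
      have : (1 + Real.log x) ^ 3 ≤ (2 * Real.log x) ^ 3 := by gcongr; linarith
      nlinarith
    have h7 : 0 ≤ 3 * (1 + L₀) ^ 3 * (x / (1 + Real.log x) ^ 3) := by positivity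
    have h8 : 0 ≤ C + 48 * |D| := by positivity
    nlinarith [mul_le_mul_of_nonneg_left h6 h8]
  · have h1 : |Chebyshev.theta x - x| ≤ 3 * x := by
      have h2 := Chebyshev.theta_le_log4_mul_x hx0.le
      have h3 := Chebyshev.theta_nonneg x
      have : Real.log 4 = 2 * Real.log 2 := by
        rw [show (4 : ℝ) = 2 ^ (2 : ℕ) by norm_num, Real.log_pow]; norm_num
      rw [abs_le]
      constructor <;> nlinarith [Real.log_two_lt_d9]
    have hL₁ : Real.log x ≤ L₀ := Real.log_le_log hx0 h
    have h2 : x ≤ (1 + L₀) ^ 3 * (x / (1 + Real.log x) ^ 3) := by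
      rw [← mul_div_assoc, le_div_iff₀ (by positivity), mul_comm]
      gcongr
    have h3 : 0 ≤ 8 * (C + 48 * |D|) * (x / (1 + Real.log x) ^ 3) := by positivity
    nlinarith

/-- The weight `log p` at primes, zero elsewhere. -/
noncomputable def logPrime (n : ℕ) : ℝ := if n.Prime then Real.log n else 0

/-- The size of the error term in the prime number theorem. -/
noncomputable def thetaErr (y : ℝ) : ℝ := y / (1 + Real.log y) ^ 3

lemma logPrime_nonneg (n : ℕ) : 0 ≤ logPrime n := by
  unfold logPrime
  split_ifs
  · exact Real.log_natCast_nonneg n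
  · rfl

lemma theta_eq_sum_logPrime (x : ℝ) :
    Chebyshev.theta x = ∑ n ∈ Finset.Ioc 0 ⌊x⌋₊, logPrime n := by
  simp only [Chebyshev.theta, logPrime, Finset.sum_filter]

lemma thetaErr_nonneg {y : ℝ} (hy : 1 ≤ y) : 0 ≤ thetaErr y := by
  have := Real.log_nonneg hy
  unfold thetaErr
  positivity

lemma one_add_log_pow_three_le {s : ℝ} (hs : 1 ≤ s) : (1 + Real.log s) ^ 3 ≤ 27 * s := by
  have h0 := Real.log_nonneg hs
  have hs0 : 0 < s := by linarith
  have h := Real.add_one_le_exp (Real.log s / 3)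
  have h1 : 1 + Real.log s ≤ 3 * Real.exp (Real.log s / 3) := by linarith
  calc (1 + Real.log s) ^ 3 ≤ (3 * Real.exp (Real.log s / 3)) ^ 3 := by gcongr
    _ = 27 * Real.exp (Real.log s) := by
      rw [mul_pow, ← Real.exp_nat_mul]; norm_num; ring_nf
    _ = 27 * s := by rw [Real.exp_log hs0]

lemma thetaErr_le {u y : ℝ} (hu : 1 ≤ u) (huy : u ≤ y) : thetaErr u ≤ 27 * thetaErr y := by
  have hu0 : 0 < u := by linarith
  have hy0 : 0 < y := by linarith
  have hlu := Real.log_nonneg hu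
  have hs : 1 ≤ y / u := by rw [le_div_iff₀ hu0]; linarith
  have hls := Real.log_nonneg hs
  have hly : Real.log y = Real.log u + Real.log (y / u) := by
    rw [Real.log_div hy0.ne' hu0.ne']; ring
  have h1 : (1 + Real.log y) ^ 3 ≤ (1 + Real.log u) ^ 3 * (27 * (y / u)) := by
    calc (1 + Real.log y) ^ 3 ≤ ((1 + Real.log u) * (1 + Real.log (y / u))) ^ 3 := by
          have : 0 ≤ Real.log y := Real.log_nonneg (hu.trans huy)
          gcongr
          rw [hly]; nlinarith [mul_nonneg hlu hls]
      _ = (1 + Real.log u) ^ 3 * (1 + Real.log (y / u)) ^ 3 := by ring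
      _ ≤ _ := by gcongr; exact one_add_log_pow_three_le hs
  have h2 : 0 < 1 + Real.log y := by linarith [Real.log_nonneg (hu.trans huy)]
  unfold thetaErr
  rw [← mul_div_assoc, div_le_div_iff₀ (by positivity) (by positivity)]
  calc u * (1 + Real.log y) ^ 3 ≤ u * ((1 + Real.log u) ^ 3 * (27 * (y / u))) := by gcongr
    _ = _ := by field_simp

lemma one_le_thetaErr {y : ℝ} (hy : 1 ≤ y) : 1 ≤ 27 * thetaErr y := by
  simpa [thetaErr] using thetaErr_le le_rfl hy

lemma exists_theta_err :
    ∃ C, 1 ≤ C ∧ ∀ y : ℝ, 1 ≤ y → 1 ≤ C * thetaErr y ∧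
      ∀ u ∈ Icc 0 y, |Chebyshev.theta u - u| ≤ C * thetaErr y := by
  obtain ⟨C, hC, h⟩ := exists_theta_sub_le
  refine ⟨27 * (C + 1), by linarith, fun y hy => ?_⟩
  have h0 := thetaErr_nonneg hy
  have h1 := one_le_thetaErr hy
  refine ⟨by nlinarith, fun u hu => ?_⟩
  rcases lt_or_ge u 1 with h2 | h2
  · rw [Chebyshev.theta_eq_zero_of_le_one h2.le, zero_sub, abs_neg, abs_of_nonneg hu.1]
    nlinarith
  · have := thetaErr_le h2 hu.2
    have h3 := h u h2
    change _ ≤ C * thetaErr u at h3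
    nlinarith

lemma abs_sum_logPrime_sub_integral_nat {φ : ℝ → ℝ} {N : ℕ} {M : ℝ}
    (hφ : MonotoneOn φ (Icc 0 N)) (hE : ∀ u ∈ Icc (0 : ℝ) N, |Chebyshev.theta u - u| ≤ M) :
    |∑ n ∈ Finset.Ioc 0 N, φ n * logPrime n - (∫ u in (0 : ℝ)..N, φ u) -
      φ N * (Chebyshev.theta N - N)| ≤ (1 + M) * (φ N - φ 0) := by
  induction N with
  | zero => simp
  | succ N ih =>
    have hsub : Icc (0 : ℝ) N ⊆ Icc 0 (N + 1 : ℕ) := Icc_subset_Icc_right (by push_cast; linarith)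
    have ih' := ih (hφ.mono hsub) (fun u hu => hE u (hsub hu))
    have hN0 : (0 : ℝ) ≤ N := Nat.cast_nonneg N
    have hmemN : (N : ℝ) ∈ Icc (0 : ℝ) (N + 1 : ℕ) := ⟨hN0, by push_cast; linarith⟩
    have hmemN1 : ((N + 1 : ℕ) : ℝ) ∈ Icc (0 : ℝ) (N + 1 : ℕ) := ⟨by positivity, le_rfl⟩
    have hmono := hφ hmemN hmemN1 (by push_cast; linarith)
    have hE' := hE N hmemN
    have hsubN : Icc (N : ℝ) (N + 1 : ℕ) ⊆ Icc (0 : ℝ) (N + 1 : ℕ) := Icc_subset_Icc_left hN0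
    have hle : (N : ℝ) ≤ (N + 1 : ℕ) := by push_cast; linarith
    have hint1 : IntervalIntegrable φ volume 0 N :=
      ((hφ.mono hsub).mono (by rw [uIcc_of_le hN0])).intervalIntegrable
    have hint2 : IntervalIntegrable φ volume N (N + 1 : ℕ) :=
      ((hφ.mono hsubN).mono (by rw [uIcc_of_le hle])).intervalIntegrable
    have hθ : Chebyshev.theta (N + 1 : ℕ) = Chebyshev.theta N + logPrime (N + 1) := by
      rw [theta_eq_sum_logPrime, theta_eq_sum_logPrime, Nat.floor_natCast, Nat.floor_natCast,
        Finset.sum_Ioc_succ_top (Nat.zero_le N)]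
    have hlo : φ N ≤ ∫ u in (N : ℝ)..(N + 1 : ℕ), φ u := by
      have := intervalIntegral.integral_mono_on hle (μ := volume)
        (f := fun _ => φ N) (by simp) hint2
        (fun u hu => hφ hmemN (hsubN hu) hu.1)
      simpa using this
    have hhi : (∫ u in (N : ℝ)..(N + 1 : ℕ), φ u) ≤ φ (N + 1 : ℕ) := by
      have := intervalIntegral.integral_mono_on hle (μ := volume)
        (g := fun _ => φ (N + 1 : ℕ)) hint2 (by simp)
        (fun u hu => hφ (hsubN hu) hmemN1 hu.2)
      simpa using this
    rw [Finset.sum_Ioc_succ_top (Nat.zero_le N), hθ,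
      ← intervalIntegral.integral_add_adjacent_intervals hint1 hint2]
    set I := ∫ u in (N : ℝ)..(N + 1 : ℕ), φ u
    set J := ∫ u in (0 : ℝ)..N, φ u
    set S := ∑ n ∈ Finset.Ioc 0 N, φ n * logPrime n
    set E := Chebyshev.theta N - N with hEdef
    have hkey : S + φ (N + 1 : ℕ) * logPrime (N + 1) - (J + I) -
        φ (N + 1 : ℕ) * (Chebyshev.theta N + logPrime (N + 1) - (N + 1 : ℕ)) =
        (S - J - φ N * E) + ((φ (N + 1 : ℕ) - I) - (φ (N + 1 : ℕ) - φ N) * E) := by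
      rw [hEdef]; push_cast; ring
    rw [hkey]
    refine (abs_add_le _ _).trans ?_
    have h1 : |(φ (N + 1 : ℕ) - I) - (φ (N + 1 : ℕ) - φ N) * E| ≤
        (φ (N + 1 : ℕ) - φ N) + (φ (N + 1 : ℕ) - φ N) * M := by
      refine (abs_sub _ _).trans (add_le_add ?_ ?_)
      · rw [abs_of_nonneg] <;> linarith
      · rw [abs_mul, abs_of_nonneg (sub_nonneg.2 hmono)]
        exact mul_le_mul_of_nonneg_left hE' (sub_nonneg.2 hmono)
    linarith

/-- Summing a monotone function over the primes with logarithmic weights. -/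
lemma abs_sum_logPrime_sub_integral_le {φ : ℝ → ℝ} {b M : ℝ} (hb : 0 ≤ b) (hM : 1 ≤ M)
    (hφ : MonotoneOn φ (Icc 0 b)) (h0 : 0 ≤ φ 0)
    (hE : ∀ u ∈ Icc (0 : ℝ) b, |Chebyshev.theta u - u| ≤ M) :
    |∑ n ∈ Finset.Ioc 0 ⌊b⌋₊, φ n * logPrime n - ∫ u in (0 : ℝ)..b, φ u| ≤ 4 * M * φ b := by
  have hN0 : (0 : ℝ) ≤ ⌊b⌋₊ := Nat.cast_nonneg _
  have hNb : (⌊b⌋₊ : ℝ) ≤ b := Nat.floor_le hb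
  have hbN : b < ⌊b⌋₊ + 1 := Nat.lt_floor_add_one b
  have hsub : Icc (0 : ℝ) ⌊b⌋₊ ⊆ Icc 0 b := Icc_subset_Icc_right hNb
  have hsub2 : Icc (⌊b⌋₊ : ℝ) b ⊆ Icc 0 b := Icc_subset_Icc_left hN0
  have h1 := abs_sum_logPrime_sub_integral_nat (hφ.mono hsub)
    (fun u hu => hE u (hsub hu))
  have hint1 : IntervalIntegrable φ volume 0 ⌊b⌋₊ :=
    ((hφ.mono hsub).mono (by rw [uIcc_of_le hN0])).intervalIntegrable
  have hint2 : IntervalIntegrable φ volume ⌊b⌋₊ b :=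
    ((hφ.mono hsub2).mono (by rw [uIcc_of_le hNb])).intervalIntegrable
  rw [← intervalIntegral.integral_add_adjacent_intervals hint1 hint2]
  have hNmem : (⌊b⌋₊ : ℝ) ∈ Icc 0 b := ⟨hN0, hNb⟩
  have hbmem : b ∈ Icc 0 b := ⟨hb, le_rfl⟩
  have h0mem : (0 : ℝ) ∈ Icc 0 b := ⟨le_rfl, hb⟩
  have hφN : φ ⌊b⌋₊ ≤ φ b := hφ hNmem hbmem hNb
  have hφ0 : φ 0 ≤ φ ⌊b⌋₊ := hφ h0mem hNmem hN0
  have hI0 : 0 ≤ ∫ u in (⌊b⌋₊ : ℝ)..b, φ u :=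
    intervalIntegral.integral_nonneg hNb fun u hu =>
      h0.trans (hφ h0mem (hsub2 hu) (hsub2 hu).1)
  have hI1 : (∫ u in (⌊b⌋₊ : ℝ)..b, φ u) ≤ φ b := by
    have := intervalIntegral.integral_mono_on hNb (μ := volume)
      (g := fun _ => φ b) hint2 (by simp) (fun u hu => hφ (hsub2 hu) hbmem hu.2)
    simp only [intervalIntegral.integral_const, smul_eq_mul] at this
    nlinarith
  have h2 : |φ ⌊b⌋₊ * (Chebyshev.theta ⌊b⌋₊ - ⌊b⌋₊)| ≤ φ ⌊b⌋₊ * M := by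
    rw [abs_mul, abs_of_nonneg (h0.trans hφ0)]
    exact mul_le_mul_of_nonneg_left (hE _ hNmem) (h0.trans hφ0)
  rw [abs_le] at h1 h2 ⊢
  constructor <;> nlinarith

lemma sum_logPrime_le {y : ℝ} (hy : 0 ≤ y) : ∑ n ∈ Finset.Ioc 0 ⌊y⌋₊, logPrime n ≤ 2 * y := by
  rw [← theta_eq_sum_logPrime]
  refine (Chebyshev.theta_le_log4_mul_x hy).trans ?_
  gcongr
  have : Real.log 4 = 2 * Real.log 2 := by
    rw [show (4 : ℝ) = 2 ^ 2 by norm_num, Real.log_pow]; norm_num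
  linarith [Real.log_two_lt_d9]

lemma sum_logPrime_div_le_of_doubling {a b : ℝ} (ha : 0 < a) (k : ℕ) (hb : b ≤ 2 ^ k * a) :
    ∑ n ∈ Finset.Ioc ⌊a⌋₊ ⌊b⌋₊, logPrime n / n ≤ 4 * k := by
  induction k generalizing b with
  | zero =>
    rw [Finset.Ioc_eq_empty (by simpa using Nat.floor_le_floor (by simpa using hb))]
    simp
  | succ k ih =>
    set c := 2 ^ k * a with hc
    have hc0 : 0 < c := by positivity
    have h1 := ih le_rfl
    have hac : ⌊a⌋₊ ≤ ⌊c⌋₊ :=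
      Nat.floor_le_floor (le_mul_of_one_le_left ha.le (one_le_pow₀ (by norm_num)))
    have h2 : ∑ n ∈ Finset.Ioc ⌊c⌋₊ ⌊2 * c⌋₊, logPrime n / n ≤ 4 := by
      calc ∑ n ∈ Finset.Ioc ⌊c⌋₊ ⌊2 * c⌋₊, logPrime n / n
          ≤ ∑ n ∈ Finset.Ioc ⌊c⌋₊ ⌊2 * c⌋₊, logPrime n / c := by
            refine Finset.sum_le_sum fun n hn => ?_
            have := (Nat.floor_lt hc0.le).1 (Finset.mem_Ioc.1 hn).1
            have := logPrime_nonneg n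
            gcongr
        _ ≤ ∑ n ∈ Finset.Ioc 0 ⌊2 * c⌋₊, logPrime n / c := by
            refine Finset.sum_le_sum_of_subset_of_nonneg
              (Finset.Ioc_subset_Ioc_left (Nat.zero_le _)) fun n _ _ => ?_
            have := logPrime_nonneg n
            positivity
        _ ≤ 4 := by
            rw [← Finset.sum_div, div_le_iff₀ hc0]
            linarith [sum_logPrime_le (y := 2 * c) (by positivity)]
    have hb' : b ≤ 2 * c := by rw [hc]; rw [pow_succ] at hb; linarith
    calc ∑ n ∈ Finset.Ioc ⌊a⌋₊ ⌊b⌋₊, logPrime n / n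
        ≤ ∑ n ∈ Finset.Ioc ⌊a⌋₊ ⌊2 * c⌋₊, logPrime n / n := by
          refine Finset.sum_le_sum_of_subset_of_nonneg
            (Finset.Ioc_subset_Ioc_right (Nat.floor_le_floor hb')) fun n _ _ => ?_
          have := logPrime_nonneg n
          positivity
      _ = ∑ n ∈ Finset.Ioc ⌊a⌋₊ ⌊c⌋₊, logPrime n / n +
          ∑ n ∈ Finset.Ioc ⌊c⌋₊ ⌊2 * c⌋₊, logPrime n / n := by
          rw [← Finset.sum_Ioc_consecutive _ hac (Nat.floor_le_floor (by linarith))]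
      _ ≤ 4 * (k + 1 : ℕ) := by push_cast; linarith

lemma sum_logPrime_div_le {a b : ℝ} (ha : 0 < a) (hab : a ≤ b) :
    ∑ n ∈ Finset.Ioc ⌊a⌋₊ ⌊b⌋₊, logPrime n / n ≤ 8 * (1 + Real.log (b / a)) := by
  have hba : 1 ≤ b / a := by rw [le_div_iff₀ ha]; linarith
  have hl := Real.log_nonneg hba
  have hl2 := Real.log_two_gt_d9
  refine (sum_logPrime_div_le_of_doubling ha ⌈Real.log (b / a) / Real.log 2⌉₊ ?_).trans ?_
  · rw [← div_le_iff₀ ha]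
    refine (Real.log_le_log_iff (by linarith) (by positivity)).1 ?_
    rw [Real.log_pow, ← div_le_iff₀ (by linarith)]
    exact Nat.le_ceil _
  · have h1 := Nat.ceil_lt_add_one (a := Real.log (b / a) / Real.log 2)
      (div_nonneg hl (by linarith))
    have h2 : Real.log (b / a) / Real.log 2 ≤ 2 * Real.log (b / a) := by
      rw [div_le_iff₀ (by linarith)]; nlinarith
    linarith

lemma sum_logPrime_div_le' {x : ℝ} (hx : 1 ≤ x) :
    ∑ n ∈ Finset.Ioc 0 ⌊x⌋₊, logPrime n / n ≤ 8 * (1 + Real.log x) := by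
  have h := sum_logPrime_div_le one_pos hx
  rw [div_one, Nat.floor_one] at h
  rw [← Finset.sum_Ioc_consecutive _ zero_le_one (Nat.le_floor (by simpa using hx))]
  simpa [logPrime, show Finset.Ioc 0 1 = {1} from rfl] using h

lemma intervalIntegrable_ite {g : ℝ → ℝ} (hg : Continuous g) (r b : ℝ) :
    IntervalIntegrable (fun t => if r * t ≤ b then g t else 0) volume 0 1 := by
  rw [intervalIntegrable_iff]
  have h := hg.integrableOn_uIoc (a := 0) (b := 1) (μ := volume)
  have hs : MeasurableSet {t : ℝ | r * t ≤ b} :=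
    measurableSet_le (by fun_prop) (by fun_prop)
  refine (h.indicator hs).congr ?_
  filter_upwards with t
  simp [indicator_apply]

lemma integral_eq_mul_integral_ite {φ : ℝ → ℝ} {b r : ℝ} (hr : 0 < r) (hb : 0 ≤ b) (hbr : b ≤ r) :
    ∫ u in (0 : ℝ)..b, φ u = r * ∫ t in (0 : ℝ)..1, if r * t ≤ b then φ (r * t) else 0 := by
  have h1 : (∫ t in (0 : ℝ)..1, if r * t ≤ b then φ (r * t) else 0) =
      ∫ t in (0 : ℝ)..(b / r), φ (r * t) := by
    rw [intervalIntegral.integral_of_le zero_le_one,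
      intervalIntegral.integral_of_le (by positivity)]
    have hs : MeasurableSet {t : ℝ | r * t ≤ b} :=
      measurableSet_le (by fun_prop) (by fun_prop)
    have : (fun t => if r * t ≤ b then φ (r * t) else 0) =
        indicator {t : ℝ | r * t ≤ b} (fun t => φ (r * t)) := by
      ext t; simp [indicator_apply]
    rw [this, setIntegral_indicator hs]
    congr 2
    ext t
    simp only [mem_inter_iff, mem_Ioc, mem_ofPred_eq, le_div_iff₀ hr]
    constructor
    · rintro ⟨⟨h1, -⟩, h2⟩
      exact ⟨h1, by linarith⟩
    · rintro ⟨h1, h2⟩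
      exact ⟨⟨h1, by nlinarith⟩, by linarith⟩
  rw [h1, intervalIntegral.integral_comp_mul_left _ hr.ne', smul_eq_mul, mul_zero,
    mul_div_cancel₀ _ hr.ne', mul_inv_cancel_left₀ hr.ne']

lemma abs_integral_sub_le {g h d : ℝ → ℝ} (hg : IntervalIntegrable g volume 0 1)
    (hh : IntervalIntegrable h volume 0 1) (hd : IntervalIntegrable d volume 0 1)
    (hle : ∀ t ∈ Ioc (0 : ℝ) 1, |g t - h t| ≤ d t) :
    |(∫ t in (0 : ℝ)..1, g t) - ∫ t in (0 : ℝ)..1, h t| ≤ ∫ t in (0 : ℝ)..1, d t := by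
  rw [← intervalIntegral.integral_sub hg hh]
  exact intervalIntegral.norm_integral_le_of_norm_le (f := fun t => g t - h t) (μ := volume)
    zero_le_one (ae_of_all _ hle) hd

lemma intervalIntegrable_div_id {f : ℝ → ℝ} {K : ℝ} (hc : Continuous f) (h0 : ∀ t, 0 ≤ f t)
    (hK : ∀ t, 0 ≤ t → f t ≤ K * t) : IntervalIntegrable (fun t => f t / t) volume 0 1 := by
  rw [intervalIntegrable_iff, uIoc_of_le zero_le_one]
  refine IntegrableOn.of_bound (by simp) ?_ K ?_
  · exact (hc.measurable.div measurable_id).aestronglyMeasurable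
  · filter_upwards [ae_restrict_mem measurableSet_Ioc] with t ht
    rw [Real.norm_of_nonneg (div_nonneg (h0 t) ht.1.le), div_le_iff₀ ht.1]
    exact hK t ht.1.le

/-- The weighted sum over products of two primes. -/
noncomputable def pairSum (f : ℝ → ℝ) (x : ℝ) : ℝ :=
  ∑ r ∈ Finset.Ioc 0 ⌊x⌋₊, logPrime r *
    ∑ p ∈ Finset.Ioc 0 ⌊min (r : ℝ) (x / r)⌋₊, f (p / r) * logPrime p

lemma thetaErr_rpow_le {x X : ℝ} {k : ℕ} (hX : 1 ≤ X) (hk : 1 ≤ k) (hXx : X ^ k = x) :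
    thetaErr X ≤ k ^ 3 * (X / (1 + Real.log x) ^ 3) := by
  have hl := Real.log_nonneg hX
  have hlx : Real.log x = k * Real.log X := by rw [← hXx, Real.log_pow]
  have hk' : (1 : ℝ) ≤ k := by exact_mod_cast hk
  unfold thetaErr
  rw [← mul_div_assoc, div_le_div_iff₀ (by positivity) (by rw [hlx]; positivity)]
  have h1 : (1 + Real.log x) ^ 3 ≤ (k * (1 + Real.log X)) ^ 3 := by
    have : 0 ≤ Real.log x := by rw [hlx]; positivity
    gcongr
    rw [hlx]; nlinarith
  calc X * (1 + Real.log x) ^ 3 ≤ X * (k * (1 + Real.log X)) ^ 3 := by gcongr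
    _ = _ := by ring

lemma pairSum_step_one {f : ℝ → ℝ} {K : ℝ} (hm : Monotone f)
    (h0 : ∀ t, 0 ≤ f t) (hK : ∀ t, 0 ≤ t → f t ≤ K * t) :
    ∃ D, 0 ≤ D ∧ ∀ x : ℝ, 1 ≤ x →
      |pairSum f x - ∑ r ∈ Finset.Ioc 0 ⌊x⌋₊, logPrime r *
        (r * ∫ t in (0 : ℝ)..1, if (r : ℝ) * t ≤ min (r : ℝ) (x / r) then f t else 0)| ≤
      D * (x / (1 + Real.log x) ^ 2) := by
  obtain ⟨C, hC, hE⟩ := exists_theta_err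
  have hK0 : 0 ≤ K := by have := hK 1 zero_le_one; have := h0 1; linarith
  refine ⟨4 * C * K * 216 * 8, by positivity, fun x hx => ?_⟩
  have hl := Real.log_nonneg hx
  have hx0 : 0 < x := by linarith
  have hs1 : 1 ≤ √x := Real.one_le_sqrt.2 hx
  rw [pairSum, ← Finset.sum_sub_distrib]
  refine (Finset.abs_sum_le_sum_abs _ _).trans ?_
  have key : ∀ r ∈ Finset.Ioc 0 ⌊x⌋₊,
      |logPrime r * ∑ p ∈ Finset.Ioc 0 ⌊min (r : ℝ) (x / r)⌋₊, f (p / r) * logPrime p -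
        logPrime r * (r * ∫ t in (0 : ℝ)..1,
          if (r : ℝ) * t ≤ min (r : ℝ) (x / r) then f t else 0)| ≤
      4 * C * K * 216 * (x / (1 + Real.log x) ^ 3) * (logPrime r / r) := by
    intro r hr
    rw [Finset.mem_Ioc] at hr
    have hr1 : (1 : ℝ) ≤ r := by exact_mod_cast hr.1
    have hr0 : (0 : ℝ) < r := by linarith
    have hrx : (r : ℝ) ≤ x := (Nat.le_floor_iff hx0.le).1 hr.2
    set m := min (r : ℝ) (x / r) with hmdef
    have hm1 : 1 ≤ m := le_min hr1 (by rw [le_div_iff₀ hr0]; linarith)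
    have hmr : m ≤ r := min_le_left _ _
    have hms : m ≤ √x := by
      apply Real.le_sqrt_of_sq_le
      rw [sq]
      calc m * m ≤ r * (x / r) := by gcongr; exact min_le_right _ _
        _ = x := by field_simp
    obtain ⟨hE1, hE2⟩ := hE m hm1
    have hφ : MonotoneOn (fun u : ℝ => f (u / r)) (Icc 0 m) :=
      fun u _ v _ huv => hm (by gcongr)
    have h1 := abs_sum_logPrime_sub_integral_le (by linarith) hE1 hφ (h0 _) hE2
    have h2 := integral_eq_mul_integral_ite (φ := fun u : ℝ => f (u / r)) hr0
      (by linarith : (0 : ℝ) ≤ m) hmr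
    simp only [mul_div_cancel_left₀ _ hr0.ne'] at h2
    rw [h2] at h1
    rw [← mul_sub, abs_mul, abs_of_nonneg (logPrime_nonneg r)]
    have h3 : thetaErr m ≤ 216 * (√x / (1 + Real.log x) ^ 3) := by
      have h4 := thetaErr_le hm1 hms
      have h5 := thetaErr_rpow_le (k := 2) hs1 (by norm_num) (Real.sq_sqrt hx0.le)
      norm_num at h5
      linarith
    have h6 : f (m / r) ≤ K * (√x / r) := (hK _ (by positivity)).trans (by gcongr)
    calc logPrime r * _ ≤ logPrime r * (4 * (C * thetaErr m) * f (m / r)) := by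
          gcongr
          · exact logPrime_nonneg r
      _ ≤ logPrime r * (4 * (C * (216 * (√x / (1 + Real.log x) ^ 3))) * (K * (√x / r))) := by
          gcongr
          · exact logPrime_nonneg r
          · exact h0 _
      _ = 4 * C * K * 216 * ((√x * √x) / (1 + Real.log x) ^ 3) * (logPrime r / r) := by ring
      _ = _ := by rw [Real.mul_self_sqrt hx0.le]
  refine (Finset.sum_le_sum key).trans ?_
  rw [← Finset.mul_sum]
  calc _ ≤ 4 * C * K * 216 * (x / (1 + Real.log x) ^ 3) * (8 * (1 + Real.log x)) := by
        gcongr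
        exact sum_logPrime_div_le' hx
    _ = _ := by field_simp

lemma intervalIntegrable_sum {ι : Type*} {s : Finset ι} {F : ι → ℝ → ℝ} {a b : ℝ}
    (h : ∀ i ∈ s, IntervalIntegrable (F i) volume a b) :
    IntervalIntegrable (fun t => ∑ i ∈ s, F i t) volume a b := by
  have := IntervalIntegrable.sum s h
  rwa [show (∑ i ∈ s, F i) = fun t => ∑ i ∈ s, F i t from funext fun t => by simp] at this

lemma filter_mul_le_min {x t : ℝ} (hx : 1 ≤ x) (ht : t ∈ Ioc (0 : ℝ) 1) :
    (Finset.Ioc 0 ⌊x⌋₊).filter (fun r : ℕ => (r : ℝ) * t ≤ min (r : ℝ) (x / r)) =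
      Finset.Ioc 0 ⌊min x (√(x / t))⌋₊ := by
  have hx0 : 0 < x := by linarith
  have ht0 := ht.1
  ext r
  simp only [Finset.mem_filter, Finset.mem_Ioc]
  rw [Nat.le_floor_iff hx0.le, Nat.le_floor_iff (by positivity), le_min_iff, le_min_iff, and_assoc]
  refine and_congr_right fun hr => and_congr_right fun hrx => ?_
  have hr0 : (0 : ℝ) < r := by exact_mod_cast hr
  rw [Real.le_sqrt' hr0, le_div_iff₀ hr0, le_div_iff₀ ht0]
  constructor
  · rintro ⟨-, h⟩; linarith
  · intro h; exact ⟨by nlinarith [ht.2], by linarith⟩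

lemma abs_sum_mul_logPrime_sub_le (k : ℕ) :
    ∃ D, 0 ≤ D ∧ ∀ y : ℝ, 1 ≤ y →
      |∑ n ∈ Finset.Ioc 0 ⌊y⌋₊, (n : ℝ) ^ k * logPrime n - y ^ (k + 1) / (k + 1)| ≤
        D * (y ^ (k + 1) / (1 + Real.log y) ^ 3) := by
  obtain ⟨C, hC, hE⟩ := exists_theta_err
  refine ⟨4 * C, by positivity, fun y hy => ?_⟩
  obtain ⟨hE1, hE2⟩ := hE y hy
  have hφ : MonotoneOn (fun u : ℝ => u ^ k) (Icc 0 y) :=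
    fun u hu v _ huv => pow_le_pow_left₀ hu.1 huv k
  have h1 := abs_sum_logPrime_sub_integral_le (by linarith) hE1 hφ (by positivity) hE2
  have h2 : ∫ u in (0 : ℝ)..y, u ^ k = y ^ (k + 1) / (k + 1) := by simp
  rw [h2] at h1
  refine h1.trans (le_of_eq ?_)
  unfold thetaErr
  ring

lemma one_le_mul_div_log_pow {x : ℝ} (hx : 1 ≤ x) {k : ℕ} (hk : k ≤ 3) :
    1 ≤ 27 * (x / (1 + Real.log x) ^ k) := by
  have hl := Real.log_nonneg hx
  have h := one_add_log_pow_three_le hx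
  have h2 : (1 + Real.log x) ^ k ≤ (1 + Real.log x) ^ 3 :=
    pow_le_pow_right₀ (by linarith) hk
  rw [← mul_div_assoc, le_div_iff₀ (by positivity)]
  linarith

lemma integral_ite_lt_le {c δ : ℝ} (hc : 0 ≤ c) (hδ : 0 ≤ δ) :
    IntervalIntegrable (fun t => if t < δ then c else 0) volume 0 1 ∧
    ∫ t in (0 : ℝ)..1, (if t < δ then c else 0) ≤ c * δ := by
  have h1 : (fun t => if t < δ then c else 0) = indicator (Iio δ) (fun _ => c) := by
    ext t; simp [indicator_apply]
  have hint : IntegrableOn (indicator (Iio δ) (fun _ => c)) (Ioc 0 1) :=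
    (integrableOn_const (by simp)).indicator measurableSet_Iio
  refine ⟨by rw [h1, intervalIntegrable_iff, uIoc_of_le zero_le_one]; exact hint, ?_⟩
  rw [h1, intervalIntegral.integral_of_le zero_le_one, setIntegral_indicator measurableSet_Iio,
    setIntegral_const, smul_eq_mul, mul_comm]
  refine mul_le_mul_of_nonneg_left ?_ hc
  have : (volume.real (Ioc 0 1 ∩ Iio δ)) ≤ volume.real (Ioc 0 δ) :=
    measureReal_mono (fun t ht => ⟨ht.1.1, (mem_Iio.1 ht.2).le⟩) (by simp)
  simpa [hδ, Measure.real] using this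

lemma abs_sum_filter_sub_le :
    ∃ D, 0 ≤ D ∧ ∀ x : ℝ, 1 ≤ x → ∀ t ∈ Ioc (0 : ℝ) 1,
      |(∑ r ∈ Finset.Ioc 0 ⌊x⌋₊, if (r : ℝ) * t ≤ min (r : ℝ) (x / r) then r * logPrime r else 0) -
        x / (2 * t)| ≤ D * (x / (1 + Real.log x) ^ 3) / t + if t < 1 / x then x / t else 0 := by
  obtain ⟨D, hD, h⟩ := abs_sum_mul_logPrime_sub_le 1
  refine ⟨8 * D, by positivity, fun x hx t ht => ?_⟩
  have hx0 : 0 < x := by linarith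
  have hl := Real.log_nonneg hx
  have ht0 := ht.1
  rw [← Finset.sum_filter, filter_mul_le_min hx ht]
  have hs1 : 1 ≤ √x := Real.one_le_sqrt.2 hx
  set y := min x (√(x / t)) with hy
  have hxy : √x ≤ y := by
    refine le_min (Real.sqrt_le_iff.2 ⟨hx0.le, by nlinarith⟩) (Real.sqrt_le_sqrt ?_)
    rw [le_div_iff₀ ht0]; nlinarith [ht.2]
  have hy2 : y ^ 2 ≤ x / t := by
    calc y ^ 2 ≤ √(x / t) ^ 2 := by gcongr; exact min_le_right _ _
      _ = x / t := Real.sq_sqrt (by positivity)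
  have h1 := h y (hs1.trans hxy)
  norm_num at h1
  have hly : Real.log x ≤ 2 * Real.log y := by
    have := Real.log_le_log (by positivity) hxy
    rw [Real.log_sqrt hx0.le] at this
    linarith
  have h2 : y ^ 2 / (1 + Real.log y) ^ 3 ≤ 8 * (x / (1 + Real.log x) ^ 3) / t := by
    calc y ^ 2 / (1 + Real.log y) ^ 3 ≤ (x / t) / ((1 + Real.log x) / 2) ^ 3 := by
          gcongr
          linarith
      _ = _ := by field_simp; norm_num
  have h3 : |y ^ 2 / 2 - x / (2 * t)| ≤ if t < 1 / x then x / t else 0 := by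
    have e : x / (2 * t) = x / t / 2 := by field_simp
    split_ifs with hlt
    · rw [e, abs_le]
      constructor <;> nlinarith [sq_nonneg y]
    · have hle : √(x / t) ≤ x := by
        rw [not_lt, div_le_iff₀ hx0] at hlt
        refine Real.sqrt_le_iff.2 ⟨hx0.le, ?_⟩
        rw [div_le_iff₀ ht0]
        nlinarith
      rw [hy, min_eq_right hle, Real.sq_sqrt (by positivity), e]
      simp
  calc _ ≤ |∑ r ∈ Finset.Ioc 0 ⌊y⌋₊, r * logPrime r - y ^ 2 / 2| + |y ^ 2 / 2 - x / (2 * t)| :=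
        abs_sub_le _ _ _
    _ ≤ _ := by
        gcongr
        refine h1.trans ((mul_le_mul_of_nonneg_left h2 hD).trans (le_of_eq ?_))
        ring

theorem exists_pairSum_sub_le {f : ℝ → ℝ} {K : ℝ} (hm : Monotone f) (hc : Continuous f)
    (h0 : ∀ t, 0 ≤ f t) (hK : ∀ t, 0 ≤ t → f t ≤ K * t) :
    ∃ D, 0 ≤ D ∧ ∀ x : ℝ, 1 ≤ x →
      |pairSum f x - (∫ t in (0 : ℝ)..1, f t / t) / 2 * x| ≤ D * (x / (1 + Real.log x) ^ 2) := by
  obtain ⟨D₁, hD₁, h₁⟩ := pairSum_step_one hm h0 hK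
  obtain ⟨D₂, hD₂, h₂⟩ := abs_sum_filter_sub_le
  have hK0 : 0 ≤ K := by have := hK 1 zero_le_one; have := h0 1; linarith
  refine ⟨D₁ + K * (D₂ + 27), by positivity, fun x hx => ?_⟩
  have hx0 : 0 < x := by linarith
  have hl := Real.log_nonneg hx
  have hswap : ∑ r ∈ Finset.Ioc 0 ⌊x⌋₊, logPrime r *
        (r * ∫ t in (0 : ℝ)..1, if (r : ℝ) * t ≤ min (r : ℝ) (x / r) then f t else 0) =
      ∫ t in (0 : ℝ)..1, f t * ∑ r ∈ Finset.Ioc 0 ⌊x⌋₊,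
        if (r : ℝ) * t ≤ min (r : ℝ) (x / r) then r * logPrime r else 0 := by
    simp only [Finset.mul_sum]
    rw [intervalIntegral.integral_finsetSum]
    · refine Finset.sum_congr rfl fun r _ => ?_
      rw [← mul_assoc, ← intervalIntegral.integral_const_mul]
      congr 1; ext t
      split_ifs <;> ring
    · intro r _
      refine ((intervalIntegrable_ite hc r (min r (x / r))).const_mul (r * logPrime r)).congr ?_
      intro t _
      dsimp only
      split_ifs <;> ring
  have hint1 : IntervalIntegrable (fun t => f t * ∑ r ∈ Finset.Ioc 0 ⌊x⌋₊,
        if (r : ℝ) * t ≤ min (r : ℝ) (x / r) then r * logPrime r else 0) volume 0 1 := by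
    simp only [Finset.mul_sum]
    refine intervalIntegrable_sum fun r _ => ?_
    refine ((intervalIntegrable_ite hc r (min r (x / r))).const_mul (r * logPrime r)).congr ?_
    intro t _
    dsimp only
    split_ifs <;> ring
  have hint2 := (intervalIntegrable_div_id hc h0 hK).mul_const (x / 2)
  obtain ⟨hint3, hI3⟩ := integral_ite_lt_le (c := K * x) (δ := 1 / x) (by positivity)
    (by positivity)
  have hmain := abs_integral_sub_le hint1 hint2
    (d := fun t => K * (D₂ * (x / (1 + Real.log x) ^ 3)) + if t < 1 / x then K * x else 0)
    ((by simp : IntervalIntegrable (fun _ : ℝ => K * (D₂ * (x / (1 + Real.log x) ^ 3)))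
      volume 0 1).add hint3) (by
    intro t ht
    have ht0 := ht.1
    have h3 := h₂ x hx t ht
    have h4 : f t / t ≤ K := by rw [div_le_iff₀ ht0]; exact hK t ht0.le
    rw [show f t / t * (x / 2) = f t * (x / (2 * t)) by field_simp, ← mul_sub, abs_mul,
      abs_of_nonneg (h0 t)]
    calc _ ≤ f t * (D₂ * (x / (1 + Real.log x) ^ 3) / t + if t < 1 / x then x / t else 0) := by
          gcongr
          exact h0 t
      _ = f t / t * (D₂ * (x / (1 + Real.log x) ^ 3) + if t < 1 / x then x else 0) := by
          split_ifs <;> field_simp; simp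
      _ ≤ K * (D₂ * (x / (1 + Real.log x) ^ 3) + if t < 1 / x then x else 0) := by
          have : 0 ≤ if t < 1 / x then x else 0 := by split_ifs <;> linarith
          gcongr
      _ = _ := by split_ifs <;> ring)
  rw [intervalIntegral.integral_add (by simp) hint3, intervalIntegral.integral_mul_const,
    intervalIntegral.integral_const] at hmain
  have h5 := h₁ x hx
  rw [hswap] at h5
  have h6 := one_le_mul_div_log_pow hx (k := 2) (by norm_num)
  have h7 : x / (1 + Real.log x) ^ 3 ≤ x / (1 + Real.log x) ^ 2 := by
    exact div_le_div_of_nonneg_left hx0.le (by positivity)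
      (pow_le_pow_right₀ (by linarith) (by norm_num))
  have h8 : K * x * (1 / x) = K := by field_simp
  have h9 := abs_sub_le (pairSum f x) (∫ t in (0 : ℝ)..1, f t * ∑ r ∈ Finset.Ioc 0 ⌊x⌋₊,
        if (r : ℝ) * t ≤ min (r : ℝ) (x / r) then r * logPrime r else 0)
        ((∫ t in (0 : ℝ)..1, f t / t) / 2 * x)
  rw [show (∫ t in (0 : ℝ)..1, f t / t) / 2 * x = (∫ t in (0 : ℝ)..1, f t / t) * (x / 2) by ring]
    at h9 ⊢
  simp only [sub_zero, one_smul] at hmain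
  have h10 : K * (D₂ * (x / (1 + Real.log x) ^ 3)) ≤ K * (D₂ * (x / (1 + Real.log x) ^ 2)) := by
    gcongr
  nlinarith

/-- The weighted sum over products of three primes. -/
noncomputable def tripleSum (f : ℝ → ℝ) (x : ℝ) : ℝ :=
  ∑ r ∈ Finset.Ioc 0 ⌊x⌋₊, logPrime r * ∑ q ∈ Finset.Ioc 0 r, logPrime q *
    ∑ p ∈ Finset.Ioc 0 ⌊min (q : ℝ) (x / (q * r))⌋₊, f (p / r) * logPrime p

lemma exists_cube_root {x : ℝ} (hx : 0 < x) : ∃ X : ℝ, 0 < X ∧ X ^ 3 = x := by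
  refine ⟨x ^ (1 / 3 : ℝ), by positivity, ?_⟩
  rw [← Real.rpow_natCast, ← Real.rpow_mul hx.le]
  norm_num

lemma one_le_of_cube {X x : ℝ} (hX : 0 < X) (hXx : X ^ 3 = x) (hx : 1 ≤ x) : 1 ≤ X := by
  by_contra! h
  have : X ^ 3 < 1 := pow_lt_one₀ hX.le h (by norm_num)
  linarith

lemma sum_logPrime_div_le_of_le {x : ℝ} (hx : 1 ≤ x) {r : ℕ} (hr : r ≤ ⌊x⌋₊) :
    ∑ q ∈ Finset.Ioc 0 r, logPrime q / q ≤ 8 * (1 + Real.log x) := by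
  refine le_trans ?_ (sum_logPrime_div_le' hx)
  refine Finset.sum_le_sum_of_subset_of_nonneg (Finset.Ioc_subset_Ioc_right hr) fun i _ _ => ?_
  exact div_nonneg (logPrime_nonneg i) (by positivity)

lemma tripleSum_step_one {f : ℝ → ℝ} {K : ℝ} (hm : Monotone f)
    (h0 : ∀ t, 0 ≤ f t) (hK : ∀ t, 0 ≤ t → f t ≤ K * t) :
    ∃ D, 0 ≤ D ∧ ∀ x : ℝ, 1 ≤ x →
      |tripleSum f x - ∑ r ∈ Finset.Ioc 0 ⌊x⌋₊, logPrime r * ∑ q ∈ Finset.Ioc 0 r, logPrime q *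
        (q * ∫ t in (0 : ℝ)..1,
          if (q : ℝ) * t ≤ min (q : ℝ) (x / (q * r)) then f (q * t / r) else 0)| ≤
      D * (x / (1 + Real.log x)) := by
  obtain ⟨C, hC, hE⟩ := exists_theta_err
  have hK0 : 0 ≤ K := by have := hK 1 zero_le_one; have := h0 1; linarith
  refine ⟨4 * C * K * 27 * 64, by positivity, fun x hx => ?_⟩
  have hl := Real.log_nonneg hx
  have hx0 : 0 < x := by linarith
  obtain ⟨X, hX0, hXx⟩ := exists_cube_root hx0
  have hX1 := one_le_of_cube hX0 hXx hx
  obtain ⟨hE1, hE2⟩ := hE X hX1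
  have hXerr := thetaErr_rpow_le (k := 3) hX1 (by norm_num) hXx
  norm_num at hXerr
  set B := 4 * C * K * 27 * (x / (1 + Real.log x) ^ 3) with hB
  have hB0 : 0 ≤ B := by positivity
  have key : ∀ r ∈ Finset.Ioc 0 ⌊x⌋₊, ∀ q ∈ Finset.Ioc 0 r,
      |(∑ p ∈ Finset.Ioc 0 ⌊min (q : ℝ) (x / (q * r))⌋₊, f (p / r) * logPrime p) -
        (q * ∫ t in (0 : ℝ)..1,
          if (q : ℝ) * t ≤ min (q : ℝ) (x / (q * r)) then f (q * t / r) else 0)| ≤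
      B / (q * r) := by
    intro r hr q hq
    rw [Finset.mem_Ioc] at hr hq
    have hq0 : (0 : ℝ) < q := by exact_mod_cast hq.1
    have hqr : (q : ℝ) ≤ r := by exact_mod_cast hq.2
    have hr0 : (0 : ℝ) < r := by linarith
    set m := min (q : ℝ) (x / (q * r)) with hmdef
    have hm0 : 0 ≤ m := le_min hq0.le (by positivity)
    have hmq : m ≤ q := min_le_left _ _
    have hmx : m * (q * r) ≤ x := by
      rw [← le_div_iff₀ (by positivity)]; exact min_le_right _ _
    have hmX : m ≤ X := by
      refine le_of_pow_le_pow_left₀ (n := 3) (by norm_num) hX0.le ?_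
      rw [hXx]
      calc m ^ 3 = m * (m * m) := by ring
        _ ≤ m * (q * r) := by gcongr; linarith
        _ ≤ x := hmx
    have hmX2 : m * q ≤ X ^ 2 := by
      rcases le_total (q : ℝ) X with h | h
      · nlinarith
      · have h1 : m * q * X ≤ X ^ 2 * X := by
          calc m * q * X ≤ m * q * r := by gcongr; linarith
            _ ≤ X ^ 2 * X := by rw [← pow_succ, hXx]; linarith
        exact le_of_mul_le_mul_right h1 hX0
    have hφ : MonotoneOn (fun u : ℝ => f (u / r)) (Icc 0 m) :=
      fun u _ v _ huv => hm (by gcongr)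
    have h1 := abs_sum_logPrime_sub_integral_le hm0 hE1 hφ (h0 _)
      (fun u hu => hE2 u ⟨hu.1, hu.2.trans hmX⟩)
    have h2 := integral_eq_mul_integral_ite (φ := fun u : ℝ => f (u / r)) hq0 hm0 hmq
    rw [h2] at h1
    refine h1.trans ?_
    have h6 : f (m / r) ≤ K * (X ^ 2 / (q * r)) := by
      refine (hK _ (by positivity)).trans ?_
      gcongr ?_ * ?_
      rw [div_le_div_iff₀ hr0 (by positivity)]
      nlinarith
    calc 4 * (C * thetaErr X) * f (m / r)
        ≤ 4 * (C * (27 * (X / (1 + Real.log x) ^ 3))) * (K * (X ^ 2 / (q * r))) := by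
          gcongr
          exact h0 _
      _ = 4 * C * K * 27 * (X ^ 3 / (1 + Real.log x) ^ 3) / (q * r) := by ring
      _ = _ := by rw [hXx]
  rw [tripleSum, ← Finset.sum_sub_distrib]
  refine (Finset.abs_sum_le_sum_abs _ _).trans ?_
  calc _ ≤ ∑ r ∈ Finset.Ioc 0 ⌊x⌋₊, logPrime r / r * (B * (8 * (1 + Real.log x))) := by
        refine Finset.sum_le_sum fun r hr => ?_
        rw [← mul_sub, ← Finset.sum_sub_distrib, abs_mul, abs_of_nonneg (logPrime_nonneg r)]
        rw [div_mul_eq_mul_div, mul_div_assoc]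
        refine mul_le_mul_of_nonneg_left ?_ (logPrime_nonneg r)
        refine (Finset.abs_sum_le_sum_abs _ _).trans ?_
        calc _ ≤ ∑ q ∈ Finset.Ioc 0 r, B / r * (logPrime q / q) := by
              refine Finset.sum_le_sum fun q hq => ?_
              rw [← mul_sub, abs_mul, abs_of_nonneg (logPrime_nonneg q)]
              calc _ ≤ logPrime q * (B / (q * r)) :=
                    mul_le_mul_of_nonneg_left (key r hr q hq) (logPrime_nonneg q)
                _ = _ := by ring
          _ ≤ B / r * (8 * (1 + Real.log x)) := by
              rw [← Finset.mul_sum]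
              gcongr
              exact sum_logPrime_div_le_of_le hx (Finset.mem_Ioc.1 hr).2
          _ = _ := by ring
    _ ≤ (8 * (1 + Real.log x)) * (B * (8 * (1 + Real.log x))) := by
        rw [← Finset.sum_mul]
        gcongr
        exact sum_logPrime_div_le' hx
    _ = _ := by rw [hB]; field_simp; ring

lemma tripleSum_step_two {f : ℝ → ℝ} {K : ℝ} (hm : Monotone f)
    (h0 : ∀ t, 0 ≤ f t) (hK : ∀ t, 0 ≤ t → f t ≤ K * t) :
    ∃ D, 0 ≤ D ∧ ∀ x : ℝ, 1 ≤ x → ∀ t ∈ Ioc (0 : ℝ) 1,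
      |(∑ r ∈ Finset.Ioc 0 ⌊x⌋₊, logPrime r * ∑ q ∈ Finset.Ioc 0 r, logPrime q *
        (q * if (q : ℝ) * t ≤ min (q : ℝ) (x / (q * r)) then f (q * t / r) else 0)) -
       ∑ r ∈ Finset.Ioc 0 ⌊x⌋₊, logPrime r * (r ^ 2 * ∫ b in (0 : ℝ)..1,
        if (r : ℝ) * b ≤ min (r : ℝ) (√(x / (r * t))) then b * f (b * t) else 0)| ≤
      D * (x / (1 + Real.log x) ^ 2) := by
  obtain ⟨C, hC, hE⟩ := exists_theta_err
  have hK0 : 0 ≤ K := by have := hK 1 zero_le_one; have := h0 1; linarith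
  refine ⟨4 * C * K * 729 * 8, by positivity, fun x hx t ht => ?_⟩
  have hl := Real.log_nonneg hx
  have hx0 : 0 < x := by linarith
  have ht0 := ht.1
  obtain ⟨X, hX0, hXx⟩ := exists_cube_root hx0
  have hX1 := one_le_of_cube hX0 hXx hx
  have hlX := Real.log_nonneg hX1
  have hlx : Real.log x = 3 * Real.log X := by rw [← hXx, Real.log_pow]; norm_num
  have key : ∀ r ∈ Finset.Ioc 0 ⌊x⌋₊,
      |(∑ q ∈ Finset.Ioc 0 r, logPrime q *
        (q * if (q : ℝ) * t ≤ min (q : ℝ) (x / (q * r)) then f (q * t / r) else 0)) -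
        r ^ 2 * ∫ b in (0 : ℝ)..1,
        if (r : ℝ) * b ≤ min (r : ℝ) (√(x / (r * t))) then b * f (b * t) else 0| ≤
      4 * C * K * 729 * (x / (1 + Real.log x) ^ 3) / r := by
    intro r hr
    rw [Finset.mem_Ioc] at hr
    have hr1 : (1 : ℝ) ≤ r := by exact_mod_cast hr.1
    have hr0 : (0 : ℝ) < r := by linarith
    set m := min (r : ℝ) (√(x / (r * t))) with hmdef
    have hm0 : 0 ≤ m := le_min hr0.le (by positivity)
    have hmr : m ≤ r := min_le_left _ _
    have hm2 : m ^ 2 * (r * t) ≤ x := by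
      rw [← le_div_iff₀ (by positivity)]
      calc m ^ 2 ≤ √(x / (r * t)) ^ 2 := by gcongr; exact min_le_right _ _
        _ = _ := Real.sq_sqrt (by positivity)
    obtain ⟨hE1, hE2⟩ := hE r hr1
    have hφ : MonotoneOn (fun u : ℝ => u * f (u * t / r)) (Icc 0 m) :=
      fun u hu v hv huv => mul_le_mul huv (hm (by gcongr)) (h0 _) hv.1
    have h1 := abs_sum_logPrime_sub_integral_le hm0 hE1 hφ (by simp)
      (fun u hu => hE2 u ⟨hu.1, hu.2.trans hmr⟩)
    have h2 := integral_eq_mul_integral_ite (φ := fun u : ℝ => u * f (u * t / r)) hr0 hm0 hmr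
    have h3 : (r : ℝ) ^ 2 * (∫ b in (0 : ℝ)..1, if (r : ℝ) * b ≤ m then b * f (b * t) else 0) =
        ∫ u in (0 : ℝ)..m, u * f (u * t / r) := by
      rw [h2, sq, mul_assoc, ← intervalIntegral.integral_const_mul (r : ℝ)]
      congr 3
      ext b
      split_ifs
      · rw [show (r : ℝ) * b * t / r = b * t by field_simp]; ring
      · simp
    have h4 : (∑ q ∈ Finset.Ioc 0 r, logPrime q *
        (q * if (q : ℝ) * t ≤ min (q : ℝ) (x / (q * r)) then f (q * t / r) else 0)) =
        ∑ q ∈ Finset.Ioc 0 ⌊m⌋₊, (q * f (q * t / r)) * logPrime q := by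
      have hsub : Finset.Ioc 0 ⌊m⌋₊ ⊆ Finset.Ioc 0 r := by
        refine Finset.Ioc_subset_Ioc_right ?_
        exact_mod_cast (Nat.floor_le hm0).trans hmr
      rw [← Finset.sum_subset hsub]
      · refine Finset.sum_congr rfl fun q hq => ?_
        rw [Finset.mem_Ioc, Nat.le_floor_iff hm0, hmdef, le_min_iff] at hq
        have hq0 : (0 : ℝ) < q := by exact_mod_cast hq.1
        rw [if_pos]
        · ring
        · refine le_min (by nlinarith [ht.2]) ?_
          have := (Real.le_sqrt' hq0).1 hq.2.2
          rw [le_div_iff₀ (by positivity)] at this ⊢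
          nlinarith
      · intro q hq hq'
        rw [Finset.mem_Ioc] at hq
        have hq0 : (0 : ℝ) < q := by exact_mod_cast hq.1
        rw [if_neg]
        · ring
        · intro hcon
          apply hq'
          rw [Finset.mem_Ioc, Nat.le_floor_iff hm0, hmdef, le_min_iff]
          refine ⟨hq.1, by exact_mod_cast hq.2, ?_⟩
          rw [Real.le_sqrt' hq0, le_div_iff₀ (by positivity)]
          have := hcon.trans (min_le_right _ _)
          rw [le_div_iff₀ (by positivity)] at this
          nlinarith
    rw [h3, h4]
    refine h1.trans ?_
    have h5 : m * f (m * t / r) ≤ K * (m ^ 2 * t / r) := by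
      calc m * f (m * t / r) ≤ m * (K * (m * t / r)) := by
            gcongr
            exact hK _ (by positivity)
        _ = _ := by ring
    have h6 : thetaErr r * (m ^ 2 * t / r) ≤ 729 * (x / (1 + Real.log x) ^ 3) / r := by
      have h7 : (1 + Real.log x) ^ 3 ≤ 27 * (1 + Real.log X) ^ 3 := by
        calc (1 + Real.log x) ^ 3 ≤ (3 * (1 + Real.log X)) ^ 3 := by gcongr; linarith
          _ = _ := by ring
      have h8 : thetaErr r * (m ^ 2 * t / r) ≤ 27 * (x / (1 + Real.log X) ^ 3) / r := by
        rcases le_total (r : ℝ) X with h | h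
        · have h9 := thetaErr_le hr1 h
          have h10 : m ^ 2 * t / r ≤ X ^ 2 / r := by
            gcongr
            calc m ^ 2 * t ≤ X ^ 2 * 1 := by
                  gcongr
                  · linarith
                  · exact ht.2
              _ = _ := mul_one _
          calc thetaErr r * (m ^ 2 * t / r) ≤ 27 * thetaErr X * (X ^ 2 / r) := by
                gcongr
                exact mul_nonneg (by norm_num) (thetaErr_nonneg hX1)
            _ = 27 * (X ^ 3 / (1 + Real.log X) ^ 3) / r := by unfold thetaErr; ring
            _ = _ := by rw [hXx]
        · have h9 : m ^ 2 * t / r ≤ x / r ^ 2 := by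
            rw [div_le_div_iff₀ hr0 (by positivity)]
            nlinarith
          have h10 : Real.log X ≤ Real.log r := Real.log_le_log hX0 h
          calc thetaErr r * (m ^ 2 * t / r) ≤ r / (1 + Real.log X) ^ 3 * (x / r ^ 2) := by
                unfold thetaErr
                gcongr
            _ = x / (1 + Real.log X) ^ 3 / r := by field_simp
            _ ≤ _ := by
                gcongr
                have : 0 ≤ x / (1 + Real.log X) ^ 3 := by positivity
                linarith
      refine h8.trans ?_
      gcongr ?_ / _
      rw [← mul_div_assoc, ← mul_div_assoc, div_le_div_iff₀ (by positivity) (by positivity)]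
      nlinarith
    calc 4 * (C * thetaErr r) * (m * f (m * t / r))
        ≤ 4 * (C * thetaErr r) * (K * (m ^ 2 * t / r)) := by
          have := thetaErr_nonneg hr1
          gcongr
      _ = 4 * C * K * (thetaErr r * (m ^ 2 * t / r)) := by ring
      _ ≤ 4 * C * K * (729 * (x / (1 + Real.log x) ^ 3) / r) := by gcongr
      _ = _ := by ring
  rw [← Finset.sum_sub_distrib]
  refine (Finset.abs_sum_le_sum_abs _ _).trans ?_
  calc _ ≤ ∑ r ∈ Finset.Ioc 0 ⌊x⌋₊, 4 * C * K * 729 * (x / (1 + Real.log x) ^ 3) *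
          (logPrime r / r) := by
        refine Finset.sum_le_sum fun r hr => ?_
        rw [← mul_sub, abs_mul, abs_of_nonneg (logPrime_nonneg r)]
        calc _ ≤ logPrime r * (4 * C * K * 729 * (x / (1 + Real.log x) ^ 3) / r) :=
              mul_le_mul_of_nonneg_left (key r hr) (logPrime_nonneg r)
          _ = _ := by ring
    _ ≤ 4 * C * K * 729 * (x / (1 + Real.log x) ^ 3) * (8 * (1 + Real.log x)) := by
        rw [← Finset.mul_sum]
        gcongr
        exact sum_logPrime_div_le' hx
    _ = _ := by field_simp

lemma one_add_log_le_two_mul_sqrt {x : ℝ} (hx : 1 ≤ x) : 1 + Real.log x ≤ 2 * √x := by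
  have hs : 1 ≤ √x := Real.one_le_sqrt.2 hx
  have h1 := Real.log_le_sub_one_of_pos (by linarith : 0 < √x)
  rw [Real.log_sqrt (by linarith)] at h1
  linarith

lemma filter_cube_le_min {x t b z : ℝ} (hx : 1 ≤ x) (ht : t ∈ Ioc (0 : ℝ) 1)
    (hb : b ∈ Ioc (0 : ℝ) 1) (hz : 0 < z) (hzx : z ^ 3 = x / (b ^ 2 * t)) :
    (Finset.Ioc 0 ⌊x⌋₊).filter (fun r : ℕ => (r : ℝ) * b ≤ min (r : ℝ) (√(x / (r * t)))) =
      Finset.Ioc 0 ⌊min x z⌋₊ := by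
  have hx0 : 0 < x := by linarith
  have ht0 := ht.1
  have hb0 := hb.1
  ext r
  simp only [Finset.mem_filter, Finset.mem_Ioc]
  rw [Nat.le_floor_iff hx0.le, Nat.le_floor_iff (by positivity), le_min_iff, le_min_iff, and_assoc]
  refine and_congr_right fun hr => and_congr_right fun hrx => ?_
  have hr0 : (0 : ℝ) < r := by exact_mod_cast hr
  rw [Real.le_sqrt' (by positivity), le_div_iff₀ (by positivity),
    ← pow_le_pow_iff_left₀ hr0.le hz.le (by norm_num : 3 ≠ 0), hzx, le_div_iff₀ (by positivity)]
  constructor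
  · rintro ⟨-, h⟩; linarith
  · intro h; exact ⟨by nlinarith [hb.2], by linarith⟩

lemma abs_sum_filter_cube_sub_le :
    ∃ D, 0 ≤ D ∧ ∀ x : ℝ, 1 ≤ x → ∀ t ∈ Ioc (0 : ℝ) 1, ∀ b ∈ Ioc (0 : ℝ) 1,
      |(∑ r ∈ Finset.Ioc 0 ⌊x⌋₊,
        if (r : ℝ) * b ≤ min (r : ℝ) (√(x / (r * t))) then r ^ 2 * logPrime r else 0) -
        x / (3 * (b ^ 2 * t))| ≤ D * (x / (1 + Real.log x) ^ 3) / (b ^ 2 * t) +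
          ((if b < 1 / √x then x / (b ^ 2 * t) else 0) +
            if t < 1 / √x then x / (b ^ 2 * t) else 0) := by
  obtain ⟨D, hD, h⟩ := abs_sum_mul_logPrime_sub_le 2
  refine ⟨27 * D, by positivity, fun x hx t ht b hb => ?_⟩
  have hx0 : 0 < x := by linarith
  have hl := Real.log_nonneg hx
  have ht0 := ht.1
  have hb0 := hb.1
  obtain ⟨X, hX0, hXx⟩ := exists_cube_root hx0
  have hX1 := one_le_of_cube hX0 hXx hx
  have hlx : Real.log x = 3 * Real.log X := by rw [← hXx, Real.log_pow]; norm_num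
  have hu0 : 0 < b ^ 2 * t := by positivity
  have hu1 : b ^ 2 * t ≤ 1 := mul_le_one₀ (pow_le_one₀ hb0.le hb.2) ht0.le ht.2
  obtain ⟨z, hz0, hzx⟩ := exists_cube_root (x := x / (b ^ 2 * t)) (by positivity)
  rw [← Finset.sum_filter, filter_cube_le_min hx ht hb hz0 hzx]
  have hxu : x ≤ x / (b ^ 2 * t) := by rw [le_div_iff₀ hu0]; nlinarith
  set y := min x z with hy
  have hXy : X ≤ y := by
    refine le_min ?_ ?_
    · rw [← hXx]; exact le_self_pow₀ hX1 (by norm_num)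
    · rw [← pow_le_pow_iff_left₀ hX0.le hz0.le (by norm_num : 3 ≠ 0), hzx, hXx]
      exact hxu
  have hy0 : 0 < y := hX0.trans_le hXy
  have hy3 : y ^ 3 ≤ x / (b ^ 2 * t) := by
    calc y ^ 3 ≤ z ^ 3 := by gcongr; exact min_le_right _ _
      _ = _ := hzx
  have h1 := h y (hX1.trans hXy)
  norm_num at h1
  have hly : Real.log X ≤ Real.log y := Real.log_le_log hX0 hXy
  have h2 : y ^ 3 / (1 + Real.log y) ^ 3 ≤ 27 * (x / (1 + Real.log x) ^ 3) / (b ^ 2 * t) := by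
    calc y ^ 3 / (1 + Real.log y) ^ 3 ≤ (x / (b ^ 2 * t)) / ((1 + Real.log x) / 3) ^ 3 := by
          gcongr
          linarith
      _ = _ := by field_simp; norm_num
  have h3 : |y ^ 3 / 3 - x / (3 * (b ^ 2 * t))| ≤
      ((if b < 1 / √x then x / (b ^ 2 * t) else 0) +
            if t < 1 / √x then x / (b ^ 2 * t) else 0) := by
    have e : x / (3 * (b ^ 2 * t)) = x / (b ^ 2 * t) / 3 := by field_simp
    have hq : 0 < x / (b ^ 2 * t) := by positivity
    by_cases hlt : b < 1 / √x ∨ t < 1 / √x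
    · have h4 : x / (b ^ 2 * t) ≤ ((if b < 1 / √x then x / (b ^ 2 * t) else 0) +
            if t < 1 / √x then x / (b ^ 2 * t) else 0) := by
        rcases hlt with h | h <;> rw [if_pos h] <;> split_ifs <;> linarith
      refine le_trans ?_ h4
      rw [e, abs_le]
      have : 0 < y ^ 3 := by positivity
      constructor <;> linarith
    · push Not at hlt
      have hs1 : 1 ≤ √x := Real.one_le_sqrt.2 hx
      have hs2 : √x ^ 2 = x := Real.sq_sqrt hx0.le
      have hle : z ≤ x := by
        rw [← pow_le_pow_iff_left₀ hz0.le hx0.le (by norm_num : 3 ≠ 0), hzx,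
          div_le_iff₀ hu0]
        have h5 : (1 / √x) ^ 2 * (1 / √x) ≤ b ^ 2 * t := by
          gcongr
          · exact hlt.1
          · exact hlt.2
        calc x = √x ^ 2 * 1 := by rw [hs2, mul_one]
          _ ≤ √x ^ 2 * √x := by gcongr
          _ = (√x ^ 2) ^ 3 * ((1 / √x) ^ 2 * (1 / √x)) := by field_simp
          _ = x ^ 3 * ((1 / √x) ^ 2 * (1 / √x)) := by rw [hs2]
          _ ≤ _ := by gcongr
      rw [hy, min_eq_right hle, hzx, e, sub_self, abs_zero]
      split_ifs <;> positivity
  calc _ ≤ |∑ r ∈ Finset.Ioc 0 ⌊y⌋₊, r ^ 2 * logPrime r - y ^ 3 / 3| +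
        |y ^ 3 / 3 - x / (3 * (b ^ 2 * t))| := abs_sub_le _ _ _
    _ ≤ _ := by
        gcongr
        refine h1.trans ((mul_le_mul_of_nonneg_left h2 hD).trans (le_of_eq ?_))
        ring

lemma tripleSum_step_three {f : ℝ → ℝ} {K : ℝ} (hc : Continuous f)
    (h0 : ∀ t, 0 ≤ f t) (hK : ∀ t, 0 ≤ t → f t ≤ K * t) :
    ∃ D, 0 ≤ D ∧ ∀ x : ℝ, 1 ≤ x → ∀ t ∈ Ioc (0 : ℝ) 1,
      |(∑ r ∈ Finset.Ioc 0 ⌊x⌋₊, logPrime r * (r ^ 2 * ∫ b in (0 : ℝ)..1,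
        if (r : ℝ) * b ≤ min (r : ℝ) (√(x / (r * t))) then b * f (b * t) else 0)) -
       (∫ b in (0 : ℝ)..1, f (b * t) / (b * t)) * (x / 3)| ≤
      D * (x / (1 + Real.log x)) + if t < 1 / √x then K * x else 0 := by
  obtain ⟨D₂, hD₂, h₂⟩ := abs_sum_filter_cube_sub_le
  have hK0 : 0 ≤ K := by have := hK 1 zero_le_one; have := h0 1; linarith
  refine ⟨K * D₂ + 2 * K, by positivity, fun x hx t ht => ?_⟩
  have hx0 : 0 < x := by linarith
  have hl := Real.log_nonneg hx
  have ht0 := ht.1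
  have hcont : Continuous fun b => b * f (b * t) := by fun_prop
  have hswap : (∑ r ∈ Finset.Ioc 0 ⌊x⌋₊, logPrime r * (r ^ 2 * ∫ b in (0 : ℝ)..1,
        if (r : ℝ) * b ≤ min (r : ℝ) (√(x / (r * t))) then b * f (b * t) else 0)) =
      ∫ b in (0 : ℝ)..1, b * f (b * t) * ∑ r ∈ Finset.Ioc 0 ⌊x⌋₊,
        if (r : ℝ) * b ≤ min (r : ℝ) (√(x / (r * t))) then r ^ 2 * logPrime r else 0 := by
    simp only [Finset.mul_sum]
    rw [intervalIntegral.integral_finsetSum]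
    · refine Finset.sum_congr rfl fun r _ => ?_
      rw [← mul_assoc, ← intervalIntegral.integral_const_mul]
      congr 1; ext b
      split_ifs <;> ring
    · intro r _
      refine ((intervalIntegrable_ite hcont r (min r (√(x / (r * t))))).const_mul
        (r ^ 2 * logPrime r)).congr ?_
      intro b _
      dsimp only
      split_ifs <;> ring
  have hint1 : IntervalIntegrable (fun b => b * f (b * t) * ∑ r ∈ Finset.Ioc 0 ⌊x⌋₊,
        if (r : ℝ) * b ≤ min (r : ℝ) (√(x / (r * t))) then r ^ 2 * logPrime r else 0)
        volume 0 1 := by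
    simp only [Finset.mul_sum]
    refine intervalIntegrable_sum fun r _ => ?_
    refine ((intervalIntegrable_ite hcont r (min r (√(x / (r * t))))).const_mul
        (r ^ 2 * logPrime r)).congr ?_
    intro b _
    dsimp only
    split_ifs <;> ring
  have hint2 : IntervalIntegrable (fun b => f (b * t) / (b * t) * (x / 3)) volume 0 1 := by
    refine IntervalIntegrable.mul_const ?_ _
    have := intervalIntegrable_div_id (f := fun b => f (b * t) / t) (K := K) (by fun_prop)
      (fun b => div_nonneg (h0 _) ht0.le) (fun b hb => by
        rw [div_le_iff₀ ht0, mul_assoc]; exact hK _ (by positivity))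
    refine this.congr ?_
    intro b _
    dsimp only
    rw [div_div, mul_comm t]
  obtain ⟨hint3, hI3⟩ := integral_ite_lt_le (c := K * x) (δ := 1 / √x) (by positivity)
    (by positivity)
  set c₀ := K * (D₂ * (x / (1 + Real.log x) ^ 3)) + if t < 1 / √x then K * x else 0 with hc₀
  have hmain := abs_integral_sub_le hint1 hint2
    (d := fun b => c₀ + if b < 1 / √x then K * x else 0)
    ((by simp : IntervalIntegrable (fun _ : ℝ => c₀) volume 0 1).add hint3) (by
    intro b hb
    have hb0 := hb.1
    have h3 := h₂ x hx t ht b hb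
    have h4 : b * f (b * t) / (b ^ 2 * t) ≤ K := by
      rw [div_le_iff₀ (by positivity)]
      calc b * f (b * t) ≤ b * (K * (b * t)) := by gcongr; exact hK _ (by positivity)
        _ = _ := by ring
    have hbf : 0 ≤ b * f (b * t) := mul_nonneg hb0.le (h0 _)
    rw [show f (b * t) / (b * t) * (x / 3) = b * f (b * t) * (x / (3 * (b ^ 2 * t))) by
      field_simp, ← mul_sub, abs_mul, abs_of_nonneg hbf]
    calc _ ≤ b * f (b * t) * (D₂ * (x / (1 + Real.log x) ^ 3) / (b ^ 2 * t) +
          ((if b < 1 / √x then x / (b ^ 2 * t) else 0) +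
            if t < 1 / √x then x / (b ^ 2 * t) else 0)) := by gcongr
      _ = b * f (b * t) / (b ^ 2 * t) * (D₂ * (x / (1 + Real.log x) ^ 3) +
          ((if b < 1 / √x then x else 0) + if t < 1 / √x then x else 0)) := by
          split_ifs <;> field_simp <;> simp
      _ ≤ K * (D₂ * (x / (1 + Real.log x) ^ 3) +
          ((if b < 1 / √x then x else 0) + if t < 1 / √x then x else 0)) := by
          have : 0 ≤ if t < 1 / √x then x else 0 := by split_ifs <;> linarith
          have : 0 ≤ if b < 1 / √x then x else 0 := by split_ifs <;> linarith
          gcongr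
      _ = _ := by rw [hc₀]; split_ifs <;> ring)
  rw [intervalIntegral.integral_add (by simp) hint3, intervalIntegral.integral_mul_const,
    intervalIntegral.integral_const] at hmain
  rw [hswap]
  refine hmain.trans ?_
  have h7 : x / (1 + Real.log x) ^ 3 ≤ x / (1 + Real.log x) :=
    div_le_div_of_nonneg_left hx0.le (by positivity) (le_self_pow₀ (by linarith) (by norm_num))
  have h8 : K * x * (1 / √x) ≤ 2 * K * (x / (1 + Real.log x)) := by
    have hs := one_add_log_le_two_mul_sqrt hx
    have hs0 : 0 < √x := Real.sqrt_pos.2 hx0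
    rw [mul_one_div, ← mul_div_assoc, div_le_div_iff₀ hs0 (by positivity)]
    calc K * x * (1 + Real.log x) ≤ K * x * (2 * √x) := by gcongr
      _ = _ := by ring
  have h10 : K * (D₂ * (x / (1 + Real.log x) ^ 3)) ≤ K * (D₂ * (x / (1 + Real.log x))) := by
    gcongr
  simp only [sub_zero, one_smul]
  rw [hc₀]
  linarith

/-- The inner integral of the third coefficient. -/
lemma integral_div_eq {f : ℝ → ℝ} {s : ℝ} (hs : 0 < s) :
    ∫ b in (0 : ℝ)..1, f (b * s) / (b * s) = ∫ t in (0 : ℝ)..s, f t / (s * t) := by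
  have := intervalIntegral.integral_comp_mul_right (a := 0) (b := 1) (fun t => f t / (s * t)) hs.ne'
  rw [zero_mul, one_mul, smul_eq_mul, eq_inv_mul_iff_mul_eq₀ hs.ne',
    ← intervalIntegral.integral_const_mul] at this
  rw [← this]
  congr 1; ext b
  rw [← mul_div_assoc, mul_div_mul_left _ _ hs.ne']

lemma intervalIntegrable_inner {f : ℝ → ℝ} {K : ℝ} (hc : Continuous f) (h0 : ∀ t, 0 ≤ f t)
    (hK : ∀ t, 0 ≤ t → f t ≤ K * t) :
    IntervalIntegrable (fun s => ∫ t in (0 : ℝ)..s, f t / (s * t)) volume 0 1 := by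
  have hd := intervalIntegrable_div_id hc h0 hK
  have hK0 : 0 ≤ K := by have := hK 1 zero_le_one; have := h0 1; linarith
  have hF : ContinuousOn (fun s => ∫ t in (0 : ℝ)..s, f t / t) (uIcc 0 1) := by
    refine intervalIntegral.continuousOn_primitive_interval ?_
    rw [uIcc_of_le zero_le_one, integrableOn_Icc_iff_integrableOn_Ioc,
      ← uIoc_of_le (zero_le_one' ℝ), ← intervalIntegrable_iff]
    exact hd
  have heq : ∀ s, ∫ t in (0 : ℝ)..s, f t / (s * t) = (∫ t in (0 : ℝ)..s, f t / t) / s := by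
    intro s
    rw [div_eq_inv_mul, ← intervalIntegral.integral_const_mul]
    congr 1; ext t
    rw [div_mul_eq_div_div, div_right_comm, div_eq_inv_mul]
  simp only [heq]
  rw [intervalIntegrable_iff, uIoc_of_le zero_le_one]
  refine IntegrableOn.of_bound (by simp) ?_ K ?_
  · refine ContinuousOn.aestronglyMeasurable ?_ measurableSet_Ioc
    rw [uIcc_of_le zero_le_one] at hF
    exact (hF.mono Ioc_subset_Icc_self).div continuousOn_id fun s hs => hs.1.ne'
  · filter_upwards [ae_restrict_mem measurableSet_Ioc] with s hs
    have h1 : ‖∫ t in (0 : ℝ)..s, f t / t‖ ≤ K * |s - 0| := by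
      refine intervalIntegral.norm_integral_le_of_norm_le_const fun t ht => ?_
      rw [uIoc_of_le hs.1.le] at ht
      rw [Real.norm_of_nonneg (div_nonneg (h0 t) ht.1.le), div_le_iff₀ ht.1]
      exact hK t ht.1.le
    rw [norm_div, Real.norm_of_nonneg hs.1.le, div_le_iff₀ hs.1]
    rwa [sub_zero, abs_of_pos hs.1] at h1

theorem exists_tripleSum_sub_le {f : ℝ → ℝ} {K : ℝ} (hm : Monotone f) (hc : Continuous f)
    (h0 : ∀ t, 0 ≤ f t) (hK : ∀ t, 0 ≤ t → f t ≤ K * t) :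
    ∃ D, 0 ≤ D ∧ ∀ x : ℝ, 1 ≤ x →
      |tripleSum f x - (∫ s in (0 : ℝ)..1, ∫ t in (0 : ℝ)..s, f t / (s * t)) / 3 * x| ≤
        D * (x / (1 + Real.log x)) := by
  obtain ⟨D₁, hD₁, h₁⟩ := tripleSum_step_one hm h0 hK
  obtain ⟨D₂, hD₂, h₂⟩ := tripleSum_step_two hm h0 hK
  obtain ⟨D₃, hD₃, h₃⟩ := tripleSum_step_three hc h0 hK
  have hK0 : 0 ≤ K := by have := hK 1 zero_le_one; have := h0 1; linarith
  refine ⟨D₁ + D₂ + D₃ + 2 * K, by positivity, fun x hx => ?_⟩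
  have hx0 : 0 < x := by linarith
  have hl := Real.log_nonneg hx
  have hterm : ∀ r ∈ Finset.Ioc 0 ⌊x⌋₊, ∀ q ∈ Finset.Ioc 0 r, IntervalIntegrable (fun t : ℝ =>
      logPrime r * (logPrime q *
      (q * if (q : ℝ) * t ≤ min (q : ℝ) (x / (q * r)) then f (q * t / r) else 0))) volume 0 1 := by
    intro r _ q _
    exact (((intervalIntegrable_ite (by fun_prop : Continuous fun t : ℝ => f (q * t / r))
      q (min q (x / (q * r)))).const_mul _).const_mul _).const_mul _
  have hswap : ∑ r ∈ Finset.Ioc 0 ⌊x⌋₊, logPrime r * ∑ q ∈ Finset.Ioc 0 r, logPrime q *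
        (q * ∫ t in (0 : ℝ)..1,
          if (q : ℝ) * t ≤ min (q : ℝ) (x / (q * r)) then f (q * t / r) else 0) =
      ∫ t in (0 : ℝ)..1, ∑ r ∈ Finset.Ioc 0 ⌊x⌋₊, logPrime r * ∑ q ∈ Finset.Ioc 0 r, logPrime q *
        (q * if (q : ℝ) * t ≤ min (q : ℝ) (x / (q * r)) then f (q * t / r) else 0) := by
    simp only [Finset.mul_sum]
    rw [intervalIntegral.integral_finsetSum fun r hr => intervalIntegrable_sum (hterm r hr)]
    refine Finset.sum_congr rfl fun r hr => ?_
    rw [intervalIntegral.integral_finsetSum (hterm r hr)]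
    refine Finset.sum_congr rfl fun q _ => ?_
    simp only [intervalIntegral.integral_const_mul]
  have hint1 : IntervalIntegrable (fun t : ℝ => ∑ r ∈ Finset.Ioc 0 ⌊x⌋₊, logPrime r *
      ∑ q ∈ Finset.Ioc 0 r, logPrime q *
        (q * if (q : ℝ) * t ≤ min (q : ℝ) (x / (q * r)) then f (q * t / r) else 0))
        volume 0 1 := by
    simp only [Finset.mul_sum]
    exact intervalIntegrable_sum fun r hr => intervalIntegrable_sum (hterm r hr)
  have hint2 := (intervalIntegrable_inner hc h0 hK).mul_const (x / 3)
  obtain ⟨hint3, hI3⟩ := integral_ite_lt_le (c := K * x) (δ := 1 / √x) (by positivity)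
    (by positivity)
  set c₀ := (D₂ + D₃) * (x / (1 + Real.log x)) with hc₀
  have h7 : x / (1 + Real.log x) ^ 2 ≤ x / (1 + Real.log x) :=
    div_le_div_of_nonneg_left hx0.le (by positivity) (le_self_pow₀ (by linarith) (by norm_num))
  have hmain := abs_integral_sub_le hint1 hint2
    (d := fun t => c₀ + if t < 1 / √x then K * x else 0)
    ((by simp : IntervalIntegrable (fun _ : ℝ => c₀) volume 0 1).add hint3) (by
    intro t ht
    refine (abs_sub_le _ _ _).trans ((add_le_add (h₂ x hx t ht)
      (d := D₃ * (x / (1 + Real.log x)) + if t < 1 / √x then K * x else 0) ?_).trans ?_)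
    · rw [← integral_div_eq ht.1]
      exact h₃ x hx t ht
    · have := mul_le_mul_of_nonneg_left h7 hD₂
      rw [hc₀]
      linarith)
  rw [intervalIntegral.integral_add (by simp) hint3, intervalIntegral.integral_mul_const,
    intervalIntegral.integral_const] at hmain
  simp only [sub_zero, one_smul] at hmain
  have h5 := h₁ x hx
  rw [hswap] at h5
  have h8 : K * x * (1 / √x) ≤ 2 * K * (x / (1 + Real.log x)) := by
    have hs := one_add_log_le_two_mul_sqrt hx
    have hs0 : 0 < √x := Real.sqrt_pos.2 hx0
    rw [mul_one_div, ← mul_div_assoc, div_le_div_iff₀ hs0 (by positivity)]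
    calc K * x * (1 + Real.log x) ≤ K * x * (2 * √x) := by gcongr
      _ = _ := by ring
  rw [div_mul_eq_mul_div, mul_div_assoc]
  refine (abs_sub_le _ _ _).trans ((add_le_add h5 hmain).trans ?_)
  rw [hc₀]
  linarith

/-- The logarithmic integral with a power of the logarithm. -/
noncomputable def logInt (k : ℕ) (x : ℝ) : ℝ := ∫ u in (2 : ℝ)..x, (Real.log u ^ k)⁻¹

lemma log_pow_four_le {x : ℝ} (hx : 1 ≤ x) : Real.log x ^ 4 ≤ 4096 * √x := by
  have hx0 : 0 ≤ x := by linarith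
  have h := Real.log_le_rpow_div hx0 (by norm_num : (0 : ℝ) < 1 / 8)
  calc Real.log x ^ 4 ≤ (x ^ (1 / 8 : ℝ) / (1 / 8)) ^ 4 :=
        pow_le_pow_left₀ (Real.log_nonneg hx) h 4
    _ = 4096 * (x ^ (1 / 8 : ℝ)) ^ 4 := by ring
    _ = 4096 * √x := by
      rw [← Real.rpow_natCast, ← Real.rpow_mul hx0, Real.sqrt_eq_rpow]; norm_num

lemma sqrt_le_div_log_pow_four {x : ℝ} (hx : 1 < x) : √x ≤ 4096 * (x / Real.log x ^ 4) := by
  have hl := Real.log_pos hx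
  rw [← mul_div_assoc, le_div_iff₀ (by positivity)]
  calc √x * Real.log x ^ 4 ≤ √x * (4096 * √x) := by gcongr; exact log_pow_four_le hx.le
    _ = 4096 * (√x * √x) := by ring
    _ = _ := by rw [Real.mul_self_sqrt (by linarith)]

lemma continuousOn_inv_log_pow (k : ℕ) {a b : ℝ} (ha : 2 ≤ a) :
    ContinuousOn (fun u => (Real.log u ^ k)⁻¹) (Icc a b) := by
  refine ContinuousOn.inv₀ (ContinuousOn.pow (Real.continuousOn_log.mono ?_) _) ?_
  · intro u hu
    simp only [mem_compl_iff, mem_singleton_iff]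
    linarith [hu.1]
  · intro u hu
    have := Real.log_pos (by linarith [hu.1] : (1 : ℝ) < u)
    positivity

lemma intervalIntegrable_inv_log_pow (k : ℕ) {a b : ℝ} (ha : 2 ≤ a) (hb : a ≤ b) :
    IntervalIntegrable (fun u => (Real.log u ^ k)⁻¹) volume a b := by
  apply ContinuousOn.intervalIntegrable
  rw [uIcc_of_le hb]
  exact continuousOn_inv_log_pow k ha

lemma logInt_nonneg (k : ℕ) {x : ℝ} (hx : 2 ≤ x) : 0 ≤ logInt k x := by
  refine intervalIntegral.integral_nonneg hx fun u hu => ?_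
  have := Real.log_nonneg (by linarith [hu.1] : (1 : ℝ) ≤ u)
  positivity

lemma logInt_eq (k : ℕ) {x : ℝ} (hx : 2 ≤ x) :
    logInt k x = x / Real.log x ^ k - 2 / Real.log 2 ^ k + k * logInt (k + 1) x := by
  have h := intervalIntegral.integral_eq_sub_of_hasDerivAt (a := 2) (b := x)
    (f := fun u => u / Real.log u ^ k)
    (f' := fun u => (Real.log u ^ k)⁻¹ - k * (Real.log u ^ (k + 1))⁻¹) (by
      intro u hu
      rw [uIcc_of_le hx] at hu
      have hu0 : u ≠ 0 := by linarith [hu.1]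
      have hl := Real.log_pos (by linarith [hu.1] : (1 : ℝ) < u)
      refine ((hasDerivAt_id' u).fun_div ((Real.hasDerivAt_log hu0).fun_pow k)
        (by positivity)).congr_deriv ?_
      rcases k with _ | k
      · simp
      · simp only [Nat.add_sub_cancel]
        field_simp
        ring)
    ((intervalIntegrable_inv_log_pow k le_rfl hx).sub
      ((intervalIntegrable_inv_log_pow (k + 1) le_rfl hx).const_mul _))
  rw [intervalIntegral.integral_sub (intervalIntegrable_inv_log_pow k le_rfl hx)
    ((intervalIntegrable_inv_log_pow (k + 1) le_rfl hx).const_mul _),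
    intervalIntegral.integral_const_mul] at h
  unfold logInt
  linarith

lemma exists_logInt_four_le : ∃ C, 0 ≤ C ∧ ∀ x : ℝ, 4 ≤ x →
    logInt 4 x ≤ C * (x / Real.log x ^ 4) := by
  have hl2 : 0 < Real.log 2 := Real.log_pos (by norm_num)
  refine ⟨4096 / Real.log 2 ^ 4 + 16, by positivity, fun x hx => ?_⟩
  have hx0 : 0 < x := by linarith
  have hl : 0 < Real.log x := Real.log_pos (by linarith)
  have hs : 2 ≤ √x := Real.le_sqrt_of_sq_le (by linarith)
  have hsx : √x ≤ x := Real.sqrt_le_self_iff.2 (Or.inr (by linarith))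
  unfold logInt
  rw [← intervalIntegral.integral_add_adjacent_intervals
    (intervalIntegrable_inv_log_pow 4 le_rfl hs) (intervalIntegrable_inv_log_pow 4 hs hsx)]
  have h1 : ∫ u in (2 : ℝ)..√x, (Real.log u ^ 4)⁻¹ ≤ (Real.log 2 ^ 4)⁻¹ * √x := by
    calc _ ≤ ∫ u in (2 : ℝ)..√x, (Real.log 2 ^ 4)⁻¹ := by
          refine intervalIntegral.integral_mono_on hs
            (intervalIntegrable_inv_log_pow 4 le_rfl hs) (by simp) fun u hu => ?_
          have := Real.log_le_log (by norm_num) hu.1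
          gcongr
      _ = (√x - 2) * (Real.log 2 ^ 4)⁻¹ := by simp
      _ ≤ _ := by
          have : 0 < (Real.log 2 ^ 4)⁻¹ := by positivity
          nlinarith
  have h2 : ∫ u in √x..x, (Real.log u ^ 4)⁻¹ ≤ 16 * (x / Real.log x ^ 4) := by
    calc _ ≤ ∫ u in √x..x, ((Real.log x / 2) ^ 4)⁻¹ := by
          refine intervalIntegral.integral_mono_on hsx
            (intervalIntegrable_inv_log_pow 4 hs hsx) (by simp) fun u hu => ?_
          have := Real.log_le_log (by linarith) hu.1
          rw [Real.log_sqrt hx0.le] at this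
          gcongr
      _ = (x - √x) * ((Real.log x / 2) ^ 4)⁻¹ := by simp
      _ ≤ x * ((Real.log x / 2) ^ 4)⁻¹ := by gcongr; linarith
      _ = _ := by field_simp; norm_num
  have h3 := sqrt_le_div_log_pow_four (x := x) (by linarith)
  have h4 : (Real.log 2 ^ 4)⁻¹ * √x ≤ (Real.log 2 ^ 4)⁻¹ * (4096 * (x / Real.log x ^ 4)) := by
    gcongr
  calc _ ≤ (Real.log 2 ^ 4)⁻¹ * (4096 * (x / Real.log x ^ 4)) + 16 * (x / Real.log x ^ 4) := by
        linarith
    _ = _ := by ring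

lemma hasDerivAt_inv_log_pow (k : ℕ) {u : ℝ} (hu : 1 < u) :
    HasDerivAt (fun u => (Real.log u ^ k)⁻¹) (-(k * (u⁻¹ * (Real.log u ^ (k + 1))⁻¹))) u := by
  have hu0 : u ≠ 0 := by linarith
  have hl := Real.log_pos hu
  refine (((Real.hasDerivAt_log hu0).fun_pow k).fun_inv (by positivity)).congr_deriv ?_
  rcases k with _ | k
  · simp
  · simp only [Nat.add_sub_cancel]
    field_simp
    ring

lemma sum_Ioc_eq_sum_Icc {c : ℕ → ℝ} (hc0 : c 0 = 0) (N : ℕ) :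
    ∑ n ∈ Finset.Icc 0 N, c n = ∑ n ∈ Finset.Ioc 0 N, c n := by
  rw [← Finset.add_sum_Ioc_eq_sum_Icc (Nat.zero_le N), hc0, zero_add]

lemma sum_inv_log_pow_mul_eq (k : ℕ) {c : ℕ → ℝ} (hc0 : c 0 = 0) (hc1 : c 1 = 0) {x : ℝ}
    (hx : 2 ≤ x) :
    ∑ n ∈ Finset.Ioc 0 ⌊x⌋₊, (Real.log n ^ k)⁻¹ * c n =
      (Real.log x ^ k)⁻¹ * ∑ n ∈ Finset.Ioc 0 ⌊x⌋₊, c n +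
        ∫ t in (2 : ℝ)..x, k * (t⁻¹ * (Real.log t ^ (k + 1))⁻¹) *
          ∑ n ∈ Finset.Ioc 0 ⌊t⌋₊, c n ∧
    IntervalIntegrable (fun t : ℝ => k * (t⁻¹ * (Real.log t ^ (k + 1))⁻¹) *
          ∑ n ∈ Finset.Ioc 0 ⌊t⌋₊, c n) volume 2 x := by
  have hd : ∀ t ∈ Icc 2 x, HasDerivAt (fun u => (Real.log u ^ k)⁻¹)
      (-(k * (t⁻¹ * (Real.log t ^ (k + 1))⁻¹))) t :=
    fun t ht => hasDerivAt_inv_log_pow k (by linarith [ht.1])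
  have hcont : ContinuousOn (fun t : ℝ => (k * (t⁻¹ * (Real.log t ^ (k + 1))⁻¹) : ℝ))
      (Icc 2 x) := by
    refine continuousOn_const.mul (ContinuousOn.mul (continuousOn_id.inv₀ ?_)
      (continuousOn_inv_log_pow (k + 1) le_rfl))
    intro t ht
    simp only [id]
    linarith [ht.1]
  have hint : IntegrableOn (deriv fun u => (Real.log u ^ k)⁻¹) (Icc 2 x) :=
    (hcont.neg.congr fun t ht => (hd t ht).deriv).integrableOn_Icc
  have h := sum_mul_eq_sub_sub_integral_mul c (f := fun u => (Real.log u ^ k)⁻¹)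
    (by norm_num : (0 : ℝ) ≤ 2) hx (fun t ht => (hd t ht).differentiableAt) hint
  have hf2 : ⌊(2 : ℝ)⌋₊ = 2 := by norm_num
  have h2 : 2 ≤ ⌊x⌋₊ := Nat.le_floor (by exact_mod_cast hx)
  constructor
  · have h3 : ∑ n ∈ Finset.Ioc 0 ⌊x⌋₊, (Real.log n ^ k)⁻¹ * c n = (Real.log 2 ^ k)⁻¹ * c 2 +
        ∑ n ∈ Finset.Ioc 2 ⌊x⌋₊, (Real.log n ^ k)⁻¹ * c n := by
      rw [← Finset.sum_Ioc_consecutive _ (Nat.zero_le 2) h2]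
      congr 1
      rw [show Finset.Ioc 0 2 = {1, 2} by decide]
      simp [hc1]
    rw [hf2, sum_Ioc_eq_sum_Icc hc0, sum_Ioc_eq_sum_Icc hc0,
      show Finset.Ioc 0 2 = {1, 2} by decide] at h
    simp only [Finset.sum_pair (by norm_num : (1 : ℕ) ≠ 2), hc1, zero_add] at h
    rw [h3, h, intervalIntegral.integral_of_le hx]
    have h4 : ∫ t in Ioc 2 x, deriv (fun u => (Real.log u ^ k)⁻¹) t *
        ∑ k ∈ Finset.Icc 0 ⌊t⌋₊, c k = - ∫ t in Ioc 2 x, k * (t⁻¹ * (Real.log t ^ (k + 1))⁻¹) *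
          ∑ n ∈ Finset.Ioc 0 ⌊t⌋₊, c n := by
      rw [← integral_neg]
      refine setIntegral_congr_fun measurableSet_Ioc fun t ht => ?_
      rw [(hd t (Ioc_subset_Icc_self ht)).deriv, sum_Ioc_eq_sum_Icc hc0]
      ring
    rw [h4]
    ring
  · rw [intervalIntegrable_iff, uIoc_of_le hx, ← integrableOn_Icc_iff_integrableOn_Ioc]
    have := integrableOn_mul_sum_Icc c (m := 0) (by norm_num : (0 : ℝ) ≤ 2)
      (hcont.integrableOn_Icc (μ := volume))
    simpa only [sum_Ioc_eq_sum_Icc hc0] using this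

/-- Partial summation against a power of the logarithm. -/
lemma exists_abs_sum_div_log_pow_sub_le {k j : ℕ} (hkj : k + j = 4) {c : ℕ → ℝ} (hc0 : c 0 = 0)
    (hc1 : c 1 = 0) {A D : ℝ} (hD : 0 ≤ D) (h : ∀ u : ℝ, 1 ≤ u →
      |∑ n ∈ Finset.Ioc 0 ⌊u⌋₊, c n - A * u| ≤ D * (u / (1 + Real.log u) ^ j)) :
    ∃ D', 0 ≤ D' ∧ ∀ x : ℝ, 4 ≤ x →
      |∑ n ∈ Finset.Ioc 0 ⌊x⌋₊, (Real.log n ^ k)⁻¹ * c n -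
        A * (x / Real.log x ^ k + k * logInt (k + 1) x)| ≤ D' * (x / Real.log x ^ 4) := by
  obtain ⟨C, hC, hI⟩ := exists_logInt_four_le
  have hl2 : 0 < Real.log 2 := Real.log_pos (by norm_num)
  refine ⟨D + k * D / Real.log 2 * C, by positivity, fun x hx => ?_⟩
  have hx2 : 2 ≤ x := by linarith
  have hl : 0 < Real.log x := Real.log_pos (by linarith)
  have hE : ∀ u : ℝ, 2 ≤ u →
      |∑ n ∈ Finset.Ioc 0 ⌊u⌋₊, c n - A * u| ≤ D * (u / Real.log u ^ j) := by
    intro u hu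
    refine (h u (by linarith)).trans ?_
    have hlu : 0 < Real.log u := Real.log_pos (by linarith)
    have : 0 ≤ u := by linarith
    gcongr
    linarith
  obtain ⟨h1, h2⟩ := sum_inv_log_pow_mul_eq k hc0 hc1 hx2
  have h3 : A * (x / Real.log x ^ k + k * logInt (k + 1) x) = (Real.log x ^ k)⁻¹ * (A * x) +
      ∫ t in (2 : ℝ)..x, k * A * (Real.log t ^ (k + 1))⁻¹ := by
    rw [intervalIntegral.integral_const_mul]
    unfold logInt
    ring
  have h4 : |(∫ t in (2 : ℝ)..x, k * (t⁻¹ * (Real.log t ^ (k + 1))⁻¹) *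
          ∑ n ∈ Finset.Ioc 0 ⌊t⌋₊, c n) -
      ∫ t in (2 : ℝ)..x, k * A * (Real.log t ^ (k + 1))⁻¹| ≤
      ∫ t in (2 : ℝ)..x, k * D / Real.log 2 * (Real.log t ^ 4)⁻¹ := by
    rw [← intervalIntegral.integral_sub h2
      ((intervalIntegrable_inv_log_pow (k + 1) le_rfl hx2).const_mul _)]
    refine intervalIntegral.norm_integral_le_of_norm_le (μ := volume)
      (f := fun t => k * (t⁻¹ * (Real.log t ^ (k + 1))⁻¹) *
        ∑ n ∈ Finset.Ioc 0 ⌊t⌋₊, c n - k * A * (Real.log t ^ (k + 1))⁻¹)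
      hx2 (ae_of_all _ fun t ht => ?_) ((intervalIntegrable_inv_log_pow 4 le_rfl hx2).const_mul _)
    have ht0 : 0 < t := by linarith [ht.1]
    have hlt : 0 < Real.log t := Real.log_pos (by linarith [ht.1])
    have hlt2 : Real.log 2 ≤ Real.log t := Real.log_le_log (by norm_num) ht.1.le
    rw [Real.norm_eq_abs, show k * (t⁻¹ * (Real.log t ^ (k + 1))⁻¹) *
      ∑ n ∈ Finset.Ioc 0 ⌊t⌋₊, c n - k * A * (Real.log t ^ (k + 1))⁻¹ =
      k * (t⁻¹ * (Real.log t ^ (k + 1))⁻¹) * (∑ n ∈ Finset.Ioc 0 ⌊t⌋₊, c n - A * t) by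
        field_simp, abs_mul, abs_of_nonneg (by positivity)]
    calc _ ≤ k * (t⁻¹ * (Real.log t ^ (k + 1))⁻¹) * (D * (t / Real.log t ^ j)) := by
          gcongr
          exact hE t ht.1.le
      _ = k * D / Real.log t * (Real.log t ^ 4)⁻¹ := by
          rw [← hkj]
          field_simp
          ring
      _ ≤ _ := by gcongr
  rw [intervalIntegral.integral_const_mul (k * D / Real.log 2)] at h4
  rw [h1, h3, add_sub_add_comm, ← mul_sub]
  refine (abs_add_le _ _).trans ?_
  have h5 : |(Real.log x ^ k)⁻¹ * (∑ n ∈ Finset.Ioc 0 ⌊x⌋₊, c n - A * x)| ≤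
      D * (x / Real.log x ^ 4) := by
    rw [abs_mul, abs_of_nonneg (by positivity)]
    calc _ ≤ (Real.log x ^ k)⁻¹ * (D * (x / Real.log x ^ j)) := by
          gcongr
          exact hE x hx2
      _ = _ := by rw [← hkj, pow_add]; field_simp
  have h6 : k * D / Real.log 2 * logInt 4 x ≤ k * D / Real.log 2 * (C * (x / Real.log x ^ 4)) := by
    gcongr
    exact hI x hx
  unfold logInt at h6
  linarith

lemma one_le_sqrt_div {x : ℝ} (hx : 4 ≤ x) : 1 ≤ 4096 * (x / Real.log x ^ 4) :=
  (Real.one_le_sqrt.2 (by linarith)).trans (sqrt_le_div_log_pow_four (by linarith))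

lemma exists_abs_logInt_three_sub_le : ∃ D, 0 ≤ D ∧ ∀ x : ℝ, 4 ≤ x →
    |logInt 3 x - x / Real.log x ^ 3| ≤ D * (x / Real.log x ^ 4) := by
  obtain ⟨C, hC, hI⟩ := exists_logInt_four_le
  have hl2 : 0 < Real.log 2 := Real.log_pos (by norm_num)
  refine ⟨2 / Real.log 2 ^ 3 * 4096 + 3 * C, by positivity, fun x hx => ?_⟩
  have h1 := logInt_eq 3 (by linarith : 2 ≤ x)
  have h2 := logInt_nonneg 4 (by linarith : 2 ≤ x)
  have h3 := hI x hx
  have h4 := mul_le_mul_of_nonneg_left (one_le_sqrt_div hx)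
    (by positivity : 0 ≤ 2 / Real.log 2 ^ 3)
  have h5 : 0 < 2 / Real.log 2 ^ 3 := by positivity
  norm_num at h1
  rw [abs_le]
  constructor <;> linarith

lemma exists_abs_logInt_two_sub_le : ∃ D, 0 ≤ D ∧ ∀ x : ℝ, 4 ≤ x →
    |logInt 2 x - (x / Real.log x ^ 2 + 2 * (x / Real.log x ^ 3))| ≤
      D * (x / Real.log x ^ 4) := by
  obtain ⟨C, hC, hI⟩ := exists_abs_logInt_three_sub_le
  have hl2 : 0 < Real.log 2 := Real.log_pos (by norm_num)
  refine ⟨2 / Real.log 2 ^ 2 * 4096 + 2 * C, by positivity, fun x hx => ?_⟩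
  have h1 := logInt_eq 2 (by linarith : 2 ≤ x)
  have h3 := abs_le.1 (hI x hx)
  have h4 := mul_le_mul_of_nonneg_left (one_le_sqrt_div hx)
    (by positivity : 0 ≤ 2 / Real.log 2 ^ 2)
  have h5 : 0 < 2 / Real.log 2 ^ 2 := by positivity
  norm_num at h1
  rw [abs_le]
  constructor <;> linarith

lemma div_log_pow_four_isLittleO :
    (fun x : ℝ => x / Real.log x ^ 4) =o[atTop] fun x : ℝ => x / Real.log x ^ 3 := by
  have h : (fun x : ℝ => x / Real.log x ^ 4) =
      fun x : ℝ => (Real.log x)⁻¹ * (x / Real.log x ^ 3) := by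
    ext x; rw [pow_succ _ 3, div_mul_eq_div_div, div_eq_inv_mul]
  rw [h]
  have h1 : (fun x : ℝ => (Real.log x)⁻¹) =o[atTop] fun _ : ℝ => (1 : ℝ) := by
    rw [Asymptotics.isLittleO_one_iff]
    exact Real.tendsto_log_atTop.inv_tendsto_atTop
  simpa using h1.mul_isBigO (Asymptotics.isBigO_refl (fun x : ℝ => x / Real.log x ^ 3) atTop)

lemma isLittleO_of_le {F : ℝ → ℝ} {D : ℝ} (h : ∀ x : ℝ, 4 ≤ x → |F x| ≤ D * (x / Real.log x ^ 4)) :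
    F =o[atTop] fun x : ℝ => x / Real.log x ^ 3 := by
  refine Asymptotics.IsBigO.trans_isLittleO (Asymptotics.IsBigO.of_bound D ?_)
    div_log_pow_four_isLittleO
  filter_upwards [eventually_ge_atTop 4] with x hx
  have : 0 ≤ x := by linarith
  rw [Real.norm_eq_abs, Real.norm_of_nonneg (by positivity)]
  exact h x hx

/-- The number of primes up to `x`. -/
noncomputable def primeSum (x : ℝ) : ℝ := ∑ n ∈ Finset.Ioc 0 ⌊x⌋₊, if n.Prime then (1 : ℝ) else 0

theorem primeSum_isLittleO :
    (fun x => primeSum x - (x / Real.log x + x / Real.log x ^ 2 + 2 * (x / Real.log x ^ 3)))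
      =o[atTop] fun x : ℝ => x / Real.log x ^ 3 := by
  obtain ⟨C, hC, hθ⟩ := exists_theta_sub_le
  obtain ⟨D₁, hD₁, h₁⟩ := exists_abs_sum_div_log_pow_sub_le (k := 1) (j := 3) (by norm_num)
    (c := logPrime) (by simp [logPrime]) (by simp [logPrime]) (A := 1) hC.le (fun u hu => by
      rw [← theta_eq_sum_logPrime, one_mul]; exact hθ u hu)
  obtain ⟨D₂, hD₂, h₂⟩ := exists_abs_logInt_two_sub_le
  refine isLittleO_of_le (D := D₁ + D₂) fun x hx => ?_
  have h3 : primeSum x = ∑ n ∈ Finset.Ioc 0 ⌊x⌋₊, (Real.log n ^ 1)⁻¹ * logPrime n := by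
    refine Finset.sum_congr rfl fun n _ => ?_
    unfold logPrime
    split_ifs with hp
    · have : Real.log n ≠ 0 := (Real.log_pos (by exact_mod_cast hp.one_lt)).ne'
      rw [pow_one, inv_mul_cancel₀ this]
    · simp
  have h4 := abs_le.1 (h₁ x hx)
  have h5 := abs_le.1 (h₂ x hx)
  norm_num at h4
  rw [h3, abs_le]
  simp only [pow_one]
  constructor <;> linarith

/-- The smallest prime factor divided by the largest one. -/
noncomputable def ratio (n : ℕ) : ℝ := (n.minFac : ℝ) / ((n.primeFactors.sup id : ℕ) : ℝ)

section Factorization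

variable {p q r n : ℕ}

lemma minFac_mul_of_le (hp : p.Prime) {m : ℕ} (hm : ∀ s, s.Prime → s ∣ m → p ≤ s) :
    (p * m).minFac = p := by
  refine le_antisymm (Nat.minFac_le_of_dvd hp.two_le (dvd_mul_right p m)) ?_
  have h1 : p * m ≠ 1 := fun h => hp.one_lt.ne' (Nat.eq_one_of_mul_eq_one_right h)
  have h2 := Nat.minFac_prime h1
  rcases (h2.dvd_mul).1 (Nat.minFac_dvd (p * m)) with h | h
  · exact ((Nat.prime_dvd_prime_iff_eq h2 hp).1 h).ge
  · exact hm _ h2 h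

lemma minFac_mul (hp : p.Prime) (hr : r.Prime) (hpr : p ≤ r) : (p * r).minFac = p :=
  minFac_mul_of_le hp fun s hs hsr => by rwa [(Nat.prime_dvd_prime_iff_eq hs hr).1 hsr]

lemma minFac_mul_mul (hp : p.Prime) (hq : q.Prime) (hr : r.Prime) (hpq : p ≤ q) (hqr : q ≤ r) :
    (p * (q * r)).minFac = p :=
  minFac_mul_of_le hp fun s hs hsr => by
    rcases (hs.dvd_mul).1 hsr with h | h
    · rwa [(Nat.prime_dvd_prime_iff_eq hs hq).1 h]
    · rw [(Nat.prime_dvd_prime_iff_eq hs hr).1 h]; exact hpq.trans hqr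

lemma sup_primeFactors_mul (hp : p.Prime) (hr : r.Prime) (hpr : p ≤ r) :
    (p * r).primeFactors.sup id = r := by
  rw [Nat.primeFactors_mul hp.ne_zero hr.ne_zero, hp.primeFactors, hr.primeFactors,
    Finset.sup_union]
  simpa using hpr

lemma sup_primeFactors_mul_mul (hp : p.Prime) (hq : q.Prime) (hr : r.Prime) (hpq : p ≤ q)
    (hqr : q ≤ r) : (p * (q * r)).primeFactors.sup id = r := by
  rw [Nat.primeFactors_mul hp.ne_zero (mul_ne_zero hq.ne_zero hr.ne_zero), Finset.sup_union,
    sup_primeFactors_mul hq hr hqr, hp.primeFactors]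
  simpa using hpq.trans hqr

open ArithmeticFunction in
lemma exists_of_cardFactors_eq_two (h : cardFactors n = 2) :
    ∃ p r : ℕ, p.Prime ∧ r.Prime ∧ p ≤ r ∧ n = p * r := by
  have hn : n ≠ 0 := by rintro rfl; simp at h
  rw [cardFactors_apply, List.length_eq_two] at h
  obtain ⟨p, r, h⟩ := h
  have hs := (Nat.primeFactorsList_sorted n).pairwise
  have hpr := Nat.prod_primeFactorsList hn
  have hpm : ∀ s ∈ n.primeFactorsList, s.Prime := fun s hs => Nat.prime_of_mem_primeFactorsList hs
  rw [h] at hs hpr hpm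
  simp at hs hpr hpm
  exact ⟨p, r, hpm.1, hpm.2, hs, hpr.symm⟩

open ArithmeticFunction in
lemma exists_of_cardFactors_eq_three (h : cardFactors n = 3) :
    ∃ p q r : ℕ, p.Prime ∧ q.Prime ∧ r.Prime ∧ p ≤ q ∧ q ≤ r ∧ n = p * (q * r) := by
  have hn : n ≠ 0 := by rintro rfl; simp at h
  rw [cardFactors_apply, List.length_eq_three] at h
  obtain ⟨p, q, r, h⟩ := h
  have hs := (Nat.primeFactorsList_sorted n).pairwise
  have hpr := Nat.prod_primeFactorsList hn
  have hpm : ∀ s ∈ n.primeFactorsList, s.Prime := fun s hs => Nat.prime_of_mem_primeFactorsList hs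
  rw [h] at hs hpr hpm
  simp at hs hpr hpm
  exact ⟨p, q, r, hpm.1, hpm.2.1, hpm.2.2, hs.1.1, hs.2, hpr.symm⟩

open ArithmeticFunction in
lemma cardFactors_mul_of_prime (hp : p.Prime) (hn : n ≠ 0) :
    cardFactors (p * n) = cardFactors n + 1 := by
  rw [cardFactors_mul hp.ne_zero hn, cardFactors_apply_prime hp, add_comm]

end Factorization

end

section

open MeasureTheory Filter Topology Set ArithmeticFunction

/-- The largest prime factor. -/
def maxFac (n : ℕ) : ℕ := n.primeFactors.sup id

/-- The weight of a product of two primes. -/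
noncomputable def pairTerm (f : ℝ → ℝ) (n : ℕ) : ℝ :=
  if cardFactors n = 2 then f (ratio n) * (Real.log n.minFac * Real.log (maxFac n)) else 0

/-- The weight of a product of three primes. -/
noncomputable def tripleTerm (f : ℝ → ℝ) (n : ℕ) : ℝ :=
  if cardFactors n = 3 then
    f (ratio n) * (Real.log n.minFac * (Real.log (n / n.minFac / maxFac n : ℕ) *
      Real.log (maxFac n))) else 0

lemma prime_of_logPrime_ne_zero {n : ℕ} (h : logPrime n ≠ 0) : n.Prime := by
  by_contra hn
  exact h (if_neg hn)

lemma logPrime_of_prime {n : ℕ} (h : n.Prime) : logPrime n = Real.log n := if_pos h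

lemma pairTerm_mul (f : ℝ → ℝ) {p r : ℕ} (hp : p.Prime) (hr : r.Prime) (hpr : p ≤ r) :
    pairTerm f (p * r) = f (p / r) * (Real.log p * Real.log r) := by
  have h : cardFactors (p * r) = 2 := by
    rw [cardFactors_mul_of_prime hp hr.ne_zero, cardFactors_apply_prime hr]
  rw [pairTerm, if_pos h, ratio, maxFac, minFac_mul hp hr hpr, sup_primeFactors_mul hp hr hpr]

lemma tripleTerm_mul (f : ℝ → ℝ) {p q r : ℕ} (hp : p.Prime) (hq : q.Prime) (hr : r.Prime)
    (hpq : p ≤ q) (hqr : q ≤ r) :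
    tripleTerm f (p * (q * r)) = f (p / r) * (Real.log p * (Real.log q * Real.log r)) := by
  have h : cardFactors (p * (q * r)) = 3 := by
    rw [cardFactors_mul_of_prime hp (mul_ne_zero hq.ne_zero hr.ne_zero),
      cardFactors_mul_of_prime hq hr.ne_zero, cardFactors_apply_prime hr]
  rw [tripleTerm, if_pos h, ratio, maxFac, minFac_mul_mul hp hq hr hpq hqr,
    sup_primeFactors_mul_mul hp hq hr hpq hqr, Nat.mul_div_cancel_left _ hp.pos,
    Nat.mul_div_cancel _ hr.pos]

lemma sum_pairTerm (f : ℝ → ℝ) {x : ℝ} (hx : 0 ≤ x) :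
    ∑ n ∈ Finset.Ioc 0 ⌊x⌋₊, pairTerm f n = pairSum f x := by
  unfold pairSum
  simp only [Finset.mul_sum]
  rw [Finset.sum_sigma']
  have hprime : ∀ a : (_ : ℕ) × ℕ, logPrime a.1 * (f (a.2 / a.1) * logPrime a.2) ≠ 0 →
      a.1.Prime ∧ a.2.Prime := fun a h => by
    have h1 := left_ne_zero_of_mul h
    have h2 := right_ne_zero_of_mul (right_ne_zero_of_mul h)
    exact ⟨prime_of_logPrime_ne_zero h1, prime_of_logPrime_ne_zero h2⟩
  have hmem : ∀ a ∈ (Finset.Ioc 0 ⌊x⌋₊).sigma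
      (fun r => Finset.Ioc 0 ⌊min (r : ℝ) (x / r)⌋₊), a.2 ≤ a.1 ∧ 0 < a.2 * a.1 ∧
        a.2 * a.1 ≤ ⌊x⌋₊ := by
    rintro ⟨r, p⟩ h
    simp only [Finset.mem_sigma, Finset.mem_Ioc] at h
    have hr0 : (0 : ℝ) < r := by exact_mod_cast h.1.1
    rw [Nat.le_floor_iff (le_min hr0.le (by positivity)), le_min_iff, le_div_iff₀ hr0] at h
    exact ⟨by exact_mod_cast h.2.2.1, Nat.mul_pos h.2.1 h.1.1,
      Nat.le_floor (by push_cast; exact h.2.2.2)⟩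
  symm
  refine Finset.sum_bij_ne_zero (fun a _ _ => a.2 * a.1) ?_ ?_ ?_ ?_
  · intro a ha _
    exact Finset.mem_Ioc.2 (hmem a ha).2
  · rintro ⟨r, p⟩ ha hne ⟨r', p'⟩ ha' hne' heq
    obtain ⟨h1, h2⟩ := hprime _ hne
    obtain ⟨h1', h2'⟩ := hprime _ hne'
    have e1 := minFac_mul h2 h1 (hmem _ ha).1
    have e2 := sup_primeFactors_mul h2 h1 (hmem _ ha).1
    dsimp only at heq e1 e2
    rw [heq] at e1 e2
    rw [minFac_mul h2' h1' (hmem _ ha').1] at e1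
    rw [sup_primeFactors_mul h2' h1' (hmem _ ha').1] at e2
    dsimp only at e1 e2
    rw [e1, e2]
  · intro n hn hne
    have hc : cardFactors n = 2 := by
      by_contra h
      exact hne (if_neg h)
    obtain ⟨p, r, hp, hr, hpr, rfl⟩ := exists_of_cardFactors_eq_two hc
    rw [pairTerm_mul f hp hr hpr] at hne
    rw [Finset.mem_Ioc, Nat.le_floor_iff hx] at hn
    push_cast at hn
    have hr0 : (0 : ℝ) < r := by exact_mod_cast hr.pos
    have hp1 : (1 : ℝ) ≤ p := by exact_mod_cast hp.one_le
    refine ⟨⟨r, p⟩, ?_, ?_, rfl⟩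
    · simp only [Finset.mem_sigma, Finset.mem_Ioc]
      rw [Nat.le_floor_iff (le_min hr0.le (by positivity)), le_min_iff, le_div_iff₀ hr0,
        Nat.le_floor_iff hx]
      exact ⟨⟨hr.pos, by nlinarith⟩, hp.pos, by exact_mod_cast hpr, hn.2⟩
    · dsimp only
      rw [logPrime_of_prime hp, logPrime_of_prime hr]
      convert hne using 1
      ring
  · rintro ⟨r, p⟩ ha hne
    obtain ⟨h1, h2⟩ := hprime _ hne
    dsimp only at h1 h2 ⊢
    rw [pairTerm_mul f h2 h1 (hmem _ ha).1, logPrime_of_prime h1, logPrime_of_prime h2]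
    ring

lemma sum_tripleTerm (f : ℝ → ℝ) {x : ℝ} (hx : 0 ≤ x) :
    ∑ n ∈ Finset.Ioc 0 ⌊x⌋₊, tripleTerm f n = tripleSum f x := by
  unfold tripleSum
  simp only [Finset.mul_sum]
  simp only [Finset.sum_sigma']
  have hprime : ∀ a : (_ : ℕ) × (_ : ℕ) × ℕ,
      logPrime a.1 * (logPrime a.2.1 * (f (a.2.2 / a.1) * logPrime a.2.2)) ≠ 0 →
      a.1.Prime ∧ a.2.1.Prime ∧ a.2.2.Prime := fun a h => by
    have h1 := left_ne_zero_of_mul h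
    have h2 := left_ne_zero_of_mul (right_ne_zero_of_mul h)
    have h3 := right_ne_zero_of_mul (right_ne_zero_of_mul (right_ne_zero_of_mul h))
    exact ⟨prime_of_logPrime_ne_zero h1, prime_of_logPrime_ne_zero h2,
      prime_of_logPrime_ne_zero h3⟩
  have hmem : ∀ a ∈ (Finset.Ioc 0 ⌊x⌋₊).sigma (fun r => (Finset.Ioc 0 r).sigma
      (fun q => Finset.Ioc 0 ⌊min (q : ℝ) (x / (q * r))⌋₊)), a.2.2 ≤ a.2.1 ∧ a.2.1 ≤ a.1 ∧
        0 < a.2.2 * (a.2.1 * a.1) ∧ a.2.2 * (a.2.1 * a.1) ≤ ⌊x⌋₊ := by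
    rintro ⟨r, q, p⟩ h
    simp only [Finset.mem_sigma, Finset.mem_Ioc] at h
    have hr0 : (0 : ℝ) < r := by exact_mod_cast h.1.1
    have hq0 : (0 : ℝ) < q := by exact_mod_cast h.2.1.1
    rw [Nat.le_floor_iff (le_min hq0.le (by positivity)), le_min_iff,
      le_div_iff₀ (by positivity)] at h
    exact ⟨by exact_mod_cast h.2.2.2.1, h.2.1.2, Nat.mul_pos h.2.2.1 (Nat.mul_pos h.2.1.1 h.1.1),
      Nat.le_floor (by push_cast; exact h.2.2.2.2)⟩
  symm
  refine Finset.sum_bij_ne_zero (fun a _ _ => a.2.2 * (a.2.1 * a.1)) ?_ ?_ ?_ ?_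
  · intro a ha _
    exact Finset.mem_Ioc.2 (hmem a ha).2.2
  · rintro ⟨r, q, p⟩ ha hne ⟨r', q', p'⟩ ha' hne' heq
    obtain ⟨h1, h2, h3⟩ := hprime _ hne
    obtain ⟨h1', h2', h3'⟩ := hprime _ hne'
    have e1 := minFac_mul_mul h3 h2 h1 (hmem _ ha).1 (hmem _ ha).2.1
    have e2 := sup_primeFactors_mul_mul h3 h2 h1 (hmem _ ha).1 (hmem _ ha).2.1
    dsimp only at heq e1 e2 h1 h2 h3
    rw [heq] at e1 e2
    rw [minFac_mul_mul h3' h2' h1' (hmem _ ha').1 (hmem _ ha').2.1] at e1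
    rw [sup_primeFactors_mul_mul h3' h2' h1' (hmem _ ha').1 (hmem _ ha').2.1] at e2
    dsimp only at e1 e2
    subst e1 e2
    rw [Nat.mul_right_inj h3.ne_zero, Nat.mul_left_inj h1.ne_zero] at heq
    rw [heq]
  · intro n hn hne
    have hc : cardFactors n = 3 := by
      by_contra h
      exact hne (if_neg h)
    obtain ⟨p, q, r, hp, hq, hr, hpq, hqr, rfl⟩ := exists_of_cardFactors_eq_three hc
    rw [tripleTerm_mul f hp hq hr hpq hqr] at hne
    rw [Finset.mem_Ioc, Nat.le_floor_iff hx] at hn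
    push_cast at hn
    have hr0 : (0 : ℝ) < r := by exact_mod_cast hr.pos
    have hp1 : (1 : ℝ) ≤ p := by exact_mod_cast hp.one_le
    have hq1 : (1 : ℝ) ≤ q := by exact_mod_cast hq.one_le
    have hrx : (r : ℝ) ≤ x := by
      have : 1 * r ≤ (p : ℝ) * (q * r) := by
        rw [← mul_assoc]
        gcongr
        nlinarith
      linarith [hn.2]
    refine ⟨⟨r, q, p⟩, ?_, ?_, rfl⟩
    · simp only [Finset.mem_sigma, Finset.mem_Ioc]
      rw [Nat.le_floor_iff (le_min (by positivity) (by positivity)), le_min_iff,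
        le_div_iff₀ (by positivity), Nat.le_floor_iff hx]
      exact ⟨⟨hr.pos, hrx⟩, ⟨hq.pos, hqr⟩, hp.pos, by exact_mod_cast hpq, hn.2⟩
    · dsimp only
      rw [logPrime_of_prime hp, logPrime_of_prime hq, logPrime_of_prime hr]
      convert hne using 1
      ring
  · rintro ⟨r, q, p⟩ ha hne
    obtain ⟨h1, h2, h3⟩ := hprime _ hne
    dsimp only at h1 h2 h3 ⊢
    rw [tripleTerm_mul f h3 h2 h1 (hmem _ ha).1 (hmem _ ha).2.1, logPrime_of_prime h1,
      logPrime_of_prime h2, logPrime_of_prime h3]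
    ring

/-- The restriction of `n ↦ f (ratio n)` to the integers with exactly `k` prime factors. -/
noncomputable def layer (f : ℝ → ℝ) (k n : ℕ) : ℝ :=
  if cardFactors n = k then f (ratio n) else 0

lemma layer_nonneg {f : ℝ → ℝ} (h0 : ∀ t, 0 ≤ f t) (k n : ℕ) : 0 ≤ layer f k n := by
  unfold layer
  split_ifs
  exacts [h0 _, le_rfl]

lemma one_lt_log {x : ℝ} (hx : 4 ≤ x) : 1 < Real.log x := by
  have h : Real.log 4 ≤ Real.log x := Real.log_le_log (by norm_num) hx
  have h2 : Real.log 4 = 2 * Real.log 2 := by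
    rw [show (4 : ℝ) = 2 ^ 2 by norm_num, Real.log_pow]
    norm_num
  have := Real.log_two_gt_d9
  linarith

lemma abs_sum_sub_sum_le {g h : ℕ → ℝ} {K ε x : ℝ} (hK : 0 ≤ K) (hε : 0 ≤ ε) (hx : 4 ≤ x)
    (hg : ∀ n, 0 ≤ g n) (h1 : ∀ n, |h n - g n| ≤ K)
    (h2 : ∀ n : ℕ, √x < n → (n : ℝ) ≤ x → |h n - g n| ≤ ε * g n + K / Real.log x ^ 4) :
    |∑ n ∈ Finset.Ioc 0 ⌊x⌋₊, h n - ∑ n ∈ Finset.Ioc 0 ⌊x⌋₊, g n| ≤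
      ε * ∑ n ∈ Finset.Ioc 0 ⌊x⌋₊, g n + 4097 * K * (x / Real.log x ^ 4) := by
  have hL := one_lt_log hx
  have hx0 : (0 : ℝ) ≤ x := by linarith
  have hs0 := Real.sqrt_nonneg x
  have hsx : √x ≤ x := by
    rw [Real.sqrt_le_left hx0]
    nlinarith
  have hpt : ∀ n ∈ Finset.Ioc 0 ⌊x⌋₊, |h n - g n| ≤
      ε * g n + K / Real.log x ^ 4 + if n ∈ Finset.Ioc 0 ⌊√x⌋₊ then K else 0 := by
    intro n hn
    rw [Finset.mem_Ioc, Nat.le_floor_iff hx0] at hn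
    have hq : 0 ≤ K / Real.log x ^ 4 := by positivity
    have hp := mul_nonneg hε (hg n)
    split_ifs with hns
    · linarith [h1 n]
    · rw [Finset.mem_Ioc, Nat.le_floor_iff hs0, not_and, not_le] at hns
      linarith [h2 n (hns hn.1) hn.2]
  rw [← Finset.sum_sub_distrib]
  refine (Finset.abs_sum_le_sum_abs _ _).trans ((Finset.sum_le_sum hpt).trans ?_)
  rw [Finset.sum_add_distrib, Finset.sum_add_distrib, ← Finset.mul_sum, Finset.sum_const,
    Finset.sum_ite_mem, Finset.sum_const]
  simp only [nsmul_eq_mul, Nat.card_Ioc]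
  have hcard : ((Finset.Ioc 0 ⌊x⌋₊ ∩ Finset.Ioc 0 ⌊√x⌋₊).card : ℝ) ≤ √x := by
    refine le_trans ?_ (Nat.floor_le hs0)
    exact_mod_cast (Finset.card_le_card Finset.inter_subset_right).trans (by simp)
  have hfl : ((⌊x⌋₊ - 0 : ℕ) : ℝ) ≤ x := by simpa using Nat.floor_le hx0
  have hsq := sqrt_le_div_log_pow_four (x := x) (by linarith)
  have e1 : ((⌊x⌋₊ - 0 : ℕ) : ℝ) * (K / Real.log x ^ 4) ≤ x * (K / Real.log x ^ 4) := by gcongr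
  have e2 := mul_le_mul_of_nonneg_right (hcard.trans hsq) hK
  have e3 : x * (K / Real.log x ^ 4) = K * (x / Real.log x ^ 4) := by ring
  linarith

lemma isLittleO_sub_of_transfer {T H M ε : ℝ → ℝ} {D D' : ℝ} (hT0 : ∀ x, 0 ≤ T x)
    (hε0 : ∀ x, 4 ≤ x → 0 ≤ ε x)
    (hHT : ∀ x, 4 ≤ x → |H x - T x| ≤ ε x * T x + D * (x / Real.log x ^ 4))
    (hHM : ∀ x, 4 ≤ x → |H x - M x| ≤ D' * (x / Real.log x ^ 4))
    (hε : Tendsto ε atTop (𝓝 0))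
    (hεM : (fun x => ε x * M x) =o[atTop] fun x => x / Real.log x ^ 3) :
    (fun x => T x - M x) =o[atTop] fun x => x / Real.log x ^ 3 := by
  have h1 : (fun x => 2 * (ε x * M x) + (2 * |D| + 2 * |D'|) * (x / Real.log x ^ 4)) =o[atTop]
      fun x => x / Real.log x ^ 3 :=
    (hεM.const_mul_left 2).add (div_log_pow_four_isLittleO.const_mul_left _)
  refine Asymptotics.IsBigO.trans_isLittleO (Asymptotics.IsBigO.of_bound 1 ?_) h1
  filter_upwards [eventually_ge_atTop (4 : ℝ),
    hε.eventually (ge_mem_nhds (show (0 : ℝ) < 1 / 2 by norm_num))]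
    with x hx he
  have hL := one_lt_log hx
  set e := x / Real.log x ^ 4 with he_def
  have he0 : 0 ≤ e := by positivity
  have a1 := hHT x hx
  have a2 := hHM x hx
  have b1 : D * e ≤ |D| * e := by gcongr; exact le_abs_self D
  have b2 : D' * e ≤ |D'| * e := by gcongr; exact le_abs_self D'
  have c1 := abs_le.1 a1
  have c2 := abs_le.1 a2
  have hT := hT0 x
  have heps := hε0 x hx
  have hTle : T x ≤ 2 * M x + 2 * (|D| * e) + 2 * (|D'| * e) := by
    have : ε x * T x ≤ 1 / 2 * T x := by gcongr
    linarith
  have hD := mul_nonneg (abs_nonneg D) he0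
  have hD' := mul_nonneg (abs_nonneg D') he0
  have hεT : ε x * T x ≤ 2 * (ε x * M x) + |D| * e + |D'| * e := by
    have i1 := mul_le_mul_of_nonneg_left hTle heps
    have i2 : ε x * (|D| * e) ≤ 1 / 2 * (|D| * e) := by gcongr
    have i3 : ε x * (|D'| * e) ≤ 1 / 2 * (|D'| * e) := by gcongr
    linarith
  rw [one_mul, Real.norm_eq_abs, Real.norm_eq_abs]
  refine le_trans ?_ (le_abs_self _)
  rw [abs_le]
  constructor <;> linarith

lemma exp_neg_le {d x : ℝ} (hx : 4 ≤ x) (hd : 4 * Real.log (Real.log x) < d) :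
    Real.exp (-d) ≤ 1 / Real.log x ^ 4 := by
  have hL := one_lt_log hx
  have h : Real.exp (-d) ≤ Real.exp (-(4 * Real.log (Real.log x))) := by
    gcongr
  refine h.trans_eq ?_
  rw [Real.exp_neg, ← Real.log_rpow (by linarith), Real.exp_log (by positivity), one_div]
  norm_cast

lemma mul_le_of_exp {g K d ρ ε x : ℝ} (hK : 0 ≤ K) (hx : 4 ≤ x) (hg : 0 ≤ g)
    (hgd : g ≤ K * Real.exp (-d)) (hρ1 : ρ ≤ 1) (hε : 0 ≤ ε)
    (hρ : d ≤ 4 * Real.log (Real.log x) → ρ ≤ ε) :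
    g * ρ ≤ ε * g + K / Real.log x ^ 4 := by
  have hL := one_lt_log hx
  have hq : 0 ≤ K / Real.log x ^ 4 := by positivity
  rcases le_or_gt d (4 * Real.log (Real.log x)) with h | h
  · have := mul_le_mul_of_nonneg_left (hρ h) hg
    linarith
  · have h1 := mul_le_mul_of_nonneg_left (exp_neg_le hx h) hK
    have h2 := mul_le_mul_of_nonneg_left hρ1 hg
    have h3 := mul_nonneg hε hg
    have h4 : K * (1 / Real.log x ^ 4) = K / Real.log x ^ 4 := by ring
    linarith

lemma le_exp_neg_log_sub {f : ℝ → ℝ} {K : ℝ} (hK : ∀ t, 0 ≤ t → f t ≤ K * t) {p r : ℕ}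
    (hp : p.Prime) (hr : r.Prime) :
    f (p / r) ≤ K * Real.exp (-(Real.log r - Real.log p)) := by
  have hp0 : (0 : ℝ) < p := by exact_mod_cast hp.pos
  have hr0 : (0 : ℝ) < r := by exact_mod_cast hr.pos
  have h : Real.exp (-(Real.log r - Real.log p)) = p / r := by
    rw [neg_sub, Real.exp_sub, Real.exp_log hp0, Real.exp_log hr0]
  rw [h]
  exact hK _ (by positivity)

/-- The relative deviation of the weight of a product of two primes. -/
lemma exists_pairTerm_deviation {f : ℝ → ℝ} {K : ℝ} (hK : ∀ t, 0 ≤ t → f t ≤ K * t) {n : ℕ}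
    (hn : cardFactors n = 2) :
    ∃ d ρ : ℝ, 0 ≤ d ∧ 0 ≤ ρ ∧ ρ ≤ 1 ∧ ρ ≤ d ^ 2 / Real.log n ^ 2 ∧
      f (ratio n) ≤ K * Real.exp (-d) ∧
      4 * ((Real.log n ^ 2)⁻¹ * pairTerm f n) = f (ratio n) * (1 - ρ) := by
  obtain ⟨p, r, hp, hr, hpr, rfl⟩ := exists_of_cardFactors_eq_two hn
  have hrat : ratio (p * r) = p / r := by
    rw [ratio, minFac_mul hp hr hpr, sup_primeFactors_mul hp hr hpr]
  have hp0 : (0 : ℝ) < p := by exact_mod_cast hp.pos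
  have hr0 : (0 : ℝ) < r := by exact_mod_cast hr.pos
  have hlp : 0 < Real.log p := Real.log_pos (by exact_mod_cast hp.one_lt)
  have hlr : Real.log p ≤ Real.log r := Real.log_le_log hp0 (by exact_mod_cast hpr)
  rw [pairTerm_mul f hp hr hpr, hrat, Nat.cast_mul, Real.log_mul hp0.ne' hr0.ne']
  set a := Real.log p
  set b := Real.log r
  have hab : 0 < a + b := by linarith
  refine ⟨b - a, (b - a) ^ 2 / (a + b) ^ 2, by linarith, by positivity, ?_, le_rfl,
    le_exp_neg_log_sub hK hp hr, ?_⟩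
  · rw [div_le_one (by positivity)]
    nlinarith
  · field_simp
    ring

/-- The relative deviation of the weight of a product of three primes. -/
lemma exists_tripleTerm_deviation {f : ℝ → ℝ} {K : ℝ} (hK : ∀ t, 0 ≤ t → f t ≤ K * t) {n : ℕ}
    (hn : cardFactors n = 3) :
    ∃ d ρ : ℝ, 0 ≤ d ∧ 0 ≤ ρ ∧ ρ ≤ 1 ∧ ρ ≤ 6 * d / Real.log n ∧
      f (ratio n) ≤ K * Real.exp (-d) ∧
      27 * ((Real.log n ^ 3)⁻¹ * tripleTerm f n) = f (ratio n) * (1 - ρ) := by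
  obtain ⟨p, q, r, hp, hq, hr, hpq, hqr, rfl⟩ := exists_of_cardFactors_eq_three hn
  have hrat : ratio (p * (q * r)) = p / r := by
    rw [ratio, minFac_mul_mul hp hq hr hpq hqr, sup_primeFactors_mul_mul hp hq hr hpq hqr]
  have hp0 : (0 : ℝ) < p := by exact_mod_cast hp.pos
  have hq0 : (0 : ℝ) < q := by exact_mod_cast hq.pos
  have hr0 : (0 : ℝ) < r := by exact_mod_cast hr.pos
  have ha : 0 < Real.log p := Real.log_pos (by exact_mod_cast hp.one_lt)
  have hab : Real.log p ≤ Real.log q := Real.log_le_log hp0 (by exact_mod_cast hpq)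
  have hbc : Real.log q ≤ Real.log r := Real.log_le_log hq0 (by exact_mod_cast hqr)
  rw [tripleTerm_mul f hp hq hr hpq hqr, hrat, Nat.cast_mul, Nat.cast_mul,
    Real.log_mul hp0.ne' (by positivity), Real.log_mul hq0.ne' hr0.ne']
  set a := Real.log p
  set b := Real.log q
  set c := Real.log r
  have hb : 0 < b := by linarith
  have hc : 0 < c := by linarith
  set l := a + (b + c) with hl
  have hl0 : 0 < l := by linarith
  refine ⟨c - a, 1 - 27 * (a * (b * c)) / l ^ 3, by linarith, ?_, ?_, ?_,
    le_exp_neg_log_sub hK hp hr, ?_⟩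
  · rw [sub_nonneg, div_le_one (by positivity), hl]
    nlinarith [mul_nonneg ha.le (sq_nonneg (b - c)), mul_nonneg hb.le (sq_nonneg (a - c)),
      mul_nonneg hc.le (sq_nonneg (a - b)),
      mul_nonneg (add_pos ha (add_pos hb hc)).le (add_nonneg (add_nonneg (sq_nonneg (a - b))
        (sq_nonneg (a - c))) (sq_nonneg (b - c)))]
  · have : 0 ≤ 27 * (a * (b * c)) / l ^ 3 := by positivity
    linarith
  · have h1 : a * (a * a) ≤ a * (b * c) := by gcongr; linarith
    have h2 : (l - 3 * a) * (l ^ 2 + l * (3 * a) + (3 * a) ^ 2) ≤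
        (2 * (c - a)) * (l ^ 2 + l * l + l ^ 2) := by
      have h3 : 3 * a ≤ l := by linarith
      have h4 : 0 ≤ c - a := by linarith
      gcongr
      linarith
    have h5 : 1 - 27 * (a * (b * c)) / l ^ 3 = (l ^ 3 - 27 * (a * (b * c))) / l ^ 3 := by
      field_simp
    rw [h5, div_le_div_iff₀ (by positivity) hl0]
    have h6 : l ^ 3 - 27 * (a * (b * c)) ≤ 6 * (c - a) * l ^ 2 := by nlinarith
    calc (l ^ 3 - 27 * (a * (b * c))) * l ≤ 6 * (c - a) * l ^ 2 * l := by gcongr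
      _ = _ := by ring
  · field_simp
    ring

lemma tendsto_log_log_pow_div (k : ℕ) :
    Tendsto (fun x : ℝ => Real.log (Real.log x) ^ k / Real.log x) atTop (𝓝 0) :=
  ((Real.isLittleO_pow_log_id_atTop (n := k)).tendsto_div_nhds_zero).comp Real.tendsto_log_atTop

lemma half_log_le {x : ℝ} (hx : 0 ≤ x) {n : ℕ} (hn : √x < n) :
    Real.log x / 2 ≤ Real.log n := by
  rcases hx.eq_or_lt with rfl | hx0
  · simp [Real.log_natCast_nonneg]
  rw [← Real.log_sqrt hx]
  exact Real.log_le_log (Real.sqrt_pos.2 hx0) hn.le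

lemma abs_sub_le_of_deviation {f : ℝ → ℝ} {K : ℝ} (h0 : ∀ t, 0 ≤ f t) (hK0 : 0 ≤ K) {n : ℕ}
    {h d ρ : ℝ} (hd : 0 ≤ d) (hρ0 : 0 ≤ ρ) (hρ1 : ρ ≤ 1)
    (hf : f (ratio n) ≤ K * Real.exp (-d)) (hh : h = f (ratio n) * (1 - ρ)) :
    |h - f (ratio n)| ≤ K ∧ ∀ ε x : ℝ, 4 ≤ x → 0 ≤ ε →
      (d ≤ 4 * Real.log (Real.log x) → ρ ≤ ε) →
      |h - f (ratio n)| ≤ ε * f (ratio n) + K / Real.log x ^ 4 := by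
  have h1 : |h - f (ratio n)| = f (ratio n) * ρ := by
    rw [hh, show f (ratio n) * (1 - ρ) - f (ratio n) = -(f (ratio n) * ρ) by ring, abs_neg,
      abs_of_nonneg (mul_nonneg (h0 _) hρ0)]
  rw [h1]
  refine ⟨?_, fun ε x hx hε hρ => mul_le_of_exp hK0 hx (h0 _) hf hρ1 hε hρ⟩
  have h2 : Real.exp (-d) ≤ 1 := Real.exp_le_one_iff.2 (by linarith)
  have h3 := mul_le_mul_of_nonneg_left h2 hK0
  have h4 := mul_le_mul_of_nonneg_left hρ1 (h0 (ratio n))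
  linarith

theorem sum_layer_two_isLittleO {f : ℝ → ℝ} {K : ℝ} (hm : Monotone f) (hc : Continuous f)
    (h0 : ∀ t, 0 ≤ f t) (hK : ∀ t, 0 ≤ t → f t ≤ K * t) :
    (fun x : ℝ => ∑ n ∈ Finset.Ioc 0 ⌊x⌋₊, layer f 2 n -
      2 * (∫ t in (0 : ℝ)..1, f t / t) * (x / Real.log x ^ 2 + 2 * (x / Real.log x ^ 3)))
      =o[atTop] fun x : ℝ => x / Real.log x ^ 3 := by
  have hK0 : 0 ≤ K := by have := hK 1 zero_le_one; have := h0 1; linarith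
  obtain ⟨D, hD, hP⟩ := exists_pairSum_sub_le hm hc h0 hK
  set I := ∫ t in (0 : ℝ)..1, f t / t with hI
  obtain ⟨D₁, hD₁, h₁⟩ := exists_abs_sum_div_log_pow_sub_le (k := 2) (j := 2) (by norm_num)
    (c := pairTerm f) (by simp [pairTerm]) (by simp [pairTerm]) (A := I / 2) hD
    (fun u hu => by rw [sum_pairTerm f (by linarith)]; exact hP u hu)
  obtain ⟨D₂, hD₂, h₂⟩ := exists_abs_logInt_three_sub_le
  refine isLittleO_sub_of_transfer (D := 4097 * K) (D' := 4 * D₁ + 4 * |I| * D₂)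
    (ε := fun x => 64 * Real.log (Real.log x) ^ 2 / Real.log x ^ 2)
    (H := fun x => ∑ n ∈ Finset.Ioc 0 ⌊x⌋₊, 4 * ((Real.log n ^ 2)⁻¹ * pairTerm f n))
    (fun x => Finset.sum_nonneg fun n _ => layer_nonneg h0 2 n)
    (fun x _ => by positivity) (fun x hx => ?_) (fun x hx => ?_) ?_ ?_
  · have hL := one_lt_log hx
    refine abs_sum_sub_sum_le hK0 (by positivity) hx (layer_nonneg h0 2) (fun n => ?_)
      (fun n hn _ => ?_)
    · by_cases hΩ : cardFactors n = 2
      · obtain ⟨d, ρ, hd, hρ0, hρ1, -, hf, hh⟩ := exists_pairTerm_deviation hK hΩ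
        rw [layer, if_pos hΩ]
        exact (abs_sub_le_of_deviation h0 hK0 hd hρ0 hρ1 hf hh).1
      · simp [layer, pairTerm, hΩ, hK0]
    · by_cases hΩ : cardFactors n = 2
      · obtain ⟨d, ρ, hd, hρ0, hρ1, hρ, hf, hh⟩ := exists_pairTerm_deviation hK hΩ
        rw [layer, if_pos hΩ]
        refine (abs_sub_le_of_deviation h0 hK0 hd hρ0 hρ1 hf hh).2 _ x hx (by positivity)
          fun hdl => hρ.trans ?_
        have hl := half_log_le (by linarith) hn
        calc d ^ 2 / Real.log n ^ 2 ≤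
            (4 * Real.log (Real.log x)) ^ 2 / (Real.log x / 2) ^ 2 := by gcongr
          _ = _ := by ring
      · simp only [layer, pairTerm, hΩ, if_false, mul_zero, sub_zero, abs_zero, zero_add]
        positivity
  · have hL := one_lt_log hx
    have e1 := h₁ x hx
    have e2 := h₂ x hx
    norm_num at e1
    rw [← Finset.mul_sum]
    set S := ∑ n ∈ Finset.Ioc 0 ⌊x⌋₊, (Real.log n ^ 2)⁻¹ * pairTerm f n
    rw [show 4 * S - 2 * I * (x / Real.log x ^ 2 + 2 * (x / Real.log x ^ 3)) =
      4 * (S - I / 2 * (x / Real.log x ^ 2 + 2 * logInt 3 x)) +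
        4 * I * (logInt 3 x - x / Real.log x ^ 3) by ring]
    refine (abs_add_le _ _).trans ?_
    rw [abs_mul, abs_mul, abs_mul, abs_of_pos (show (0 : ℝ) < 4 by norm_num)]
    have e3 := mul_le_mul_of_nonneg_left e2 (by positivity : 0 ≤ 4 * |I|)
    linarith
  · have h := (tendsto_log_log_pow_div 1).pow 2 |>.const_mul 64
    simp only [pow_one, div_pow] at h
    convert h using 2 <;> ring
  · have h1 : (fun x : ℝ => Real.log (Real.log x) ^ 2 / Real.log x) =o[atTop]
        fun _ : ℝ => (1 : ℝ) := (Asymptotics.isLittleO_one_iff ℝ).2 (tendsto_log_log_pow_div 2)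
    have h2 : (fun x : ℝ => 64 / Real.log x *
        (2 * I * (x / Real.log x ^ 2 + 2 * (x / Real.log x ^ 3)))) =O[atTop]
        fun x : ℝ => x / Real.log x ^ 3 := by
      refine Asymptotics.IsBigO.of_bound (64 * (2 * |I| * 3)) ?_
      filter_upwards [eventually_ge_atTop (4 : ℝ)] with x hx
      have hL := one_lt_log hx
      rw [show 64 / Real.log x * (2 * I * (x / Real.log x ^ 2 + 2 * (x / Real.log x ^ 3))) =
        64 * (2 * I * (1 + 2 / Real.log x)) * (x / Real.log x ^ 3) by field_simp, norm_mul]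
      gcongr
      have h4 : 0 ≤ 1 + 2 / Real.log x := by positivity
      rw [Real.norm_eq_abs, abs_mul, abs_mul, abs_mul, abs_of_pos (show (0 : ℝ) < 64 by norm_num),
        abs_of_pos (show (0 : ℝ) < 2 by norm_num), abs_of_nonneg h4]
      have h5 : 2 / Real.log x ≤ 2 := by
        rw [div_le_iff₀ (by linarith)]; linarith
      gcongr
      linarith
    have h3 := h1.mul_isBigO h2
    simp only [one_mul] at h3
    refine h3.congr_left fun x => ?_
    ring

theorem sum_layer_three_isLittleO {f : ℝ → ℝ} {K : ℝ} (hm : Monotone f) (hc : Continuous f)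
    (h0 : ∀ t, 0 ≤ f t) (hK : ∀ t, 0 ≤ t → f t ≤ K * t) :
    (fun x : ℝ => ∑ n ∈ Finset.Ioc 0 ⌊x⌋₊, layer f 3 n -
      9 * (∫ s in (0 : ℝ)..1, ∫ t in (0 : ℝ)..s, f t / (s * t)) * (x / Real.log x ^ 3))
      =o[atTop] fun x : ℝ => x / Real.log x ^ 3 := by
  have hK0 : 0 ≤ K := by have := hK 1 zero_le_one; have := h0 1; linarith
  obtain ⟨D, hD, hP⟩ := exists_tripleSum_sub_le hm hc h0 hK
  set I := ∫ s in (0 : ℝ)..1, ∫ t in (0 : ℝ)..s, f t / (s * t) with hI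
  obtain ⟨D₁, hD₁, h₁⟩ := exists_abs_sum_div_log_pow_sub_le (k := 3) (j := 1) (by norm_num)
    (c := tripleTerm f) (by simp [tripleTerm]) (by simp [tripleTerm]) (A := I / 3) hD
    (fun u hu => by rw [sum_tripleTerm f (by linarith), pow_one]; exact hP u hu)
  obtain ⟨D₂, hD₂, h₂⟩ := exists_logInt_four_le
  refine isLittleO_sub_of_transfer (D := 4097 * K) (D' := 27 * D₁ + 27 * |I| * D₂)
    (ε := fun x => 48 * (|Real.log (Real.log x)| / Real.log x))
    (H := fun x => ∑ n ∈ Finset.Ioc 0 ⌊x⌋₊, 27 * ((Real.log n ^ 3)⁻¹ * tripleTerm f n))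
    (fun x => Finset.sum_nonneg fun n _ => layer_nonneg h0 3 n)
    (fun x hx => by have := one_lt_log hx; positivity) (fun x hx => ?_) (fun x hx => ?_) ?_ ?_
  · have hL := one_lt_log hx
    refine abs_sum_sub_sum_le hK0 (by positivity) hx (layer_nonneg h0 3) (fun n => ?_)
      (fun n hn _ => ?_)
    · by_cases hΩ : cardFactors n = 3
      · obtain ⟨d, ρ, hd, hρ0, hρ1, -, hf, hh⟩ := exists_tripleTerm_deviation hK hΩ
        rw [layer, if_pos hΩ]
        exact (abs_sub_le_of_deviation h0 hK0 hd hρ0 hρ1 hf hh).1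
      · simp [layer, tripleTerm, hΩ, hK0]
    · by_cases hΩ : cardFactors n = 3
      · obtain ⟨d, ρ, hd, hρ0, hρ1, hρ, hf, hh⟩ := exists_tripleTerm_deviation hK hΩ
        rw [layer, if_pos hΩ]
        refine (abs_sub_le_of_deviation h0 hK0 hd hρ0 hρ1 hf hh).2 _ x hx (by positivity)
          fun hdl => hρ.trans ?_
        have hl := half_log_le (by linarith) hn
        calc 6 * d / Real.log n ≤
            6 * (4 * |Real.log (Real.log x)|) / (Real.log x / 2) := by
              gcongr
              exact hdl.trans (by gcongr; exact le_abs_self _)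
          _ = _ := by ring
      · simp only [layer, tripleTerm, hΩ, if_false, mul_zero, sub_zero, abs_zero, zero_add]
        positivity
  · have hL := one_lt_log hx
    have e1 := h₁ x hx
    have e2 := h₂ x hx
    have e4 := logInt_nonneg 4 (by linarith : 2 ≤ x)
    norm_num at e1
    rw [← Finset.mul_sum]
    set S := ∑ n ∈ Finset.Ioc 0 ⌊x⌋₊, (Real.log n ^ 3)⁻¹ * tripleTerm f n
    rw [show 27 * S - 9 * I * (x / Real.log x ^ 3) =
      27 * (S - I / 3 * (x / Real.log x ^ 3 + 3 * logInt 4 x)) + 27 * I * logInt 4 x by ring]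
    refine (abs_add_le _ _).trans ?_
    rw [abs_mul, abs_mul, abs_mul, abs_of_pos (show (0 : ℝ) < 27 by norm_num), abs_of_nonneg e4]
    have e3 := mul_le_mul_of_nonneg_left e2 (by positivity : 0 ≤ 27 * |I|)
    linarith
  · have h := (tendsto_log_log_pow_div 1).abs.const_mul 48
    simp only [pow_one, abs_zero, mul_zero] at h
    refine h.congr' ?_
    filter_upwards [eventually_ge_atTop (4 : ℝ)] with x hx
    have hL := one_lt_log hx
    rw [abs_div, abs_of_pos (zero_lt_one.trans hL)]
  · have h := (tendsto_log_log_pow_div 1).abs.const_mul 48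
    simp only [pow_one, abs_zero, mul_zero] at h
    have h1 : (fun x : ℝ => 48 * (|Real.log (Real.log x)| / Real.log x)) =o[atTop]
        fun _ : ℝ => (1 : ℝ) := by
      refine (Asymptotics.isLittleO_one_iff ℝ).2 (h.congr' ?_)
      filter_upwards [eventually_ge_atTop (4 : ℝ)] with x hx
      have hL := one_lt_log hx
      rw [abs_div, abs_of_pos (zero_lt_one.trans hL)]
    simpa using h1.mul_isBigO
      ((Asymptotics.isBigO_refl (fun x : ℝ => x / Real.log x ^ 3) atTop).const_mul_left (9 * I))

/-- `n` is divisible by a product of `j` elements of `Q`. -/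
def HasFactorsIn (Q : Finset ℕ) : ℕ → ℕ → Prop
  | 0, _ => True
  | j + 1, n => ∃ q ∈ Q, ∃ m, n = q * m ∧ HasFactorsIn Q j m

lemma card_filter_le_of_mul (Q : Finset ℕ) {R : ℕ → Prop} [DecidablePred R] (P : ℕ → ℕ → Prop)
    [∀ q, DecidablePred (P q)] {x B : ℝ}
    (hQ : ∀ q ∈ Q, 0 < q) (hR : ∀ n, R n → ∃ q ∈ Q, ∃ m, n = q * m ∧ P q m)
    (hP : ∀ q ∈ Q,
      (((Finset.Ioc 0 ⌊x / q⌋₊).filter (P q)).card : ℝ) ≤ x / q * B) (hx : 0 ≤ x) :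
    (((Finset.Ioc 0 ⌊x⌋₊).filter R).card : ℝ) ≤
      x * (∑ q ∈ Q, 1 / (q : ℝ)) * B := by
  have hsub : ((Finset.Ioc 0 ⌊x⌋₊).filter R) ⊆
      Q.biUnion fun q => ((Finset.Ioc 0 ⌊x / q⌋₊).filter (P q)).image (q * ·) := by
    intro n hn
    simp only [Finset.mem_filter, Finset.mem_Ioc] at hn
    obtain ⟨⟨hn0, hnx⟩, hn⟩ := hn
    obtain ⟨q, hq, m, rfl, hm⟩ := hR n hn
    simp only [Finset.mem_biUnion, Finset.mem_image, Finset.mem_filter, Finset.mem_Ioc]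
    have hq0 : (0 : ℝ) < q := by exact_mod_cast hQ q hq
    rw [Nat.le_floor_iff hx] at hnx
    push_cast at hnx
    refine ⟨q, hq, m, ⟨⟨Nat.pos_of_mul_pos_left hn0, Nat.le_floor ?_⟩, hm⟩, rfl⟩
    rw [le_div_iff₀ hq0]
    linarith
  have h1 : (((Finset.Ioc 0 ⌊x⌋₊).filter R).card : ℝ) ≤
      ∑ q ∈ Q, (((Finset.Ioc 0 ⌊x / q⌋₊).filter (P q)).card : ℝ) := by
    exact_mod_cast (Finset.card_le_card hsub).trans (Finset.card_biUnion_le.trans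
      (Finset.sum_le_sum fun q _ => Finset.card_image_le))
  refine h1.trans ((Finset.sum_le_sum hP).trans_eq ?_)
  rw [Finset.mul_sum, Finset.sum_mul]
  exact Finset.sum_congr rfl fun q _ => by ring

lemma card_hasFactorsIn_le {Q : Finset ℕ} (hQ : ∀ q ∈ Q, 0 < q) (j : ℕ) {x : ℝ} (hx : 0 ≤ x)
    {R : ℕ → Prop} [DecidablePred R] (hR : ∀ n, R n → HasFactorsIn Q j n) :
    (((Finset.Ioc 0 ⌊x⌋₊).filter R).card : ℝ) ≤ x * (∑ q ∈ Q, 1 / (q : ℝ)) ^ j := by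
  induction j generalizing x R with
  | zero =>
    rw [pow_zero, mul_one]
    refine le_trans ?_ (Nat.floor_le hx)
    exact_mod_cast (Finset.card_filter_le _ _).trans (by simp)
  | succ j ih =>
    classical
    have hx' : ∀ q : ℕ, 0 ≤ x / q := fun q => by positivity
    rw [pow_succ', ← mul_assoc]
    exact card_filter_le_of_mul Q (fun _ => HasFactorsIn Q j) hQ hR
      (fun q _ => ih (hx' q) fun _ h => h) hx

lemma hasFactorsIn_of_le_cardFactors {Q : Finset ℕ} {j n : ℕ} (hn : n ≠ 0)
    (h : ∀ q, q.Prime → q ∣ n → q ∈ Q) (hj : j ≤ cardFactors n) : HasFactorsIn Q j n := by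
  induction j generalizing n with
  | zero => trivial
  | succ j ih =>
    have hn1 : n ≠ 1 := by rintro rfl; simp at hj
    have hp := Nat.minFac_prime hn1
    have hd := Nat.minFac_dvd n
    obtain ⟨m, hm⟩ := hd
    have hm0 : m ≠ 0 := by rintro rfl; exact hn (by rw [hm, mul_zero])
    refine ⟨n.minFac, h _ hp (Nat.minFac_dvd n), m, hm, ih hm0 (fun q hq hqm => h q hq ?_) ?_⟩
    · rw [hm]; exact hqm.mul_left _
    · have := cardFactors_mul_of_prime hp hm0
      rw [← hm] at this
      omega

/-- The primes in `(u, v]`. -/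
noncomputable def primesIoc (u v : ℝ) : Finset ℕ :=
  (Finset.Ioc ⌊u⌋₊ ⌊v⌋₊).filter Nat.Prime

lemma mem_primesIoc {u v : ℝ} (hu : 0 ≤ u) (hv : 0 ≤ v) {q : ℕ} :
    q ∈ primesIoc u v ↔ (u < q ∧ (q : ℝ) ≤ v) ∧ q.Prime := by
  rw [primesIoc, Finset.mem_filter, Finset.mem_Ioc, Nat.floor_lt hu, Nat.le_floor_iff hv]

lemma sum_primesIoc_le {u v : ℝ} (hu : 1 < u) (huv : u ≤ v) :
    ∑ q ∈ primesIoc u v, 1 / (q : ℝ) ≤ 8 * (1 + Real.log (v / u)) / Real.log u := by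
  have hl := Real.log_pos hu
  rw [le_div_iff₀ hl]
  refine le_trans ?_ (sum_logPrime_div_le (by linarith) huv)
  rw [primesIoc, Finset.sum_filter, Finset.sum_mul]
  refine Finset.sum_le_sum fun q hq => ?_
  rw [Finset.mem_Ioc, Nat.floor_lt (by linarith)] at hq
  unfold logPrime
  split_ifs with h
  · have : Real.log u ≤ Real.log q := Real.log_le_log (by linarith) hq.1.le
    rw [div_mul_eq_mul_div, one_mul]
    gcongr
  · simp

lemma card_sq_dvd_le {x B : ℝ} (hx : 0 ≤ x) (hB : 0 < B) {R : ℕ → Prop} [DecidablePred R]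
    (hR : ∀ n, R n → ∃ b : ℕ, B ≤ b ∧ b ^ 2 ∣ n) :
    (((Finset.Ioc 0 ⌊x⌋₊).filter R).card : ℝ) ≤ 2 * (x / B) := by
  set N := ⌊x⌋₊ with hN
  have hc : 0 < ⌈B⌉₊ := Nat.ceil_pos.2 hB
  have hsub : ((Finset.Ioc 0 N).filter R) ⊆
      (Finset.Ioo (⌈B⌉₊ - 1) (N + 1)).biUnion fun b => (Finset.Ioc 0 N).filter (b ^ 2 ∣ ·) := by
    intro n hn
    simp only [Finset.mem_filter, Finset.mem_Ioc] at hn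
    obtain ⟨hn, hb⟩ := hn
    obtain ⟨b, hBb, hb⟩ := hR n hb
    simp only [Finset.mem_biUnion, Finset.mem_filter, Finset.mem_Ioc, Finset.mem_Ioo]
    have h1 : ⌈B⌉₊ ≤ b := Nat.ceil_le.2 hBb
    have h2 := Nat.le_of_dvd hn.1 hb
    have h3 : b ≤ b ^ 2 := Nat.le_self_pow two_ne_zero b
    exact ⟨b, ⟨by omega, by omega⟩, hn, hb⟩
  have h1 := (Finset.card_le_card hsub).trans Finset.card_biUnion_le
  simp only [Nat.Ioc_filter_dvd_card_eq_div] at h1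
  have h2 : ∀ b ∈ Finset.Ioo (⌈B⌉₊ - 1) (N + 1), ((N / b ^ 2 : ℕ) : ℝ) ≤ x * ((b : ℝ) ^ 2)⁻¹ := by
    intro b _
    refine Nat.cast_div_le.trans ?_
    push_cast
    rw [← div_eq_mul_inv]
    gcongr
    exact Nat.floor_le hx
  have h3 := sum_Ioo_inv_sq_le (α := ℝ) (⌈B⌉₊ - 1) (N + 1)
  rw [Nat.cast_sub hc, Nat.cast_one, sub_add_cancel] at h3
  have h4 : 2 / (⌈B⌉₊ : ℝ) ≤ 2 / B := by
    gcongr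
    exact Nat.le_ceil B
  calc _ ≤ ((∑ b ∈ Finset.Ioo (⌈B⌉₊ - 1) (N + 1), N / b ^ 2 : ℕ) : ℝ) := by exact_mod_cast h1
    _ = ∑ b ∈ Finset.Ioo (⌈B⌉₊ - 1) (N + 1), ((N / b ^ 2 : ℕ) : ℝ) := by push_cast; rfl
    _ ≤ ∑ b ∈ Finset.Ioo (⌈B⌉₊ - 1) (N + 1), x * ((b : ℝ) ^ 2)⁻¹ := Finset.sum_le_sum h2
    _ ≤ x * (2 / B) := by rw [← Finset.mul_sum]; gcongr; exact h3.trans h4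
    _ = _ := by ring

lemma sum_card_divisors_le {x : ℝ} (hx : 1 ≤ x) :
    ∑ n ∈ Finset.Ioc 0 ⌊x⌋₊, (n.divisors.card : ℝ) ≤ x * (1 + Real.log x) := by
  have h1 := sum_Ioc_sigma0_eq_sum_div ⌊x⌋₊
  simp only [sigma_zero_apply] at h1
  have h2 := harmonic_floor_le_one_add_log x hx
  rw [harmonic_eq_sum_Icc] at h2
  push_cast at h2
  calc _ = ((∑ n ∈ Finset.Ioc 0 ⌊x⌋₊, n.divisors.card : ℕ) : ℝ) := by push_cast; rfl
    _ = ∑ n ∈ Finset.Ioc 0 ⌊x⌋₊, ((⌊x⌋₊ / n : ℕ) : ℝ) := by rw [h1]; push_cast; rfl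
    _ ≤ ∑ n ∈ Finset.Ioc 0 ⌊x⌋₊, x * (n : ℝ)⁻¹ := by
      refine Finset.sum_le_sum fun n _ => Nat.cast_div_le.trans ?_
      rw [← div_eq_mul_inv]
      gcongr
      exact Nat.floor_le (by linarith)
    _ ≤ _ := by
      rw [← Finset.mul_sum]
      gcongr
      exact h2

lemma card_divisors_ge_le {x B : ℝ} (hx : 1 ≤ x) (hB : 0 < B) {R : ℕ → Prop} [DecidablePred R]
    (hR : ∀ n, R n → B ≤ n.divisors.card) :
    (((Finset.Ioc 0 ⌊x⌋₊).filter R).card : ℝ) ≤ x * (1 + Real.log x) / B := by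
  rw [le_div_iff₀ hB]
  refine le_trans ?_ (sum_card_divisors_le hx)
  rw [← nsmul_eq_mul]
  refine (Finset.card_nsmul_le_sum _ (fun n : ℕ => (n.divisors.card : ℝ)) B fun n hn =>
    hR n (Finset.mem_filter.1 hn).2).trans ?_
  exact Finset.sum_le_sum_of_subset_of_nonneg (Finset.filter_subset _ _) fun _ _ _ => by positivity

lemma le_maxFac {n q : ℕ} (hn : n ≠ 0) (hq : q.Prime) (hqn : q ∣ n) : q ≤ maxFac n :=
  Finset.le_sup (f := id) (Nat.mem_primeFactors.2 ⟨hq, hqn, hn⟩)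

lemma minFac_pow_cardFactors_le {n : ℕ} (hn : n ≠ 0) : n.minFac ^ cardFactors n ≤ n := by
  conv_rhs => rw [← Nat.prod_primeFactorsList hn]
  rw [cardFactors_apply]
  exact List.pow_card_le_prod _ _ fun q hq => Nat.minFac_le_of_dvd
    (Nat.prime_of_mem_primeFactorsList hq).two_le (Nat.dvd_of_mem_primeFactorsList hq)

lemma le_maxFac_pow_cardFactors {n : ℕ} (hn : n ≠ 0) : n ≤ maxFac n ^ cardFactors n := by
  conv_lhs => rw [← Nat.prod_primeFactorsList hn]
  rw [cardFactors_apply]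
  exact List.prod_le_pow_card _ _ fun q hq => le_maxFac hn
    (Nat.prime_of_mem_primeFactorsList hq) (Nat.dvd_of_mem_primeFactorsList hq)

lemma two_pow_card_primeFactors_le {n : ℕ} (hn : n ≠ 0) :
    2 ^ n.primeFactors.card ≤ n.divisors.card := by
  rw [Nat.card_divisors hn]
  refine Finset.pow_card_le_prod _ _ _ fun q hq => ?_
  have h := Nat.mem_primeFactors.1 hq
  have := h.1.factorization_pos_of_dvd hn h.2.1
  omega

lemma log_le_card_primeFactors_mul {n : ℕ} {B Z : ℝ} (hn : n ≠ 0)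
    (hsq : ∀ b : ℕ, B ≤ b → ¬ b ^ 2 ∣ n) (hZ0 : 0 ≤ Z)
    (hZ : ∀ q : ℕ, q.Prime → q ∣ n → Real.log q ≤ Z) :
    Real.log n ≤ 2 * Real.log B + n.primeFactors.card * Z := by
  obtain ⟨a, b, hab, ha⟩ := Nat.sq_mul_squarefree n
  have hb0 : b ≠ 0 := by rintro rfl; exact hn (by rw [← hab]; simp)
  have ha0 : a ≠ 0 := ha.ne_zero
  have hbB : (b : ℝ) < B := by
    by_contra h
    exact hsq b (not_lt.1 h) ⟨a, hab.symm⟩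
  have hb0' : (0 : ℝ) < b := by positivity
  have hlb : Real.log b ≤ Real.log B := Real.log_le_log hb0' hbB.le
  have hla : Real.log a ≤ n.primeFactors.card * Z := by
    have h1 : (a : ℝ) = ∏ q ∈ a.primeFactors, (q : ℝ) := by
      rw [← Nat.cast_prod, Nat.prod_primeFactors_of_squarefree ha]
    rw [h1, Real.log_prod (fun q hq => by
      exact_mod_cast (Nat.prime_of_mem_primeFactors hq).ne_zero)]
    refine (Finset.sum_le_card_nsmul _ _ Z fun q hq => ?_).trans ?_
    · have h := Nat.mem_primeFactors.1 hq
      exact hZ q h.1 (h.2.1.trans ⟨b ^ 2, by rw [← hab, mul_comm]⟩)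
    · rw [nsmul_eq_mul]
      gcongr
      exact Nat.primeFactors_mono ⟨b ^ 2, by rw [← hab, mul_comm]⟩ hn
  rw [← hab]
  push_cast
  rw [Real.log_mul (by positivity) (by positivity), Real.log_pow, hab]
  push_cast
  linarith

/-- An integer with at least four prime factors whose smallest and largest prime factors are
close, and which has few divisors and no large square divisor, has four of its prime factors in a
short window. -/
lemma hasFactorsIn_or {x L l : ℝ} (hL : Real.log x = L) (hl : Real.log L = l) (hl1 : 1 ≤ l)
    (hlL : 1000 * l ^ 2 ≤ L) {n : ℕ} (hn : n ≠ 0) (hnx : (n : ℝ) ≤ x) (hΩ : 4 ≤ cardFactors n)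
    (h1 : x / L ^ 4 < n) (h2 : 1 / L ^ 4 < ratio n) (h3 : (n.divisors.card : ℝ) < L ^ 5)
    (h4 : ∀ b : ℕ, L ^ 4 ≤ b → ¬ b ^ 2 ∣ n) :
    HasFactorsIn (primesIoc (Real.exp (L / 4 - 5 * l)) (Real.exp (L / 4 + 4 * l))) 4 n ∨
      ∃ q ∈ primesIoc (Real.exp (L / (32 * l))) x, ∃ m, n = q * m ∧
        HasFactorsIn (primesIoc (q / 2) (L ^ 4 * q)) 4 m := by
  have hL0 : 0 < L := by nlinarith
  have hLl : 1000 * l ≤ L := by nlinarith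
  have hx0 : 0 < x := lt_of_lt_of_le (by positivity) hnx
  have hn1 : n ≠ 1 := by rintro rfl; simp at hΩ
  have hp := Nat.minFac_prime hn1
  have hPp : (maxFac n).Prime := by
    obtain ⟨q, hq, hq'⟩ := Finset.exists_mem_eq_sup n.primeFactors
      (Nat.nonempty_primeFactors.2 (by omega)) id
    rw [maxFac, hq']
    exact Nat.prime_of_mem_primeFactors hq
  set p := n.minFac with hpdef
  set P := maxFac n with hPdef
  have hp0 : (0 : ℝ) < p := by exact_mod_cast hp.pos
  have hP0 : (0 : ℝ) < P := by exact_mod_cast hPp.pos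
  have hPlt : (P : ℝ) < L ^ 4 * p := by
    have h : ratio n = p / P := rfl
    rw [h, div_lt_div_iff₀ (by positivity) hP0] at h2
    linarith
  have hlogL4 : Real.log (L ^ 4) = 4 * l := by rw [Real.log_pow, hl]; norm_num
  have hlP : Real.log P < 4 * l + Real.log p := by
    have := Real.log_lt_log hP0 hPlt
    rwa [Real.log_mul (by positivity) hp0.ne', hlogL4] at this
  have hqmin : ∀ q : ℕ, q.Prime → q ∣ n → p ≤ q := fun q hq hqn =>
    Nat.minFac_le_of_dvd hq.two_le hqn
  have hqmax : ∀ q : ℕ, q.Prime → q ∣ n → q ≤ P := fun q hq hqn => le_maxFac hn hq hqn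
  have hn0 : (0 : ℝ) < n := by positivity
  have hlogn : L - 4 * l < Real.log n := by
    have := Real.log_lt_log (by positivity) h1
    rwa [Real.log_div hx0.ne' (by positivity), hL, hlogL4] at this
  have hlogn' : Real.log n ≤ L := by rw [← hL]; exact Real.log_le_log hn0 hnx
  rcases le_or_gt (Real.log p) (L / (32 * l)) with hpy | hpy
  · exfalso
    have h5 : 4 * l ≤ L / (32 * l) := by
      rw [le_div_iff₀ (by positivity)]
      nlinarith
    have h6 := log_le_card_primeFactors_mul hn h4
      (by positivity : 0 ≤ L / (16 * l)) fun q hq hqn => by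
        have h7 : Real.log q ≤ Real.log P :=
          Real.log_le_log (by exact_mod_cast hq.pos) (by exact_mod_cast hqmax q hq hqn)
        have h8 : L / (16 * l) = L / (32 * l) + L / (32 * l) := by field_simp; norm_num
        linarith
    rw [hlogL4] at h6
    set w := n.primeFactors.card with hw
    have h7 : 8 * l ≤ w := by
      have h8 : L / 2 ≤ w * (L / (16 * l)) := by linarith
      have h9 : w * (L / (16 * l)) = L / 2 * (w / (8 * l)) := by field_simp; ring
      rw [h9] at h8
      have h10 : 1 ≤ w / (8 * l) := by
        by_contra h
        push Not at h
        have : L / 2 * (w / (8 * l)) < L / 2 * 1 := by gcongr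
        linarith
      rwa [le_div_iff₀ (by positivity), one_mul] at h10
    have h8 : (2 : ℝ) ^ w ≤ n.divisors.card := by exact_mod_cast two_pow_card_primeFactors_le hn
    have h9 := Real.log_lt_log (by positivity) (h8.trans_lt h3)
    rw [Real.log_pow, Real.log_pow, hl] at h9
    have h10 := Real.log_two_gt_d9
    push_cast at h9
    nlinarith
  · rcases hΩ.eq_or_lt with hΩ | hΩ
    · left
      refine hasFactorsIn_of_le_cardFactors hn (fun q hq hqn => ?_) hΩ.le
      have hq0 : (0 : ℝ) < q := by exact_mod_cast hq.pos
      have e1 : Real.log p ≤ Real.log q := Real.log_le_log hp0 (by exact_mod_cast hqmin q hq hqn)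
      have e2 : Real.log q ≤ Real.log P := Real.log_le_log hq0 (by exact_mod_cast hqmax q hq hqn)
      have e3 : 4 * Real.log p ≤ Real.log n := by
        have h : (p : ℝ) ^ 4 ≤ n := by
          have := minFac_pow_cardFactors_le hn
          rw [← hΩ] at this
          exact_mod_cast this
        have := Real.log_le_log (by positivity) h
        rw [Real.log_pow] at this
        exact_mod_cast this
      have e4 : Real.log n ≤ 4 * Real.log P := by
        have h : (n : ℝ) ≤ (P : ℝ) ^ 4 := by
          have := le_maxFac_pow_cardFactors hn
          rw [← hΩ] at this
          exact_mod_cast this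
        have := Real.log_le_log (by positivity) h
        rw [Real.log_pow] at this
        exact_mod_cast this
      rw [mem_primesIoc (Real.exp_pos _).le (Real.exp_pos _).le]
      refine ⟨⟨(Real.lt_log_iff_exp_lt hq0).1 (by linarith),
        (Real.log_le_iff_le_exp hq0).1 (by linarith)⟩, hq⟩
    · right
      obtain ⟨m, hm⟩ : p ∣ n := Nat.minFac_dvd n
      have hm0 : m ≠ 0 := by rintro rfl; exact hn (by rw [hm, mul_zero])
      refine ⟨p, ?_, m, hm, hasFactorsIn_of_le_cardFactors hm0 (fun q hq hqm => ?_) ?_⟩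
      · rw [mem_primesIoc (Real.exp_pos _).le hx0.le]
        refine ⟨⟨(Real.lt_log_iff_exp_lt hp0).1 hpy, le_trans ?_ hnx⟩, hp⟩
        exact_mod_cast Nat.minFac_le (Nat.pos_of_ne_zero hn)
      · have hqn : q ∣ n := hqm.trans ⟨p, by rw [mul_comm]; exact hm⟩
        have e1 : (p : ℝ) ≤ q := by exact_mod_cast hqmin q hq hqn
        have e2 : (q : ℝ) ≤ P := by exact_mod_cast hqmax q hq hqn
        rw [mem_primesIoc (by positivity) (by positivity)]
        exact ⟨⟨by linarith, by linarith⟩, hq⟩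
      · have := cardFactors_mul_of_prime hp hm0
        rw [← hm] at this
        omega

lemma ratio_nonneg (n : ℕ) : 0 ≤ ratio n := by unfold ratio; positivity

lemma ratio_le_one (n : ℕ) : ratio n ≤ 1 := by
  rcases Nat.lt_or_ge n 2 with h | h
  · interval_cases n <;> simp [ratio]
  · refine div_le_one_of_le₀ ?_ (by positivity)
    exact_mod_cast le_maxFac (by omega) (Nat.minFac_prime (by omega)) (Nat.minFac_dvd n)

lemma card_hasFactorsIn_middle_le {x L l : ℝ} (hx : 0 ≤ x) (hl1 : 1 ≤ l)
    (hlL : 1000 * l ^ 2 ≤ L) {R : ℕ → Prop} [DecidablePred R] (hR : ∀ n, R n → HasFactorsIn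
      (primesIoc (Real.exp (L / 4 - 5 * l)) (Real.exp (L / 4 + 4 * l))) 4 n) :
    (((Finset.Ioc 0 ⌊x⌋₊).filter R).card : ℝ) ≤ 640 ^ 4 * (x * (l ^ 4 / L ^ 4)) := by
  have hL0 : 0 < L := by nlinarith
  have hLl : 1000 * l ≤ L := by nlinarith
  refine (card_hasFactorsIn_le (fun q hq => ((mem_primesIoc (Real.exp_pos _).le
    (Real.exp_pos _).le).1 hq).2.pos) 4 hx hR).trans ?_
  have h := sum_primesIoc_le (u := Real.exp (L / 4 - 5 * l)) (v := Real.exp (L / 4 + 4 * l))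
    (Real.one_lt_exp_iff.2 (by linarith)) (Real.exp_le_exp.2 (by linarith))
  rw [← Real.exp_sub, Real.log_exp, Real.log_exp] at h
  have h2 : 8 * (1 + (L / 4 + 4 * l - (L / 4 - 5 * l))) / (L / 4 - 5 * l) ≤ 640 * (l / L) := by
    rw [← mul_div_assoc, div_le_div_iff₀ (by linarith) hL0]
    nlinarith
  calc _ ≤ x * (640 * (l / L)) ^ 4 := by
        gcongr
        exact h.trans h2
    _ = _ := by ring

lemma card_exists_hasFactorsIn_le {x L l : ℝ} (hL : Real.log x = L) (hl : Real.log L = l)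
    (hl1 : 1 ≤ l) (hlL : 1000 * l ^ 2 ≤ L) (hx1 : 1 ≤ x) {R : ℕ → Prop} [DecidablePred R]
    (hR : ∀ n, R n → ∃ q ∈ primesIoc (Real.exp (L / (32 * l))) x, ∃ m,
      n = q * m ∧ HasFactorsIn (primesIoc (q / 2) (L ^ 4 * q)) 4 m) :
    (((Finset.Ioc 0 ⌊x⌋₊).filter R).card : ℝ) ≤
      512 * 3072 ^ 4 * (x * (l ^ 9 / L ^ 4)) := by
  classical
  have hL0 : 0 < L := by nlinarith
  have hLl : 1000 * l ≤ L := by nlinarith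
  have hx0 : 0 < x := by linarith
  have hmem : ∀ q ∈ primesIoc (Real.exp (L / (32 * l))) x,
      L / (32 * l) < Real.log q ∧ q.Prime := fun q hq => by
    have h := (mem_primesIoc (Real.exp_pos _).le hx0.le).1 hq
    exact ⟨(Real.lt_log_iff_exp_lt (by exact_mod_cast h.2.pos)).2 h.1.1, h.2⟩
  have hl2 := Real.log_two_lt_d9
  have h64 : 1 ≤ L / (64 * l) := by
    rw [le_div_iff₀ (by positivity)]; nlinarith
  have h32 : L / (32 * l) = L / (64 * l) + L / (64 * l) := by field_simp; norm_num
  have hsum : ∑ q ∈ primesIoc (Real.exp (L / (32 * l))) x, 1 / (q : ℝ) ≤ 512 * l := by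
    have hle : L / (32 * l) ≤ L := div_le_self hL0.le (by linarith)
    refine (sum_primesIoc_le (Real.one_lt_exp_iff.2 (by positivity)) ?_).trans ?_
    · rw [← Real.le_log_iff_exp_le hx0, hL]
      exact hle
    · rw [Real.log_exp, Real.log_div hx0.ne' (Real.exp_pos _).ne', Real.log_exp, hL,
        div_le_iff₀ (by positivity)]
      have e : 512 * l * (L / (32 * l)) = 16 * L := by field_simp; norm_num
      rw [e]
      have : 0 ≤ L / (32 * l) := by positivity
      nlinarith
  refine (card_filter_le_of_mul (primesIoc (Real.exp (L / (32 * l))) x)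
    (fun q m => HasFactorsIn (primesIoc (q / 2) (L ^ 4 * q)) 4 m) (B := (3072 * (l ^ 2 / L)) ^ 4)
    (fun q hq => (hmem q hq).2.pos) hR (fun q hq => ?_) hx0.le).trans ?_
  · obtain ⟨h1, hq⟩ := hmem q hq
    have hq0 : (0 : ℝ) < q := by exact_mod_cast hq.pos
    refine (card_hasFactorsIn_le (fun r hr => ((mem_primesIoc (by positivity)
      (by positivity)).1 hr).2.pos) 4 (by positivity) fun _ h => h).trans ?_
    gcongr
    have hlog : L / (64 * l) ≤ Real.log (q / 2) := by
      rw [Real.log_div hq0.ne' two_ne_zero]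
      linarith
    have hq2 : (1 : ℝ) < q / 2 := by
      rw [← Real.log_pos_iff (by positivity)]
      linarith
    have hL4 : (1 : ℝ) ≤ L ^ 4 := one_le_pow₀ (by nlinarith)
    refine (sum_primesIoc_le hq2 (by nlinarith)).trans ?_
    have e1 : Real.log (L ^ 4 * q / (q / 2)) = 4 * l + Real.log 2 := by
      rw [show L ^ 4 * q / (q / 2) = L ^ 4 * 2 by field_simp,
        Real.log_mul (by positivity) two_ne_zero, Real.log_pow, hl]
      norm_num
    rw [e1]
    calc 8 * (1 + (4 * l + Real.log 2)) / Real.log (q / 2) ≤ 8 * (6 * l) / (L / (64 * l)) := by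
          gcongr
          linarith
      _ = 3072 * (l ^ 2 / L) := by field_simp; norm_num
  · calc _ ≤ x * (512 * l) * (3072 * (l ^ 2 / L)) ^ 4 := by gcongr
      _ = _ := by ring

lemma sum_ratio_le {x L l : ℝ} (hL : Real.log x = L) (hl : Real.log L = l)
    (hl1 : 1 ≤ l) (hlL : 1000 * l ^ 2 ≤ L) (hx1 : 1 ≤ x) :
    ∑ n ∈ Finset.Ioc 0 ⌊x⌋₊, (if 4 ≤ cardFactors n then ratio n else 0) ≤
      (6 + 640 ^ 4 + 512 * 3072 ^ 4) * (x * (l ^ 9 / L ^ 4)) := by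
  classical
  have hL0 : 0 < L := by nlinarith
  have hLl : 1000 * l ≤ L := by nlinarith
  have hx0 : 0 < x := by linarith
  let S : Fin 5 → ℕ → Prop := ![fun n => (n : ℝ) ≤ x / L ^ 4,
    fun n => L ^ 5 ≤ n.divisors.card,
    fun n => ∃ b : ℕ, L ^ 4 ≤ b ∧ b ^ 2 ∣ n,
    HasFactorsIn (primesIoc (Real.exp (L / 4 - 5 * l)) (Real.exp (L / 4 + 4 * l))) 4,
    fun n => ∃ q ∈ primesIoc (Real.exp (L / (32 * l))) x, ∃ m,
      n = q * m ∧ HasFactorsIn (primesIoc (q / 2) (L ^ 4 * q)) 4 m]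
  have hpt : ∀ n ∈ Finset.Ioc 0 ⌊x⌋₊, (if 4 ≤ cardFactors n then ratio n else 0) ≤
      1 / L ^ 4 + ∑ i, if S i n then (1 : ℝ) else 0 := by
    intro n hn
    rw [Finset.mem_Ioc, Nat.le_floor_iff hx0.le] at hn
    have hnn : ∀ i ∈ Finset.univ, (0 : ℝ) ≤ if S i n then (1 : ℝ) else 0 := fun i _ => by
      split_ifs <;> norm_num
    have hq : 0 ≤ 1 / L ^ 4 := by positivity
    by_cases hS : ∃ i, S i n
    · obtain ⟨i, hi⟩ := hS
      have h := Finset.single_le_sum hnn (Finset.mem_univ i)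
      rw [if_pos hi] at h
      have h2 := ratio_le_one n
      split_ifs <;> linarith
    · push Not at hS
      have h := Finset.sum_nonneg hnn
      split_ifs with hΩ
      · by_contra hcon
        have h1 := hS 0
        have h2 := hS 1
        have h3 := hS 2
        have h4 := hS 3
        have h5 := hS 4
        simp only [S, Matrix.cons_val] at h1 h2 h3 h4 h5
        rcases hasFactorsIn_or hL hl hl1 hlL hn.1.ne' hn.2 hΩ (not_le.1 h1) (by linarith)
          (not_le.1 h2) (fun b hb hd => h3 ⟨b, hb, hd⟩) with h6 | h6
        exacts [h4 h6, h5 h6]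
      · linarith
  refine (Finset.sum_le_sum hpt).trans ?_
  rw [Finset.sum_add_distrib, Finset.sum_const, Finset.sum_comm, nsmul_eq_mul, Nat.card_Ioc,
    Nat.sub_zero]
  simp only [← Finset.natCast_card_filter]
  rw [Fin.sum_univ_five]
  have hfl : (⌊x⌋₊ : ℝ) ≤ x := Nat.floor_le hx0.le
  have hl9 : 1 ≤ l ^ 9 := one_le_pow₀ hl1
  have hl4 : l ^ 4 ≤ l ^ 9 := pow_le_pow_right₀ hl1 (by norm_num)
  have hbase : x / L ^ 4 ≤ x * (l ^ 9 / L ^ 4) := by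
    rw [← mul_div_assoc]
    gcongr
    nlinarith
  have b0 : (⌊x⌋₊ : ℝ) * (1 / L ^ 4) ≤ x / L ^ 4 := by
    rw [mul_one_div]
    gcongr
  have b1 : (((Finset.Ioc 0 ⌊x⌋₊).filter (S 0)).card : ℝ) ≤
      x / L ^ 4 := by
    have hq : 0 ≤ x / L ^ 4 := by positivity
    refine le_trans ?_ (Nat.floor_le hq)
    have : ((Finset.Ioc 0 ⌊x⌋₊).filter (S 0)) ⊆
        Finset.Ioc 0 ⌊x / L ^ 4⌋₊ := fun n hn => by
      rw [Finset.mem_filter, Finset.mem_Ioc] at hn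
      exact Finset.mem_Ioc.2 ⟨hn.1.1, Nat.le_floor hn.2⟩
    exact_mod_cast (Finset.card_le_card this).trans (by simp)
  have b2 := card_divisors_ge_le hx1 (by positivity : 0 < L ^ 5) (R := S 1) fun _ h => h
  have b2' : x * (1 + Real.log x) / L ^ 5 ≤ 2 * (x / L ^ 4) := by
    rw [hL, ← mul_div_assoc, div_le_div_iff₀ (by positivity) (by positivity)]
    have : x * (1 + L) ≤ x * (2 * L) := by gcongr; nlinarith
    calc x * (1 + L) * L ^ 4 ≤ x * (2 * L) * L ^ 4 := by gcongr
      _ = _ := by ring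
  have b3 := card_sq_dvd_le hx0.le (by positivity : 0 < L ^ 4) (R := S 2) fun _ h => h
  have b4 := card_hasFactorsIn_middle_le hx0.le hl1 hlL (R := S 3) fun _ h => h
  have b4' : x * (l ^ 4 / L ^ 4) ≤ x * (l ^ 9 / L ^ 4) := by gcongr
  have b5 := card_exists_hasFactorsIn_le hL hl hl1 hlL hx1 (R := S 4) fun _ h => h
  linarith

theorem sum_ratio_isLittleO :
    (fun x : ℝ => ∑ n ∈ Finset.Ioc 0 ⌊x⌋₊, (if 4 ≤ cardFactors n then ratio n else 0))
      =o[atTop] fun x : ℝ => x / Real.log x ^ 3 := by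
  have h1 : (fun x : ℝ => Real.log (Real.log x) ^ 9 / Real.log x) =o[atTop]
      fun _ : ℝ => (1 : ℝ) := (Asymptotics.isLittleO_one_iff ℝ).2 (tendsto_log_log_pow_div 9)
  have h2 := h1.mul_isBigO (Asymptotics.isBigO_refl (fun x : ℝ => x / Real.log x ^ 3) atTop)
  simp only [one_mul] at h2
  refine Asymptotics.IsBigO.trans_isLittleO
    (Asymptotics.IsBigO.of_bound (6 + 640 ^ 4 + 512 * 3072 ^ 4) ?_) h2
  filter_upwards [eventually_ge_atTop (1 : ℝ),
    (Real.tendsto_log_atTop.comp Real.tendsto_log_atTop).eventually_ge_atTop 1,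
    (tendsto_log_log_pow_div 2).eventually (ge_mem_nhds (show (0 : ℝ) < 1 / 1000 by norm_num)),
    Real.tendsto_log_atTop.eventually_gt_atTop 0] with x hx hl hlL hL
  rw [div_le_div_iff₀ hL (by norm_num)] at hlL
  simp only [Function.comp_apply] at hl
  have h := sum_ratio_le rfl rfl hl (by linarith) hx
  rw [Real.norm_of_nonneg (Finset.sum_nonneg fun n _ => by
    split_ifs
    exacts [ratio_nonneg n, le_rfl])]
  refine h.trans ?_
  gcongr
  refine le_trans (le_of_eq ?_) (le_abs_self _)
  field_simp

lemma ratio_of_prime {p : ℕ} (hp : p.Prime) : ratio p = 1 := by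
  have : (p : ℝ) ≠ 0 := by exact_mod_cast hp.ne_zero
  simp [ratio, hp.minFac_eq, hp.primeFactors, this]

/-- The expected main terms of `∑ n ≤ x, f (ratio n)`. -/
noncomputable def mainTerm (f : ℝ → ℝ) (x : ℝ) : ℝ :=
  f 1 * (x / Real.log x)
    + (2 * (∫ t in (0 : ℝ)..1, f t / t) + f 1) * (x / Real.log x ^ 2)
    + (9 * (∫ s in (0 : ℝ)..1, ∫ t in (0 : ℝ)..s, f t / (s * t))
        + 4 * (∫ t in (0 : ℝ)..1, f t / t) + 2 * f 1) * (x / Real.log x ^ 3)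

lemma sum_ratio_eq_sum_layers (f : ℝ → ℝ) (N : ℕ) :
    ∑ n ∈ Finset.Icc 2 N, f (ratio n) = f 1 * (∑ n ∈ Finset.Ioc 0 N, if n.Prime then (1 : ℝ) else 0)
      + ∑ n ∈ Finset.Ioc 0 N, layer f 2 n + ∑ n ∈ Finset.Ioc 0 N, layer f 3 n
      + ∑ n ∈ Finset.Ioc 0 N, (if 4 ≤ cardFactors n then f (ratio n) else 0) := by
  rw [Finset.mul_sum, ← Finset.sum_add_distrib, ← Finset.sum_add_distrib, ← Finset.sum_add_distrib]
  refine Finset.sum_subset_zero_on_sdiff ?_ ?_ ?_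
  · intro n hn
    simp only [Finset.mem_Icc, Finset.mem_Ioc] at hn ⊢
    omega
  · intro n hn
    simp only [Finset.mem_sdiff, Finset.mem_Icc, Finset.mem_Ioc] at hn
    obtain rfl : n = 1 := by omega
    simp [layer, Nat.not_prime_one]
  · intro n hn
    simp only [Finset.mem_Icc] at hn
    have hpos : cardFactors n ≠ 0 := by
      rw [Ne, cardFactors_eq_zero_iff_eq_zero_or_one]
      omega
    by_cases hp : n.Prime
    · simp [layer, hp, cardFactors_apply_prime hp, ratio_of_prime hp]
    · have h1 : cardFactors n ≠ 1 := fun h => hp (cardFactors_eq_one_iff_prime.1 h)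
      simp only [layer, if_neg hp, mul_zero, zero_add]
      by_cases h4 : 4 ≤ cardFactors n
      · simp [h4, show cardFactors n ≠ 2 by omega, show cardFactors n ≠ 3 by omega]
      · obtain h | h : cardFactors n = 2 ∨ cardFactors n = 3 := by omega
        all_goals simp [h]

theorem sum_comp_ratio_isLittleO {f : ℝ → ℝ} {K : ℝ} (hm : Monotone f) (hc : Continuous f)
    (h0 : ∀ t, 0 ≤ f t) (hK : ∀ t, 0 ≤ t → f t ≤ K * t) :
    (fun x : ℝ => ∑ n ∈ Finset.Icc 2 ⌊x⌋₊, f (ratio n) - mainTerm f x)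
      =o[atTop] fun x : ℝ => x / Real.log x ^ 3 := by
  have h4 : (fun x : ℝ => ∑ n ∈ Finset.Ioc 0 ⌊x⌋₊, (if 4 ≤ cardFactors n then f (ratio n) else 0))
      =o[atTop] fun x : ℝ => x / Real.log x ^ 3 := by
    refine (Asymptotics.IsBigO.of_bound K (Eventually.of_forall fun x => ?_)).trans_isLittleO
      sum_ratio_isLittleO
    rw [Real.norm_of_nonneg (Finset.sum_nonneg fun n _ => by split_ifs; exacts [h0 _, le_rfl]),
      Real.norm_of_nonneg (Finset.sum_nonneg fun n _ => by
        split_ifs; exacts [ratio_nonneg n, le_rfl]), Finset.mul_sum]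
    refine Finset.sum_le_sum fun n _ => ?_
    split_ifs
    exacts [hK _ (ratio_nonneg n), by simp]
  have h := (((primeSum_isLittleO.const_mul_left (f 1)).add
    (sum_layer_two_isLittleO hm hc h0 hK)).add (sum_layer_three_isLittleO hm hc h0 hK)).add h4
  refine h.congr_left fun x => ?_
  rw [sum_ratio_eq_sum_layers, mainTerm, primeSum]
  ring

/-- The sum of a power series, extended to be constant outside `[0, 1]`. -/
noncomputable def clampedSeries (b : ℕ → ℝ) (t : ℝ) : ℝ := ∑' i, b i * (max 0 (min t 1)) ^ i

section ClampedSeries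

variable {b : ℕ → ℝ}

lemma clamp_mem (t : ℝ) : max 0 (min t 1) ∈ Icc (0 : ℝ) 1 := by simp

lemma summable_clamped (hb : ∀ i, 0 ≤ b i) (hs : Summable b) (t : ℝ) :
    Summable fun i => b i * (max 0 (min t 1)) ^ i :=
  Summable.of_nonneg_of_le (fun i => mul_nonneg (hb i) (pow_nonneg (clamp_mem t).1 i))
    (fun i => mul_le_of_le_one_right (hb i) (pow_le_one₀ (clamp_mem t).1 (clamp_mem t).2)) hs

lemma clampedSeries_mono (hb : ∀ i, 0 ≤ b i) (hs : Summable b) : Monotone (clampedSeries b) := by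
  intro s t hst
  refine (summable_clamped hb hs s).tsum_le_tsum (fun i => ?_) (summable_clamped hb hs t)
  exact mul_le_mul_of_nonneg_left (pow_le_pow_left₀ (clamp_mem s).1 (by gcongr) i) (hb i)

lemma clampedSeries_continuous (hb : ∀ i, 0 ≤ b i) (hs : Summable b) :
    Continuous (clampedSeries b) := by
  refine continuous_tsum (fun i => by fun_prop) hs fun i t => ?_
  rw [Real.norm_of_nonneg (mul_nonneg (hb i) (pow_nonneg (clamp_mem t).1 i))]
  exact mul_le_of_le_one_right (hb i) (pow_le_one₀ (clamp_mem t).1 (clamp_mem t).2)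

lemma clampedSeries_nonneg (hb : ∀ i, 0 ≤ b i) (t : ℝ) : 0 ≤ clampedSeries b t :=
  tsum_nonneg fun i => mul_nonneg (hb i) (pow_nonneg (clamp_mem t).1 i)

lemma clampedSeries_le (hb : ∀ i, 0 ≤ b i) (hs : Summable b) (h0 : b 0 = 0) {t : ℝ}
    (ht : 0 ≤ t) : clampedSeries b t ≤ (∑' i, b i) * t := by
  rw [← tsum_mul_right]
  refine (summable_clamped hb hs t).tsum_le_tsum (fun i => ?_) (hs.mul_right t)
  rcases Nat.eq_zero_or_pos i with rfl | hi
  · simp [h0]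
  · refine mul_le_mul_of_nonneg_left ?_ (hb i)
    refine (pow_le_of_le_one (clamp_mem t).1 (clamp_mem t).2 hi.ne').trans ?_
    simp [ht]

end ClampedSeries

lemma integral_div_sub {f g h : ℝ → ℝ} {a b : ℝ} (hab : a ≤ b) (w : ℝ → ℝ)
    (hf : ∀ t ∈ Ioc a b, f t = g t - h t)
    (hg : IntervalIntegrable (fun t => g t / w t) volume a b)
    (hh : IntervalIntegrable (fun t => h t / w t) volume a b) :
    ∫ t in a..b, f t / w t = (∫ t in a..b, g t / w t) - ∫ t in a..b, h t / w t := by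
  rw [← intervalIntegral.integral_sub hg hh]
  refine intervalIntegral.integral_congr_ae (Eventually.of_forall fun t ht => ?_)
  rw [uIoc_of_le hab] at ht
  simp only [hf t ht, sub_div]

lemma intervalIntegrable_div_mul {f : ℝ → ℝ} {s : ℝ} (hs : s ∈ Ioc (0 : ℝ) 1)
    (hf : IntervalIntegrable (fun t => f t / t) volume 0 1) :
    IntervalIntegrable (fun t => f t / (s * t)) volume 0 s := by
  have := (hf.mono_set (c := 0) (d := s) (by
    rw [uIcc_of_le hs.1.le, uIcc_of_le zero_le_one]; exact Icc_subset_Icc_right hs.2)).div_const s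
  refine this.congr fun t _ => ?_
  simp only [div_div, mul_comm]

lemma mainTerm_sub {f g h : ℝ → ℝ} (hf : ∀ t ∈ Icc (0 : ℝ) 1, f t = g t - h t)
    (hg : IntervalIntegrable (fun t => g t / t) volume 0 1)
    (hh : IntervalIntegrable (fun t => h t / t) volume 0 1)
    (hg2 : IntervalIntegrable (fun s => ∫ t in (0 : ℝ)..s, g t / (s * t)) volume 0 1)
    (hh2 : IntervalIntegrable (fun s => ∫ t in (0 : ℝ)..s, h t / (s * t)) volume 0 1) (x : ℝ) :
    mainTerm f x = mainTerm g x - mainTerm h x := by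
  have h1 := integral_div_sub zero_le_one (fun t => t)
    (fun t ht => hf t (Ioc_subset_Icc_self ht)) hg hh
  have h2 : (∫ s in (0 : ℝ)..1, ∫ t in (0 : ℝ)..s, f t / (s * t)) =
      (∫ s in (0 : ℝ)..1, ∫ t in (0 : ℝ)..s, g t / (s * t)) -
        ∫ s in (0 : ℝ)..1, ∫ t in (0 : ℝ)..s, h t / (s * t) := by
    rw [← intervalIntegral.integral_sub hg2 hh2]
    refine intervalIntegral.integral_congr_ae (Eventually.of_forall fun s hs => ?_)
    rw [uIoc_of_le zero_le_one] at hs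
    exact integral_div_sub hs.1.le (fun t => s * t)
      (fun t ht => hf t ⟨ht.1.le, ht.2.trans hs.2⟩) (intervalIntegrable_div_mul hs hg)
      (intervalIntegrable_div_mul hs hh)
  rw [mainTerm, mainTerm, mainTerm, h1, h2, hf 1 ⟨zero_le_one, le_rfl⟩]
  ring

lemma summable_posPart {a : ℕ → ℝ} (ha : Summable fun i => |a i|) : Summable fun i => (a i)⁺ :=
  ha.of_nonneg_of_le (fun i => posPart_nonneg _) fun i => by rw [← posPart_add_negPart]; simp

lemma summable_negPart {a : ℕ → ℝ} (ha : Summable fun i => |a i|) : Summable fun i => (a i)⁻ :=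
  ha.of_nonneg_of_le (fun i => negPart_nonneg _) fun i => by rw [← posPart_add_negPart]; simp

lemma eq_clampedSeries_sub {f : ℝ → ℝ} {a : ℕ → ℝ} {r : ℝ} (hr : 1 < r)
    (hf : ∀ x : ℝ, |x| < r → HasSum (fun i => a i * x ^ i) (f x)) (ha : Summable fun i => |a i|)
    {t : ℝ} (ht : t ∈ Icc (0 : ℝ) 1) :
    f t = clampedSeries (fun i => (a i)⁺) t - clampedSeries (fun i => (a i)⁻) t := by
  have h1 := summable_clamped (b := fun i => (a i)⁺) (fun i => posPart_nonneg _)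
    (summable_posPart ha) t
  have h2 := summable_clamped (b := fun i => (a i)⁻) (fun i => negPart_nonneg _)
    (summable_negPart ha) t
  rw [clampedSeries, clampedSeries, ← h1.tsum_sub h2,
    ← (hf t (by rw [abs_of_nonneg ht.1]; linarith [ht.2])).tsum_eq]
  refine tsum_congr fun i => ?_
  rw [← sub_mul, posPart_sub_negPart, min_eq_left ht.2, max_eq_right ht.1]

theorem sum_powerSeries_ratio_isLittleO {f : ℝ → ℝ} {a : ℕ → ℝ} {r : ℝ} (hr : 1 < r)
    (ha0 : a 0 = 0) (hf : ∀ x : ℝ, |x| < r → HasSum (fun i => a i * x ^ i) (f x)) :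
    (fun x : ℝ => ∑ n ∈ Finset.Icc 2 ⌊x⌋₊, f (ratio n) - mainTerm f x)
      =o[atTop] fun x : ℝ => x / Real.log x ^ 3 := by
  have ha : Summable fun i => |a i| := by
    have := (hf 1 (by simpa using hr)).summable
    simpa using this.abs
  have hp : Summable fun i => (a i)⁺ := summable_posPart ha
  have hn : Summable fun i => (a i)⁻ := summable_negPart ha
  have key {b : ℕ → ℝ} (hb : ∀ i, 0 ≤ b i) (hs : Summable b) (h0 : b 0 = 0) :=
    sum_comp_ratio_isLittleO (clampedSeries_mono hb hs) (clampedSeries_continuous hb hs)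
      (clampedSeries_nonneg hb) fun t ht => clampedSeries_le hb hs h0 ht
  have int1 {b : ℕ → ℝ} (hb : ∀ i, 0 ≤ b i) (hs : Summable b) (h0 : b 0 = 0) :=
    intervalIntegrable_div_id (clampedSeries_continuous hb hs)
      (clampedSeries_nonneg hb) fun t ht => clampedSeries_le hb hs h0 ht
  have int2 {b : ℕ → ℝ} (hb : ∀ i, 0 ≤ b i) (hs : Summable b) (h0 : b 0 = 0) :=
    intervalIntegrable_inner (clampedSeries_continuous hb hs)
      (clampedSeries_nonneg hb) fun t ht => clampedSeries_le hb hs h0 ht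
  have p0 : ∀ i, 0 ≤ (a i)⁺ := fun i => posPart_nonneg _
  have n0 : ∀ i, 0 ≤ (a i)⁻ := fun i => negPart_nonneg _
  have z1 : (a 0)⁺ = 0 := by simp [ha0]
  have z2 : (a 0)⁻ = 0 := by simp [ha0]
  have hfs {t : ℝ} (ht : t ∈ Set.Icc (0 : ℝ) 1) := eq_clampedSeries_sub hr hf ha ht
  refine ((key p0 hp z1).sub (key n0 hn z2)).congr_left fun x => ?_
  have hsum : ∑ n ∈ Finset.Icc 2 ⌊x⌋₊, f (ratio n) =
      ∑ n ∈ Finset.Icc 2 ⌊x⌋₊, clampedSeries (fun i => (a i)⁺) (ratio n) -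
        ∑ n ∈ Finset.Icc 2 ⌊x⌋₊, clampedSeries (fun i => (a i)⁻) (ratio n) := by
    rw [← Finset.sum_sub_distrib]
    exact Finset.sum_congr rfl fun n _ => hfs ⟨ratio_nonneg n, ratio_le_one n⟩
  rw [hsum, mainTerm_sub (fun t ht => hfs ht) (int1 p0 hp z1) (int1 n0 hn z2) (int2 p0 hp z1)
    (int2 n0 hn z2)]
  ring

end

end SmallLargePrime

open Filter Finset

/-- If `f` is real analytic, given by a power series `Σ_{i} a_i x^i` with `a 0 = 0`
(so `f 0 = 0`) whose radius of convergence is `> 1`, then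
`S_f(x) = Σ_{1 < n ≤ x} f(p(n)/P(n))` satisfies
`S_f(x) = f(1)·x/log x + (2∫₀¹ f(t)/t dt + f(1))·x/log²x
  + (9∫₀¹∫₀ˢ f(t)/(st) dt ds + 4∫₀¹ f(t)/t dt + 2f(1))·x/log³x + o(x/log³x)`. -/
theorem avg_analytic_ratio_smallest_largest_prime
    (f : ℝ → ℝ) (a : ℕ → ℝ) (r : ℝ) (hr : 1 < r) (ha0 : a 0 = 0) (hf0 : f 0 = 0)
    (hf : ∀ x : ℝ, |x| < r → HasSum (fun i => a i * x ^ i) (f x)) :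
    (fun x : ℝ =>
        (∑ n ∈ Finset.Icc 2 ⌊x⌋₊,
            f ((n.minFac : ℝ) / ((n.primeFactors.sup id : ℕ) : ℝ)))
        - (f 1 * (x / Real.log x)
          + (2 * (∫ t in (0:ℝ)..1, f t / t) + f 1) * (x / Real.log x ^ 2)
          + (9 * (∫ s in (0:ℝ)..1, ∫ t in (0:ℝ)..s, f t / (s * t))
              + 4 * (∫ t in (0:ℝ)..1, f t / t) + 2 * f 1) * (x / Real.log x ^ 3)))
      =o[atTop] (fun x : ℝ => x / Real.log x ^ 3) :=
  SmallLargePrime.sum_powerSeries_ratio_isLittleO hr ha0 hf
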